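/- There exist constants γ ∈ (0,1] and N, depending only on δ, K, and d, such that if L ∈ 𝔏_{δ,K}, u ∈ W^{1,2}_{d+1,loc}(C_{2,1}) ∩ C(C̄_{2,1}), and Lu = g − f in C_{2,1} with f ≥ 0, then ∫_{C_{1,1}(1,0)} |f|^γ dx dt ≤ N (∫_{C_{2,1}} |g₊|^{d+1} dx dt)^{γ/(d+1)} + N |u₊(0,0)|^γ + N sup_{∂'C_{2,1}} |u₋|^γ, where g₊, u₊, u₋ denote positive and negative parts. -/

import Mathlib

open MeasureTheory ENNReal Set

noncomputable section

/-- The Frobenius norm of a matrix, used as `|D²u|`. -/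
def frobNorm {d : ℕ} (m : Matrix (Fin d) (Fin d) ℝ) : ℝ :=
  Real.sqrt (∑ i, ∑ j, (m i j) ^ 2)

abbrev EE (d : ℕ) := EuclideanSpace ℝ (Fin d)
abbrev ZZ (d : ℕ) := ℝ × EuclideanSpace ℝ (Fin d)

def eb {d : ℕ} (i : Fin d) : EE d := EuclideanSpace.single i (1 : ℝ)

def dt {d : ℕ} (u : ZZ d → ℝ) (z : ZZ d) : ℝ := fderiv ℝ u z (1, 0)
def dx {d : ℕ} (u : ZZ d → ℝ) (z : ZZ d) (v : EE d) : ℝ := fderiv ℝ u z (0, v)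
def dxx {d : ℕ} (u : ZZ d → ℝ) (z : ZZ d) (v w : EE d) : ℝ :=
  fderiv ℝ (fderiv ℝ u) z (0, v) (0, w)

structure Adm {d : ℕ} (δ K : ℝ) (a : Matrix (Fin d) (Fin d) ℝ) (b : EE d) (c : ℝ) : Prop where
  lo : ∀ ξ : EE d, δ * ‖ξ‖ ^ 2 ≤ ∑ i, ∑ j, a i j * ξ i * ξ j
  up : ∀ ξ : EE d, ∑ i, ∑ j, a i j * ξ i * ξ j ≤ δ⁻¹ * ‖ξ‖ ^ 2
  bc : ‖b‖ + c ≤ K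
  c0 : 0 ≤ c

def Lop {d : ℕ} (a : Matrix (Fin d) (Fin d) ℝ) (b : EE d) (c : ℝ) (u : ZZ d → ℝ) (z : ZZ d) : ℝ :=
  dt u z + (∑ i, ∑ j, a i j * dxx u z (eb i) (eb j)) + dx u z b - c * u z

def Super {d : ℕ} (δ K : ℝ) (u : ZZ d → ℝ) (z : ZZ d) (v : ℝ) : Prop :=
  ∃ a b c, Adm δ K a b c ∧ Lop a b c u z ≤ v

/-- gradient in space -/
def grd {d : ℕ} (u : ZZ d → ℝ) (z : ZZ d) : EE d := WithLp.toLp 2 (fun i => dx u z (eb i))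

lemma sum_eb {d : ℕ} (v : EE d) : v = ∑ i, v i • eb i := by
  have := (EuclideanSpace.basisFun (Fin d) ℝ).sum_repr v
  simp only [EuclideanSpace.basisFun_apply, EuclideanSpace.basisFun_repr] at this
  exact this.symm

lemma dx_add {d : ℕ} (u : ZZ d → ℝ) (z : ZZ d) (v w : EE d) :
    dx u z (v + w) = dx u z v + dx u z w := by
  unfold dx
  rw [← map_add]; simp

lemma dx_smul {d : ℕ} (u : ZZ d → ℝ) (z : ZZ d) (c : ℝ) (v : EE d) :
    dx u z (c • v) = c * dx u z v := by
  unfold dx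
  rw [← smul_eq_mul, ← map_smul]; simp

lemma dx_sum {d : ℕ} (u : ZZ d → ℝ) (z : ZZ d) (v : EE d) :
    dx u z v = ∑ i, v i * dx u z (eb i) := by
  have h : ((0 : ℝ), v) = ∑ i, v i • ((0 : ℝ), (eb i : EE d)) := by
    apply Prod.ext
    · simp [Prod.fst_sum]
    · simp only [Prod.snd_sum, Prod.smul_snd]; exact sum_eb v
  unfold dx
  rw [h, map_sum]
  simp only [map_smul, smul_eq_mul]

lemma dx_eq_inner {d : ℕ} (u : ZZ d → ℝ) (z : ZZ d) (v : EE d) :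
    dx u z v = inner ℝ (grd u z) v := by
  rw [dx_sum]
  simp [grd, PiLp.inner_apply, mul_comm]

lemma grd_apply {d : ℕ} (u : ZZ d → ℝ) (z : ZZ d) (i : Fin d) : grd u z i = dx u z (eb i) := rfl

lemma dxx_sum {d : ℕ} (u : ZZ d → ℝ) (z : ZZ d) (v w : EE d) :
    dxx u z v w = ∑ i, ∑ j, v i * w j * dxx u z (eb i) (eb j) := by
  have h : ∀ v : EE d, ((0 : ℝ), v) = ∑ i, v i • ((0 : ℝ), (eb i : EE d)) := by
    intro v
    apply Prod.ext
    · simp [Prod.fst_sum]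
    · simp only [Prod.snd_sum, Prod.smul_snd]; exact sum_eb v
  unfold dxx
  rw [h v, h w]
  simp only [map_sum, map_smul, _root_.sum_apply, _root_.smul_apply, smul_eq_mul,
    Finset.mul_sum]
  rw [Finset.sum_comm]
  refine Finset.sum_congr rfl fun i _ => Finset.sum_congr rfl fun j _ => ?_
  ring

/-- determinant bound for symmetric positive semidefinite matrices -/
lemma det_le_of_psd {d : ℕ} {δ : ℝ} (hδ : 0 < δ) (a m : Matrix (Fin d) (Fin d) ℝ)
    (hm : m.PosSemidef)
    (lo : ∀ ξ : EE d, δ * ‖ξ‖ ^ 2 ≤ ∑ i, ∑ j, a i j * ξ i * ξ j) :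
    0 ≤ ∑ i, ∑ j, a i j * m i j ∧
    m.det ≤ (δ⁻¹ * ∑ i, ∑ j, a i j * m i j) ^ d ∧ 0 ≤ m.det := by
  have hH := hm.isHermitian
  set μ := hH.eigenvalues with hμ
  have hμ0 : ∀ i, 0 ≤ μ i := hm.eigenvalues_nonneg
  set q := hH.eigenvectorBasis with hq
  have hmij : ∀ i j, m i j = ∑ k, μ k * (q k i) * (q k j) := by
    intro i j
    have := hH.spectral_theorem
    have h2 := congrFun (congrFun this i) j
    rw [Unitary.conjStarAlgAut_apply, Matrix.mul_apply] at h2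
    rw [h2]
    refine Finset.sum_congr rfl fun k _ => ?_
    rw [Matrix.mul_diagonal]
    simp only [Matrix.star_apply, hq, hμ, Matrix.IsHermitian.eigenvectorUnitary_apply, Function.comp,
      star_trivial, RCLike.ofReal_real_eq_id, id]
    ring
  have hsum : ∑ i, ∑ j, a i j * m i j = ∑ k, μ k * ∑ i, ∑ j, a i j * (q k i) * (q k j) := by
    simp only [hmij, Finset.mul_sum]
    rw [Finset.sum_congr rfl fun i _ => Finset.sum_comm]
    rw [Finset.sum_comm]
    refine Finset.sum_congr rfl fun k _ => Finset.sum_congr rfl fun i _ =>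
      Finset.sum_congr rfl fun j _ => ?_
    ring
  have hlow : ∀ k, δ * μ k ≤ μ k * ∑ i, ∑ j, a i j * (q k i) * (q k j) := by
    intro k
    have := lo (q k)
    have h1 : ‖q k‖ = 1 := q.orthonormal.1 k
    rw [h1] at this
    nlinarith [hμ0 k]
  have hnn : ∀ k, 0 ≤ μ k * ∑ i, ∑ j, a i j * (q k i) * (q k j) := fun k =>
    le_trans (by have := hμ0 k; positivity) (hlow k)
  have hdet : m.det = ∏ i, μ i := by
    have := hH.det_eq_prod_eigenvalues
    simpa using this
  refine ⟨?_, ?_, ?_⟩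
  · rw [hsum]; exact Finset.sum_nonneg fun k _ => hnn k
  · rw [hdet, hsum]
    have : ∀ k ∈ Finset.univ, μ k ≤ δ⁻¹ * ∑ k, μ k * ∑ i, ∑ j, a i j * (q k i) * (q k j) := by
      intro k _
      have h1 : μ k * ∑ i, ∑ j, a i j * (q k i) * (q k j) ≤
          ∑ k, μ k * ∑ i, ∑ j, a i j * (q k i) * (q k j) :=
        Finset.single_le_sum (f := fun k => μ k * ∑ i, ∑ j, a i j * (q k i) * (q k j))
          (fun k _ => hnn k) (Finset.mem_univ k)
      rw [inv_mul_eq_div, le_div_iff₀ hδ]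
      have := hlow k
      linarith
    have := Finset.prod_le_prod (fun k _ => hμ0 k) this
    simpa using this
  · rw [hdet]; exact Finset.prod_nonneg fun k _ => hμ0 k

/-- determinant of the contact map derivative -/
lemma det_contact {d : ℕ} (τ : ℝ) (v y : EE d) (H : EE d →ₗ[ℝ] EE d)
    (T : ZZ d →ₗ[ℝ] ZZ d)
    (hT : ∀ s η, T (s, η) = (τ * s - inner ℝ (s • v + H η) y, s • v + H η)) :
    LinearMap.det T = τ * LinearMap.det H := by
  classical
  set b1 : Module.Basis Unit ℝ ℝ := Module.Basis.singleton Unit ℝ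
  set b2 := (EuclideanSpace.basisFun (Fin d) ℝ).toBasis
  -- shear
  let S : ZZ d →ₗ[ℝ] ZZ d := LinearMap.prod
    (LinearMap.fst ℝ ℝ (EE d) + ((innerSL ℝ y).toLinearMap ∘ₗ LinearMap.snd ℝ ℝ (EE d)))
    (LinearMap.snd ℝ ℝ (EE d))
  have hS : LinearMap.det S = 1 := by
    rw [← LinearMap.det_toMatrix (b1.prod b2)]
    have : LinearMap.toMatrix (b1.prod b2) (b1.prod b2) S =
      Matrix.fromBlocks 1 (Matrix.of fun _ j => inner ℝ y (b2 j)) 0 1 := by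
      ext i j
      rw [LinearMap.toMatrix_apply]
      rcases i with i | i <;> rcases j with j | j <;>
        simp [S, b1, b2, Matrix.one_apply]
    rw [this, Matrix.det_fromBlocks_zero₂₁]; simp
  have hST : LinearMap.det (S ∘ₗ T) = τ * LinearMap.det H := by
    rw [← LinearMap.det_toMatrix (b1.prod b2)]
    have : LinearMap.toMatrix (b1.prod b2) (b1.prod b2) (S ∘ₗ T) =
      Matrix.fromBlocks (Matrix.of fun _ _ => τ) 0 (Matrix.of fun i _ => v i)
        (LinearMap.toMatrix b2 b2 H) := by
      ext i j
      rw [LinearMap.toMatrix_apply]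
      rcases i with i | i <;> rcases j with j | j <;>
        simp [S, b1, b2, hT, LinearMap.toMatrix_apply, real_inner_comm]
    rw [this, Matrix.det_fromBlocks_zero₁₂, LinearMap.det_toMatrix]; simp
  rw [LinearMap.det_comp, hS, one_mul] at hST
  exact hST

/-- closed parabolic cylinder -/
def cyl {d : ℕ} (t0 T : ℝ) (y : EE d) (R : ℝ) : Set (ZZ d) := Icc t0 T ×ˢ Metric.closedBall y R

lemma isCompact_cyl {d : ℕ} (t0 T : ℝ) (y : EE d) (R : ℝ) : IsCompact (cyl t0 T y R) :=
  isCompact_Icc.prod (isCompact_closedBall y R)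

def C2on {d : ℕ} (w : ZZ d → ℝ) (s : Set (ZZ d)) : Prop := ∀ z ∈ s, ContDiffAt ℝ 2 w z

def Contact {d : ℕ} (w : ZZ d → ℝ) (t0 T : ℝ) (y : EE d) (R η : ℝ) : Set (ZZ d) :=
  {z | z ∈ cyl t0 T y R ∧ 0 < w z ∧ ‖grd w z‖ ≤ η ∧
    ∀ τ y', τ ∈ Icc z.1 T → y' ∈ Metric.closedBall y R → w (τ, y') ≤ w z + dx w z (y' - z.2)}

def Lg (d : ℕ) : (ZZ d →L[ℝ] ℝ) →L[ℝ] EE d :=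
  ∑ i, (ContinuousLinearMap.apply ℝ ℝ ((0 : ℝ), (eb i : EE d))).smulRight (eb i)

lemma Lg_apply {d : ℕ} (A : ZZ d →L[ℝ] ℝ) (i : Fin d) : Lg d A i = A (0, eb i) := by
  simp [Lg, eb, Pi.single_apply]

lemma grd_eq_Lg {d : ℕ} (w : ZZ d → ℝ) (z : ZZ d) : grd w z = Lg d (fderiv ℝ w z) := by
  ext i; rw [Lg_apply]; rfl

lemma C2on.continuousOn {d : ℕ} {w : ZZ d → ℝ} {s : Set (ZZ d)} (h : C2on w s) :
    ContinuousOn w s := fun z hz => (h z hz).continuousAt.continuousWithinAt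

lemma ContDiffAt.fderiv_diff {d : ℕ} {w : ZZ d → ℝ} {z : ZZ d} (h : ContDiffAt ℝ 2 w z) :
    ContDiffAt ℝ 1 (fderiv ℝ w) z := h.fderiv_right (by norm_num)

lemma C2on.grd_continuousOn {d : ℕ} {w : ZZ d → ℝ} {s : Set (ZZ d)} (h : C2on w s) :
    ContinuousOn (grd w) s := by
  intro z hz
  have h1 : ContinuousAt (fun z => Lg d (fderiv ℝ w z)) z :=
    (Lg d).continuous.continuousAt.comp (h z hz).fderiv_diff.continuousAt
  have : grd w = fun z => Lg d (fderiv ℝ w z) := by ext1 z; exact grd_eq_Lg w z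
  rw [this]; exact h1.continuousWithinAt

lemma contact_measurable {d : ℕ} {w : ZZ d → ℝ} {t0 T : ℝ} {y : EE d} {R η : ℝ}
    (hw : C2on w (cyl t0 T y R)) : MeasurableSet (Contact w t0 T y R η) := by
  have hc : IsClosed (cyl t0 T y R) := (isCompact_cyl t0 T y R).isClosed
  have hwc := hw.continuousOn
  have hgc := hw.grd_continuousOn
  have h1 : IsClosed (cyl t0 T y R ∩ w ⁻¹' (Iic 0)) := hwc.preimage_isClosed_of_isClosed hc isClosed_Iic
  have h2 : IsClosed (cyl t0 T y R ∩ (fun z => ‖grd w z‖) ⁻¹' (Iic η)) :=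
    hgc.norm.preimage_isClosed_of_isClosed hc isClosed_Iic
  have h3 : ∀ q : cyl t0 T y R, IsClosed (cyl t0 T y R ∩ (fun z : ZZ d => w (max q.1.1 z.1, q.1.2) -
      (w z + inner ℝ (grd w z) (q.1.2 - z.2))) ⁻¹' (Iic 0)) := by
    rintro ⟨q, hq⟩
    refine ContinuousOn.preimage_isClosed_of_isClosed ?_ hc isClosed_Iic
    refine ContinuousOn.sub ?_ (hwc.add (ContinuousOn.inner (𝕜 := ℝ) hgc (continuous_const.sub continuous_snd).continuousOn))
    refine hwc.comp (by fun_prop) ?_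
    intro z hz
    refine ⟨⟨le_trans hq.1.1 (le_max_left _ _), max_le hq.1.2 hz.1.2⟩, hq.2⟩
  have h4 := isClosed_iInter h3
  have : Contact w t0 T y R η = ((cyl t0 T y R ∩ (fun z => ‖grd w z‖) ⁻¹' (Iic η)) ∩
      ⋂ q : cyl t0 T y R, (cyl t0 T y R ∩ (fun z : ZZ d => w (max q.1.1 z.1, q.1.2) -
      (w z + inner ℝ (grd w z) (q.1.2 - z.2))) ⁻¹' (Iic 0))) \ (cyl t0 T y R ∩ w ⁻¹' (Iic 0)) := by
    ext z
    constructor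
    · rintro ⟨hz, hw0, hg, hcon⟩
      refine ⟨⟨⟨hz, hg⟩, mem_iInter.2 ?_⟩, fun h => absurd h.2 (not_le.2 hw0)⟩
      rintro ⟨q, hq⟩
      refine ⟨hz, ?_⟩
      have := hcon (max q.1 z.1) q.2 ⟨le_max_right _ _, max_le hq.1.2 hz.1.2⟩ hq.2
      rw [dx_eq_inner] at this
      simpa using this
    · rintro ⟨⟨⟨hz, hg⟩, hI⟩, hn⟩
      refine ⟨hz, ?_, hg, ?_⟩
      · by_contra h; exact hn ⟨hz, not_lt.1 h⟩
      · intro τ y' hτ hy'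
        have := (mem_iInter.1 hI ⟨(τ, y'), ⟨⟨le_trans hz.1.1 hτ.1, hτ.2⟩, hy'⟩⟩).2
        rw [dx_eq_inner]
        simp only [mem_preimage, mem_Iic, max_eq_left hτ.1] at this
        linarith
  rw [this]
  exact (h2.inter h4).measurableSet.diff h1.measurableSet

/-- line derivatives -/
lemma hasDerivAt_line {d : ℕ} {w : ZZ d → ℝ} {t : ℝ} {x v : EE d} {s : ℝ}
    (h : DifferentiableAt ℝ w (t, x + s • v)) :
    HasDerivAt (fun s : ℝ => w (t, x + s • v)) (dx w (t, x + s • v) v) s := by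
  have h1 : HasDerivAt (fun s : ℝ => ((t, x + s • v) : ZZ d)) (0, v) s := by
    refine HasDerivAt.prodMk (hasDerivAt_const s t) ?_
    simpa using ((hasDerivAt_id s).smul_const v).const_add x
  exact h.hasFDerivAt.comp_hasDerivAt s h1

lemma hasDerivAt_time {d : ℕ} {w : ZZ d → ℝ} {t : ℝ} {x : EE d}
    (h : DifferentiableAt ℝ w (t, x)) :
    HasDerivAt (fun s : ℝ => w (s, x)) (dt w (t, x)) t := by
  have h1 : HasDerivAt (fun s : ℝ => ((s, x) : ZZ d)) (1, 0) t :=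
    HasDerivAt.prodMk (hasDerivAt_id t) (hasDerivAt_const t x)
  exact h.hasFDerivAt.comp_hasDerivAt t h1

lemma hasDerivAt_dx_line {d : ℕ} {w : ZZ d → ℝ} {t : ℝ} {x v v' : EE d}
    (h : ContDiffAt ℝ 2 w (t, x)) :
    HasDerivAt (fun s : ℝ => dx w (t, x + s • v) v') (dxx w (t, x) v v') 0 := by
  have h1 : HasDerivAt (fun s : ℝ => ((t, x + s • v) : ZZ d)) (0, v) 0 := by
    refine HasDerivAt.prodMk (hasDerivAt_const _ t) ?_
    simpa using ((hasDerivAt_id (0:ℝ)).smul_const v).const_add x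
  have h2 : HasFDerivAt (fderiv ℝ w) (fderiv ℝ (fderiv ℝ w) (t, x)) ((t, x + (0 : ℝ) • v) : ZZ d) := by
    simp only [zero_smul, add_zero]
    exact (h.fderiv_diff.differentiableAt (by norm_num)).hasFDerivAt
  have h3 := h2.comp_hasDerivAt (0 : ℝ) h1
  have h4 := h3.clm_apply (hasDerivAt_const (0 : ℝ) ((0 : ℝ), v'))
  simpa [dx, dxx, Function.comp_def] using h4

lemma C2_eventually_diff {d : ℕ} {w : ZZ d → ℝ} {z : ZZ d} (h : ContDiffAt ℝ 2 w z) :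
    ∀ᶠ z' in nhds z, DifferentiableAt ℝ w z' :=
  (h.eventually (by simp)).mono fun z' h' => h'.differentiableAt (by norm_num)

lemma tendsto_line {d : ℕ} (t : ℝ) (x v : EE d) :
    Filter.Tendsto (fun s : ℝ => ((t, x + s • v) : ZZ d)) (nhds 0) (nhds (t, x)) := by
  have : Continuous (fun s : ℝ => ((t, x + s • v) : ZZ d)) := by fun_prop
  simpa using this.tendsto 0

/-- second order condition at a point touched from above by an affine function. -/
lemma second_order {d : ℕ} {w : ZZ d → ℝ} {t : ℝ} {x v : EE d} (h : ContDiffAt ℝ 2 w (t, x))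
    (hle : ∀ᶠ x' in nhds x, w (t, x') ≤ w (t, x) + dx w (t, x) (x' - x)) :
    dxx w (t, x) v v ≤ 0 := by
  by_contra hpos
  push Not at hpos
  set q : ℝ → ℝ := fun s => w (t, x + s • v) - w (t, x) - s * dx w (t, x) v with hq
  have hdq : ∀ᶠ s in nhds (0 : ℝ), HasDerivAt q (dx w (t, x + s • v) v - dx w (t, x) v) s := by
    filter_upwards [(tendsto_line t x v).eventually (C2_eventually_diff h)] with s hs
    have := ((hasDerivAt_line hs).sub_const (w (t, x))).sub
      ((hasDerivAt_id s).mul_const (dx w (t, x) v))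
    exact HasDerivAt.congr_deriv this (by simp)
  have hder : deriv q =ᶠ[nhds 0] fun s => dx w (t, x + s • v) v - dx w (t, x) v :=
    hdq.mono fun s hs => hs.deriv
  have hd2 : HasDerivAt (deriv q) (dxx w (t, x) v v) 0 := by
    refine HasDerivAt.congr_of_eventuallyEq ?_ hder
    exact (hasDerivAt_dx_line h).sub_const _
  have hq0 : deriv q 0 = 0 := by rw [hder.eq_of_nhds]; simp
  have hmin : IsLocalMin q 0 := by
    refine isLocalMin_of_deriv_deriv_pos (by rw [hd2.deriv]; exact hpos) hq0 ?_
    exact hdq.self_of_nhds.continuousAt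
  have hmax : ∀ᶠ s in nhds (0 : ℝ), q s ≤ q 0 := by
    have hx : Filter.Tendsto (fun s : ℝ => x + s • v) (nhds 0) (nhds x) := by
      have : Continuous (fun s : ℝ => x + s • v) := by fun_prop
      simpa using this.tendsto 0
    filter_upwards [hx.eventually hle] with s hs
    simp only [hq]
    rw [add_sub_cancel_left, dx_smul] at hs
    simp; linarith
  have hconst : q =ᶠ[nhds 0] fun _ => q 0 := by
    filter_upwards [hmax, hmin] with s h1 h2
    exact le_antisymm h1 h2
  have h5 : deriv q =ᶠ[nhds 0] fun _ => 0 := by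
    have := hconst.deriv
    simpa using this
  have := hd2.deriv
  rw [h5.deriv_eq] at this
  simp at this
  linarith

lemma time_order {d : ℕ} {w : ZZ d → ℝ} {t T : ℝ} {x : EE d} (h : DifferentiableAt ℝ w (t, x)) (htT : t < T)
    (hle : ∀ τ ∈ Icc t T, w (τ, x) ≤ w (t, x)) : dt w (t, x) ≤ 0 := by
  by_contra hpos
  push Not at hpos
  have h1 := (hasDerivWithinAt_iff_tendsto_slope' (by simp)).1 ((hasDerivAt_time h).hasDerivWithinAt (s := Ioi t))
  have h2 : ∀ᶠ s in nhdsWithin t (Ioi t), 0 < slope (fun s => w (s, x)) t s := h1.eventually (lt_mem_nhds hpos)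
  have h3 : ∀ᶠ s in nhdsWithin t (Ioi t), s ∈ Ioo t T := Ioo_mem_nhdsGT htT
  obtain ⟨s, hs, hs2⟩ := (h2.and h3).exists
  rw [slope_def_field] at hs
  have h4 := hle s ⟨hs2.1.le, hs2.2.le⟩
  have : (w (s, x) - w (t, x)) / (s - t) ≤ 0 := div_nonpos_of_nonpos_of_nonneg (by linarith) (by linarith [hs2.1])
  linarith

/-- existence of contact points -/
lemma contact_exists {d : ℕ} {w : ZZ d → ℝ} {t0 T : ℝ} {y x0 : EE d} {R η M h : ℝ} {p : EE d}
    (hw : C2on w (cyl t0 T y R)) (ht : t0 ≤ T) (hx0 : x0 ∈ Metric.closedBall y R)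
    (hlat : ∀ t ∈ Icc t0 T, ∀ x, dist x y = R → w (t, x) ≤ 0)
    (htop : ∀ x ∈ Metric.closedBall y R, w (T, x) ≤ 0)
    (hM : M ≤ w (t0, x0)) (hη : η * (2 * R) ≤ M / 2) (hη0 : 0 ≤ η) (hh1 : M / 2 < h) (hh2 : h < M) (hp : ‖p‖ < η) :
    ∃ z ∈ Contact w t0 T y R η, z.1 < T ∧ z.2 ∈ Metric.ball y R ∧ grd w z = p ∧
      w z - dx w z (z.2 - x0) = h := by
  have hpos : ∀ x ∈ Metric.closedBall y R, 0 < h + inner ℝ p (x - x0) := by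
    intro x hx
    have h1 : |inner ℝ p (x - x0)| ≤ ‖p‖ * ‖x - x0‖ := abs_real_inner_le_norm _ _
    have h2 : ‖x - x0‖ ≤ 2 * R := by
      rw [← dist_eq_norm]
      have := dist_triangle_right x x0 y
      have h3 := Metric.mem_closedBall.1 hx
      have h4 := Metric.mem_closedBall.1 hx0
      linarith
    have h3 : ‖p‖ * ‖x - x0‖ ≤ η * (2 * R) := mul_le_mul hp.le h2 (norm_nonneg _) hη0
    have := (abs_le.1 (h1.trans h3)).1
    linarith
  set ψ : ZZ d → ℝ := fun z => w z - (h + inner ℝ p (z.2 - x0)) with hψ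
  have hψc : ContinuousOn ψ (cyl t0 T y R) := hw.continuousOn.sub (by fun_prop)
  have hcpt : IsCompact (cyl t0 T y R ∩ ψ ⁻¹' (Ici 0)) :=
    (isCompact_cyl t0 T y R).of_isClosed_subset
      (hψc.preimage_isClosed_of_isClosed (isCompact_cyl t0 T y R).isClosed isClosed_Ici) inter_subset_left
  have hne : (cyl t0 T y R ∩ ψ ⁻¹' (Ici 0)).Nonempty := by
    refine ⟨(t0, x0), ⟨⟨le_rfl, ht⟩, hx0⟩, ?_⟩
    simp [hψ]; linarith
  obtain ⟨⟨t, x⟩, ⟨hz, hz0⟩, hmax⟩ := hcpt.exists_isMaxOn hne (f := fun z : ZZ d => z.1) (by fun_prop)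
  have hx : x ∈ Metric.closedBall y R := hz.2
  have htI : t ∈ Icc t0 T := hz.1
  simp only [mem_preimage, mem_Ici, hψ] at hz0
  have htT : t < T := by
    rcases lt_or_eq_of_le htI.2 with h1 | h1
    · exact h1
    · subst h1
      have := htop x hx; have := hpos x hx; linarith
  have hxb : x ∈ Metric.ball y R := by
    rcases lt_or_eq_of_le (Metric.mem_closedBall.1 hx) with h1 | h1
    · exact h1
    · have := hlat t htI x h1; have := hpos x hx; linarith
  have hlate : ∀ τ, t < τ → τ ≤ T → ∀ y' ∈ Metric.closedBall y R, ψ (τ, y') < 0 := by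
    intro τ h1 h2 y' hy'
    by_contra hcon
    push Not at hcon
    have h3 : ((τ, y') : ZZ d) ∈ cyl t0 T y R ∩ ψ ⁻¹' (Ici 0) :=
      ⟨⟨⟨htI.1.trans h1.le, h2⟩, hy'⟩, hcon⟩
    have := hmax h3
    simp at this
    linarith
  have hnow : ∀ y' ∈ Metric.closedBall y R, ψ (t, y') ≤ 0 := by
    intro y' hy'
    have hm : ((t, y') : ZZ d) ∈ cyl t0 T y R := ⟨htI, hy'⟩
    have hca : ContinuousAt ψ (t, y') := by
      refine (hw _ hm).continuousAt.sub ?_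
      fun_prop
    have h1 : Filter.Tendsto (fun τ : ℝ => ψ (τ, y')) (nhdsWithin t (Ioi t)) (nhds (ψ (t, y'))) := by
      have : ContinuousAt (fun τ : ℝ => ψ (τ, y')) t :=
        ContinuousAt.comp (f := fun τ : ℝ => ((τ, y') : ZZ d)) hca (by fun_prop)
      exact this.tendsto.mono_left nhdsWithin_le_nhds
    refine le_of_tendsto h1 ?_
    filter_upwards [Ioo_mem_nhdsGT htT] with τ hτ
    exact (hlate τ hτ.1 hτ.2.le y' hy').le
  have heq : w (t, x) = h + inner ℝ p (x - x0) := by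
    have := hnow x hx
    simp only [hψ] at this
    linarith
  have hdxw : ∀ v, dx w (t, x) v = inner ℝ p v := by
    intro v
    have hda : DifferentiableAt ℝ w ((t, x + (0 : ℝ) • v) : ZZ d) := by
      simp only [zero_smul, add_zero]
      exact (hw (t, x) hz).differentiableAt (by norm_num)
    have h1 := (hasDerivAt_line hda).sub ((hasDerivAt_id (0 : ℝ)).mul_const (inner ℝ p v))
    have h2 : IsLocalMax ((fun s : ℝ => w (t, x + s • v)) - fun s => id s * inner ℝ p v) 0 := by
      have hx' : Filter.Tendsto (fun s : ℝ => x + s • v) (nhds 0) (nhds x) := by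
        have : Continuous (fun s : ℝ => x + s • v) := by fun_prop
        simpa using this.tendsto 0
      filter_upwards [hx'.eventually (Metric.isOpen_ball.mem_nhds hxb)] with s hs
      have := hnow _ (Metric.ball_subset_closedBall hs)
      simp only [hψ] at this
      simp only [Pi.sub_apply, zero_smul, add_zero, id]
      rw [heq]
      have e : x + s • v - x0 = (x - x0) + s • v := by abel
      rw [e, inner_add_right, inner_smul_right] at this
      linarith
    have h3 := h2.hasDerivAt_eq_zero h1
    simp only [zero_smul, add_zero, one_mul] at h3
    linarith
  have hgrd : grd w (t, x) = p := by
    apply ext_inner_right ℝ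
    intro v
    rw [← dx_eq_inner, hdxw]
  refine ⟨(t, x), ⟨hz, ?_, ?_, ?_⟩, htT, hxb, hgrd, ?_⟩
  · rw [heq]; exact hpos x hx
  · rw [hgrd]; exact hp.le
  · intro τ y' hτ hy'
    have : ψ (τ, y') ≤ 0 := by
      rcases lt_or_eq_of_le hτ.1 with h1 | h1
      · exact (hlate τ h1 hτ.2 y' hy').le
      · simp only at h1; rw [← h1]; exact hnow y' hy'
    simp only [hψ] at this
    rw [hdxw, heq]
    have e : y' - x0 = (x - x0) + (y' - x) := by abel
    rw [e, inner_add_right] at this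
    simp only
    linarith
  · simp only [hdxw, heq]; ring

lemma Lg_inner {d : ℕ} (A : ZZ d →L[ℝ] ℝ) (v : EE d) : A (0, v) = inner ℝ (Lg d A) v := by
  have h : ((0 : ℝ), v) = ∑ i, v i • ((0 : ℝ), (eb i : EE d)) := by
    apply Prod.ext
    · simp [Prod.fst_sum]
    · simp only [Prod.snd_sum, Prod.smul_snd]; exact sum_eb v
  rw [h, map_sum]
  simp only [map_smul, PiLp.inner_apply, Lg_apply]
  simp [mul_comm]

lemma contact_int {d : ℕ} {w : ZZ d → ℝ} {t0 T : ℝ} {y : EE d} {R η : ℝ}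
    (hlat : ∀ t ∈ Icc t0 T, ∀ x, dist x y = R → w (t, x) ≤ 0)
    (htop : ∀ x ∈ Metric.closedBall y R, w (T, x) ≤ 0) {z : ZZ d}
    (hz : z ∈ Contact w t0 T y R η) : z.1 < T ∧ z.2 ∈ Metric.ball y R := by
  obtain ⟨h1, h2, -, -⟩ := hz
  constructor
  · rcases lt_or_eq_of_le h1.1.2 with h | h
    · exact h
    · have := htop z.2 h1.2
      rw [← h] at this
      exact absurd this (not_le.2 h2)
  · rcases lt_or_eq_of_le (Metric.mem_closedBall.1 h1.2) with h | h
    · exact h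
    · exact absurd (hlat z.1 h1.1 z.2 h) (not_le.2 h2)

/-- pointwise information at contact points -/
lemma contact_pt {d : ℕ} {δ K : ℝ} (hδ : 0 < δ) {w : ZZ d → ℝ} {t0 T : ℝ} {y : EE d} {R η : ℝ}
    (hw : C2on w (cyl t0 T y R))
    {z : ZZ d} (hz : z ∈ Contact w t0 T y R η) (hzT : z.1 < T) (hzR : z.2 ∈ Metric.ball y R)
    {a : Matrix (Fin d) (Fin d) ℝ} {b : EE d} {c : ℝ} (hA : Adm δ K a b c) :
    Lop a b c w z ≤ K * η ∧
    |dt w z * (Matrix.of fun i j => dxx w z (eb i) (eb j)).det| ≤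
      δ⁻¹ ^ d * (K * η - Lop a b c w z) ^ (d + 1) := by
  obtain ⟨h1, h2, h3, h4⟩ := hz
  have hC := hw z h1
  have hdt : dt w z ≤ 0 := by
    refine time_order (w := w) (t := z.1) (x := z.2) (T := T) (hC.differentiableAt (by norm_num)) hzT ?_
    intro τ hτ
    have := h4 τ z.2 hτ (Metric.ball_subset_closedBall hzR)
    have e : dx w z (z.2 - z.2) = 0 := by
      rw [sub_self]; exact (fderiv ℝ w z).map_zero
    rw [e, add_zero] at this
    exact this
  have hdxx : ∀ v, dxx w z v v ≤ 0 := by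
    intro v
    refine second_order (w := w) (t := z.1) (x := z.2) hC ?_
    filter_upwards [Metric.isOpen_ball.mem_nhds hzR] with x' hx'
    exact h4 z.1 x' ⟨le_rfl, hzT.le⟩ (Metric.ball_subset_closedBall hx')
  have hsymm : ∀ v v', dxx w z v v' = dxx w z v' v := by
    intro v v'
    exact hC.isSymmSndFDerivAt (by simp) _ _
  set m : Matrix (Fin d) (Fin d) ℝ := Matrix.of fun i j => dxx w z (eb i) (eb j) with hm
  have hpsd : (-m).PosSemidef := by
    refine Matrix.PosSemidef.of_dotProduct_mulVec_nonneg ?_ ?_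
    · ext i j
      simp [hm, hsymm (eb i) (eb j)]
    · intro x
      have := hdxx (WithLp.toLp 2 x)
      rw [dxx_sum] at this
      simp only [dotProduct, Matrix.mulVec, star_trivial, Matrix.neg_apply, hm, Matrix.of_apply]
      have e : ∑ i, x i * ∑ j, -dxx w z (eb i) (eb j) * x j =
        - ∑ i, ∑ j, x i * x j * dxx w z (eb i) (eb j) := by
        simp only [Finset.mul_sum, ← Finset.sum_neg_distrib]
        refine Finset.sum_congr rfl fun i _ => Finset.sum_congr rfl fun j _ => ?_
        ring
      rw [e]
      simpa using this
  obtain ⟨e1, e2, e3⟩ := det_le_of_psd hδ a (-m) hpsd hA.lo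
  have hb : dx w z b - c * w z ≤ K * η := by
    rw [dx_eq_inner]
    have h5 : inner ℝ (grd w z) b ≤ ‖grd w z‖ * ‖b‖ := real_inner_le_norm _ _
    have h6 : ‖b‖ ≤ K := by have := hA.bc; have := hA.c0; linarith
    have h7 : ‖grd w z‖ * ‖b‖ ≤ η * K :=
      mul_le_mul h3 h6 (norm_nonneg _) ((norm_nonneg _).trans h3)
    have h8 := mul_nonneg hA.c0 h2.le
    linarith
  have hS : ∑ i, ∑ j, a i j * (-m) i j = - ∑ i, ∑ j, a i j * dxx w z (eb i) (eb j) := by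
    simp [hm, Finset.sum_neg_distrib]
  have hLop : Lop a b c w z = dt w z - (∑ i, ∑ j, a i j * (-m) i j) + (dx w z b - c * w z) := by
    rw [hS, Lop]; ring
  set σ := ∑ i, ∑ j, a i j * (-m) i j with hσ
  set s := K * η - Lop a b c w z with hs
  have hs1 : -dt w z ≤ s := by rw [hs, hLop]; linarith
  have hs2 : σ ≤ s := by rw [hs, hLop]; linarith
  refine ⟨by linarith, ?_⟩
  have hdet : |m.det| = (-m).det := by
    rw [Matrix.det_neg] at e3 ⊢
    have h9 : |(-1 : ℝ) ^ Fintype.card (Fin d) * m.det| = |m.det| := by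
      rw [abs_mul, abs_pow]; simp
    rw [← h9, abs_of_nonneg e3]
  rw [abs_mul, hdet, abs_of_nonpos hdt]
  have hδi : 0 ≤ δ⁻¹ := by positivity
  calc -dt w z * (-m).det ≤ s * (δ⁻¹ * s) ^ d := by
        refine mul_le_mul hs1 (e2.trans ?_) e3 (by linarith)
        gcongr
    _ = δ⁻¹ ^ d * s ^ (d + 1) := by rw [mul_pow]; ring

def PhiMap {d : ℕ} (w : ZZ d → ℝ) (x0 : EE d) (z : ZZ d) : ZZ d :=
  (w z - dx w z (z.2 - x0), grd w z)

lemma phi_deriv {d : ℕ} {w : ZZ d → ℝ} (x0 : EE d) {z : ZZ d} (h : ContDiffAt ℝ 2 w z) :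
    ∃ T : ZZ d →L[ℝ] ZZ d, HasFDerivAt (PhiMap w x0) T z ∧
      T.det = dt w z * (Matrix.of fun i j => dxx w z (eb i) (eb j)).det := by
  have hD1 : HasFDerivAt w (fderiv ℝ w z) z := (h.differentiableAt (by norm_num)).hasFDerivAt
  have hD2 : HasFDerivAt (fderiv ℝ w) (fderiv ℝ (fderiv ℝ w) z) z :=
    (h.fderiv_diff.differentiableAt (by norm_num)).hasFDerivAt
  set D1 := fderiv ℝ w z with hD1e
  set D2 := fderiv ℝ (fderiv ℝ w) z with hD2e
  have hu : HasFDerivAt (fun z : ZZ d => ((0 : ℝ), z.2 - x0))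
      ((0 : ZZ d →L[ℝ] ℝ).prod (ContinuousLinearMap.snd ℝ ℝ (EE d))) z :=
    (hasFDerivAt_const (0 : ℝ) z).prodMk (hasFDerivAt_snd.sub_const x0)
  have h1 := hD1.sub (hD2.clm_apply hu)
  have h2 : HasFDerivAt (grd w) ((Lg d).comp D2) z := by
    have : grd w = fun z => Lg d (fderiv ℝ w z) := by ext1 z; exact grd_eq_Lg w z
    rw [this]
    exact (Lg d).hasFDerivAt.comp z hD2
  refine ⟨_, h1.prodMk h2, ?_⟩
  set T := (D1 - (D1 ∘SL ((0 : ZZ d →L[ℝ] ℝ).prod (ContinuousLinearMap.snd ℝ ℝ (EE d)))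
    + D2.flip (0, z.2 - x0))).prod ((Lg d).comp D2) with hT
  let H : EE d →ₗ[ℝ] EE d := ((Lg d).comp (D2.comp (ContinuousLinearMap.inr ℝ ℝ (EE d)))).toLinearMap
  have hsplit : ∀ (s : ℝ) (η : EE d), ((s, η) : ZZ d) = s • ((1 : ℝ), (0 : EE d)) + (0, η) := by
    intro s η; simp
  have hTT : ∀ s η, T.toLinearMap (s, η) = (dt w z * s - inner ℝ (s • (Lg d (D2 (1, 0))) + H η) (z.2 - x0),
      s • (Lg d (D2 (1, 0))) + H η) := by
    intro s η
    have e : s • (Lg d (D2 (1, 0))) + H η = Lg d (D2 (s, η)) := by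
      rw [hsplit s η]
      simp only [map_add, map_smul]
      rfl
    rw [e, ← Lg_inner]
    apply Prod.ext
    · have : D1 (s, η) = s * dt w z + D1 (0, η) := by
        rw [hsplit s η, map_add, map_smul]; simp [dt, hD1e]
      simp [hT, this]
      ring
    · simp [hT]
  have hdet := det_contact (dt w z) (Lg d (D2 (1, 0))) (z.2 - x0) H T.toLinearMap hTT
  rw [ContinuousLinearMap.det]
  rw [show (T : ZZ d →ₗ[ℝ] ZZ d) = T.toLinearMap from rfl, hdet]
  congr 1
  classical
  rw [← LinearMap.det_toMatrix (EuclideanSpace.basisFun (Fin d) ℝ).toBasis, ← Matrix.det_transpose]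
  congr 1
  ext i j
  rw [Matrix.transpose_apply, LinearMap.toMatrix_apply]
  simp [H, Lg_apply, dxx, eb, hD2e]

instance volZ_haar (d : ℕ) : (volume : Measure (ZZ d)).IsAddHaarMeasure := by
  rw [Measure.volume_eq_prod]; infer_instance

/-- the ABP estimate -/
lemma abp {d : ℕ} {δ K : ℝ} (hδ : 0 < δ) {w q : ZZ d → ℝ} {t0 T : ℝ} {y x0 : EE d} {R η M : ℝ}
    (hw : C2on w (cyl t0 T y R)) (ht : t0 ≤ T) (hx0 : x0 ∈ Metric.closedBall y R)
    (hlat : ∀ t ∈ Icc t0 T, ∀ x, dist x y = R → w (t, x) ≤ 0)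
    (htop : ∀ x ∈ Metric.closedBall y R, w (T, x) ≤ 0)
    (hM : M ≤ w (t0, x0)) (hη : η * (2 * R) ≤ M / 2) (hη0 : 0 < η) (hM0 : 0 < M)
    (hL : ∀ z ∈ cyl t0 T y R, 0 < w z → ∃ a b c, Adm δ K a b c ∧ -q z ≤ Lop a b c w z) :
    (∀ z ∈ Contact w t0 T y R η, 0 ≤ q z + K * η) ∧
    ENNReal.ofReal (M / 2 * η ^ d) * volume (Metric.ball (0 : EE d) 1) ≤
      ∫⁻ z in Contact w t0 T y R η, ENNReal.ofReal (δ⁻¹ ^ d * (q z + K * η) ^ (d + 1)) := by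
  have key : ∀ z ∈ Contact w t0 T y R η, 0 ≤ q z + K * η ∧
      |dt w z * (Matrix.of fun i j => dxx w z (eb i) (eb j)).det| ≤
      δ⁻¹ ^ d * (q z + K * η) ^ (d + 1) := by
    intro z hz
    obtain ⟨a, b, c, hA, hLz⟩ := hL z hz.1 hz.2.1
    obtain ⟨i1, i2⟩ := contact_int hlat htop hz
    obtain ⟨j1, j2⟩ := contact_pt hδ hw hz i1 i2 hA
    refine ⟨by linarith, j2.trans ?_⟩
    have : 0 ≤ K * η - Lop a b c w z := by linarith
    gcongr
    linarith
  refine ⟨fun z hz => (key z hz).1, ?_⟩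
  have hms : MeasurableSet (Contact w t0 T y R η) := contact_measurable hw
  choose! F hF1 hF2 using fun z (hz : z ∈ cyl t0 T y R) => phi_deriv x0 (hw z hz)
  have himg := addHaar_image_le_lintegral_abs_det_fderiv (volume : Measure (ZZ d)) hms
    (f := PhiMap w x0) (f' := F) (fun z hz => (hF1 z hz.1).hasFDerivWithinAt)
  have hsub : Ioo (M / 2) M ×ˢ Metric.ball (0 : EE d) η ⊆ PhiMap w x0 '' (Contact w t0 T y R η) := by
    rintro ⟨h, p⟩ ⟨hh, hp⟩
    obtain ⟨z, hz, -, -, k1, k2⟩ := contact_exists hw ht hx0 hlat htop hM hη hη0.le hh.1 hh.2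
      (mem_ball_zero_iff.1 hp)
    exact ⟨z, hz, Prod.ext k2 k1⟩
  have hvol : volume (Ioo (M / 2) M ×ˢ Metric.ball (0 : EE d) η) =
      ENNReal.ofReal (M / 2 * η ^ d) * volume (Metric.ball (0 : EE d) 1) := by
    rw [Measure.volume_eq_prod, Measure.prod_prod, Real.volume_Ioo, Measure.addHaar_ball_of_pos _ _ hη0,
      finrank_euclideanSpace_fin, ← mul_assoc, ← ENNReal.ofReal_mul (by linarith)]
    congr 3; ring
  rw [← hvol]
  refine (measure_mono hsub).trans (himg.trans ?_)
  refine setLIntegral_mono' hms ?_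
  intro z hz
  rw [hF2 z hz.1]
  exact ENNReal.ofReal_le_ofReal (key z hz).2

lemma lint_bound {d : ℕ} {g : ZZ d → ℝ} {Γ S : Set (ZZ d)} (hΓ : MeasurableSet Γ) (hS : Γ ⊆ S)
    {D κ : ℝ} (hD : 0 ≤ D) (hκ : 0 ≤ κ) (hg : ∀ z ∈ Γ, 0 ≤ g z) :
    ∫⁻ z in Γ, ENNReal.ofReal (D * (g z + κ) ^ (d + 1)) ≤
      ENNReal.ofReal (D * 2 ^ d) * ((∫⁻ z in S, ENNReal.ofReal (g z) ^ (d + 1)) +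
        ENNReal.ofReal (κ ^ (d + 1)) * volume Γ) := by
  calc ∫⁻ z in Γ, ENNReal.ofReal (D * (g z + κ) ^ (d + 1))
      ≤ ∫⁻ z in Γ, ENNReal.ofReal (D * 2 ^ d) *
          (ENNReal.ofReal (g z) ^ (d + 1) + ENNReal.ofReal (κ ^ (d + 1))) := by
        refine setLIntegral_mono' hΓ fun z hz => ?_
        rw [← ENNReal.ofReal_pow (hg z hz), ← ENNReal.ofReal_add (by have := hg z hz; positivity) (by positivity),
          ← ENNReal.ofReal_mul (by positivity)]
        refine ENNReal.ofReal_le_ofReal ?_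
        have := add_pow_le (hg z hz) hκ (d + 1)
        simp only [Nat.add_sub_cancel] at this
        rw [mul_assoc]
        gcongr
    _ = ENNReal.ofReal (D * 2 ^ d) * ((∫⁻ z in Γ, ENNReal.ofReal (g z) ^ (d + 1)) +
        ENNReal.ofReal (κ ^ (d + 1)) * volume Γ) := by
        rw [lintegral_const_mul' _ _ ENNReal.ofReal_ne_top, lintegral_add_right _ measurable_const]
        simp
    _ ≤ _ := by
        gcongr

lemma vol_cyl {d : ℕ} (t0 T : ℝ) (y : EE d) (R : ℝ) :
    volume (cyl t0 T y R) = ENNReal.ofReal (T - t0) * volume (Metric.closedBall (0 : EE d) R) := by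
  unfold cyl
  rw [Measure.volume_eq_prod, Measure.prod_prod, Real.volume_Icc, Measure.addHaar_closedBall_center]

/-- unit ball volume -/
def vb (d : ℕ) : ℝ := (volume (Metric.ball (0 : EE d) 1)).toReal

lemma vb_pos (d : ℕ) : 0 < vb d :=
  ENNReal.toReal_pos (Metric.measure_ball_pos _ _ one_pos).ne' measure_ball_lt_top.ne

lemma vb_eq (d : ℕ) : volume (Metric.ball (0 : EE d) 1) = ENNReal.ofReal (vb d) :=
  (ENNReal.ofReal_toReal measure_ball_lt_top.ne).symm

def vR (d : ℕ) (R : ℝ) : ℝ := (volume (Metric.closedBall (0 : EE d) R)).toReal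

lemma vR_eq (d : ℕ) (R : ℝ) : volume (Metric.closedBall (0 : EE d) R) = ENNReal.ofReal (vR d R) :=
  (ENNReal.ofReal_toReal measure_closedBall_lt_top.ne).symm

lemma vR_nonneg (d : ℕ) (R : ℝ) : 0 ≤ vR d R := ENNReal.toReal_nonneg

/-- choice of small epsilon -/
lemma exists_eps {d : ℕ} {δ K R τ : ℝ} (hδ : 0 < δ) (hK : 0 ≤ K) (hR : 0 < R) (hτ : 0 ≤ τ) :
    ∃ ε : ℝ, 0 < ε ∧ ε * (2 * R) ≤ 1 / 2 ∧ ε ≤ 1 ∧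
      (δ⁻¹ ^ d * 2 ^ d) * (K * ε) ^ (d + 1) * (τ * vR d R) ≤ ε ^ d * vb d / 4 := by
  set B := (δ⁻¹ ^ d * 2 ^ d) * K ^ (d + 1) * (τ * vR d R) with hB
  have hB0 : 0 ≤ B := by have := vR_nonneg d R; positivity
  have hv := vb_pos d
  set ε := min (min (1 / (4 * R)) 1) (vb d / (4 * (B + 1))) with hε
  have h1 : ε ≤ 1 / (4 * R) := (min_le_left _ _).trans (min_le_left _ _)
  have h2 : ε ≤ vb d / (4 * (B + 1)) := min_le_right _ _
  have h3 : ε ≤ 1 := (min_le_left _ _).trans (min_le_right _ _)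
  have h0 : 0 < ε := lt_min (lt_min (by positivity) one_pos) (by positivity)
  refine ⟨ε, h0, ?_, h3, ?_⟩
  · rw [le_div_iff₀ (by positivity)] at h1; linarith
  · rw [le_div_iff₀ (by positivity)] at h2
    have : (δ⁻¹ ^ d * 2 ^ d) * (K * ε) ^ (d + 1) * (τ * vR d R) = ε ^ d * (B * ε) := by
      rw [hB, mul_pow]; ring
    rw [this, mul_div_assoc]
    gcongr
    nlinarith

/-- Maximum principle -/
lemma maxp {d : ℕ} {δ K R τ : ℝ} (hδ : 0 < δ) (hK : 0 ≤ K) (hR : 0 < R) (hτ : 0 ≤ τ) :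
    ∃ N : ℝ, 1 ≤ N ∧ ∀ (w g : ZZ d → ℝ) (t0 T : ℝ) (y x0 : EE d) (β : ℝ),
      C2on w (cyl t0 T y R) → t0 ≤ T → T - t0 ≤ τ → x0 ∈ Metric.closedBall y R →
      (∀ t ∈ Icc t0 T, ∀ x, dist x y = R → w (t, x) ≤ 0) →
      (∀ x ∈ Metric.closedBall y R, w (T, x) ≤ 0) →
      (∀ z ∈ cyl t0 T y R, 0 ≤ g z) →
      (∀ z ∈ cyl t0 T y R, 0 < w z → ∃ a b c, Adm δ K a b c ∧ -g z ≤ Lop a b c w z) →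
      0 ≤ β → ∫⁻ z in cyl t0 T y R, ENNReal.ofReal (g z) ^ (d + 1) ≤ ENNReal.ofReal (β ^ (d + 1)) →
      w (t0, x0) ≤ N * β := by
  obtain ⟨ε, hε0, hε1, -, hε2⟩ := exists_eps (d := d) hδ hK hR hτ
  set D := δ⁻¹ ^ d * 2 ^ d with hD
  have hD0 : 0 < D := by positivity
  have hv := vb_pos d
  set N := max 1 (4 * D / (ε ^ d * vb d)) with hN
  refine ⟨N, le_max_left _ _, ?_⟩
  intro w g t0 T y x0 β hw ht hTt hx0 hlat htop hg hL hβ hgint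
  have hN1 : 1 ≤ N := le_max_left _ _
  rcases le_or_gt (w (t0, x0)) 0 with hneg | hpos
  · exact hneg.trans (by positivity)
  set M := w (t0, x0) with hM
  have hA := abp (q := g) (η := ε * M) hδ hw ht hx0 hlat htop hM.le (by nlinarith) (by positivity) hpos hL
  have hms : MeasurableSet (Contact w t0 T y R (ε * M)) := contact_measurable hw
  have hsub : Contact w t0 T y R (ε * M) ⊆ cyl t0 T y R := fun z hz => hz.1
  have h1 := hA.2.trans (lint_bound hms hsub (by positivity) (by positivity) (fun z hz => hg z hz.1))
  have hvolle : volume (Contact w t0 T y R (ε * M)) ≤ ENNReal.ofReal (τ * vR d R) := by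
    refine (measure_mono hsub).trans ?_
    rw [vol_cyl, vR_eq, ← ENNReal.ofReal_mul (by linarith)]
    refine ENNReal.ofReal_le_ofReal ?_
    have := vR_nonneg d R
    gcongr
  have hVR := vR_nonneg d R
  have h2 : ENNReal.ofReal (M / 2 * (ε * M) ^ d * vb d) ≤
      ENNReal.ofReal (D * (β ^ (d + 1) + (K * (ε * M)) ^ (d + 1) * (τ * vR d R))) := by
    rw [ENNReal.ofReal_mul (by positivity), ← vb_eq]
    refine h1.trans ?_
    rw [ENNReal.ofReal_mul (by positivity : 0 ≤ D), ENNReal.ofReal_add (by positivity) (by positivity),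
      ENNReal.ofReal_mul (by positivity : 0 ≤ (K * (ε * M)) ^ (d + 1))]
    gcongr
  have h3 := (ENNReal.ofReal_le_ofReal_iff (by positivity)).1 h2
  have h4 : M ^ (d + 1) * (ε ^ d * vb d / 4) ≤ D * β ^ (d + 1) := by
    have e1 : M / 2 * (ε * M) ^ d * vb d = M ^ (d + 1) * (ε ^ d * vb d / 2) := by
      rw [mul_pow]; ring
    have e2 : D * (β ^ (d + 1) + (K * (ε * M)) ^ (d + 1) * (τ * vR d R)) =
      D * β ^ (d + 1) + M ^ (d + 1) * (D * (K * ε) ^ (d + 1) * (τ * vR d R)) := by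
      rw [← mul_assoc K, mul_pow _ M]; ring
    rw [e1, e2] at h3
    have := mul_le_mul_of_nonneg_left hε2 (by positivity : 0 ≤ M ^ (d + 1))
    linarith
  have h5 : M ^ (d + 1) ≤ N * β ^ (d + 1) := by
    have : M ^ (d + 1) ≤ 4 * D / (ε ^ d * vb d) * β ^ (d + 1) := by
      rw [div_mul_eq_mul_div, le_div_iff₀ (by positivity)]; linarith
    refine this.trans ?_
    gcongr
    exact le_max_right _ _
  have h6 : M ^ (d + 1) ≤ (N * β) ^ (d + 1) := by
    refine h5.trans ?_
    rw [mul_pow]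
    gcongr
    exact le_self_pow₀ hN1 (by simp)
  exact le_of_pow_le_pow_left₀ (by simp) (by positivity) h6

def barH {d : ℕ} (S : ℝ → ℝ) (ξ : ℝ → EE d) (z : ZZ d) : ℝ := S z.1 - ‖z.2 - ξ z.1‖ ^ 2

def bar {d : ℕ} (ω S : ℝ → ℝ) (ξ : ℝ → EE d) (z : ZZ d) : ℝ := ω z.1 * barH S ξ z ^ 3

lemma bar_C2 {d : ℕ} {ω S : ℝ → ℝ} {ξ : ℝ → EE d} {t : ℝ} (hω : ContDiffAt ℝ 2 ω t)
    (hS : ContDiffAt ℝ 2 S t) (hξ : ContDiffAt ℝ 2 ξ t) (x : EE d) :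
    ContDiffAt ℝ 2 (bar ω S ξ) (t, x) := by
  have h1 : ContDiffAt ℝ 2 (fun z : ZZ d => ω z.1) (t, x) := ContDiffAt.comp (t, x) (g := ω) hω contDiffAt_fst
  have h2 : ContDiffAt ℝ 2 (fun z : ZZ d => S z.1) (t, x) := ContDiffAt.comp (t, x) (g := S) hS contDiffAt_fst
  have h3 : ContDiffAt ℝ 2 (fun z : ZZ d => ξ z.1) (t, x) := ContDiffAt.comp (t, x) (g := ξ) hξ contDiffAt_fst
  exact h1.mul ((h2.sub ((contDiffAt_snd.sub h3).norm_sq ℝ)).pow 3)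

lemma bar_dx {d : ℕ} {ω S : ℝ → ℝ} {ξ : ℝ → EE d} {t : ℝ} {x : EE d}
    (h : DifferentiableAt ℝ (bar ω S ξ) (t, x)) (v : EE d) :
    dx (bar ω S ξ) (t, x) v = -6 * ω t * barH S ξ (t, x) ^ 2 * inner ℝ (x - ξ t) v := by
  have h0 : DifferentiableAt ℝ (bar ω S ξ) (t, x + (0 : ℝ) • v) := by simpa using h
  have h1 := hasDerivAt_line h0
  have h2 : HasDerivAt (fun s : ℝ => x + s • v - ξ t) v 0 := by
    simpa using (((hasDerivAt_id (0:ℝ)).smul_const v).const_add x).sub_const (ξ t)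
  have h3 := (((h2.norm_sq).const_sub (S t)).pow 3).const_mul (ω t)
  have h4 := h1.unique h3
  simp only [zero_smul, add_zero] at h4
  rw [h4]
  simp [barH]
  ring

lemma bar_dt {d : ℕ} {ω S : ℝ → ℝ} {ξ : ℝ → EE d} {t : ℝ} {x : EE d} {ω' S' : ℝ} {ξ' : EE d}
    (h : DifferentiableAt ℝ (bar ω S ξ) (t, x)) (hω : HasDerivAt ω ω' t) (hS : HasDerivAt S S' t)
    (hξ : HasDerivAt ξ ξ' t) :
    dt (bar ω S ξ) (t, x) = ω' * barH S ξ (t, x) ^ 3 +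
      3 * ω t * barH S ξ (t, x) ^ 2 * (S' + 2 * inner ℝ (x - ξ t) ξ') := by
  have h1 := hasDerivAt_time h
  have h2 := hω.mul ((hS.sub ((hξ.const_sub x).norm_sq)).pow 3)
  have h4 := h1.unique h2
  rw [h4]
  simp [barH]
  ring

lemma bar_dxx {d : ℕ} {ω S : ℝ → ℝ} {ξ : ℝ → EE d} {t : ℝ} {x : EE d}
    (h : ∀ x, ContDiffAt ℝ 2 (bar ω S ξ) (t, x)) (v v' : EE d) :
    dxx (bar ω S ξ) (t, x) v v' = 24 * ω t * barH S ξ (t, x) * inner ℝ (x - ξ t) v * inner ℝ (x - ξ t) v'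
      - 6 * ω t * barH S ξ (t, x) ^ 2 * inner ℝ v v' := by
  have h1 := hasDerivAt_dx_line (v := v) (v' := v') (h x)
  have e : (fun s : ℝ => dx (bar ω S ξ) (t, x + s • v) v') =
      fun s : ℝ => -6 * ω t * (S t - ‖x + s • v - ξ t‖ ^ 2) ^ 2 * inner ℝ (x + s • v - ξ t) v' := by
    ext s
    rw [bar_dx ((h _).differentiableAt (by norm_num))]
    rfl
  rw [e] at h1
  have h2 : HasDerivAt (fun s : ℝ => x + s • v - ξ t) v 0 := by
    simpa using (((hasDerivAt_id (0:ℝ)).smul_const v).const_add x).sub_const (ξ t)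
  have h3 := ((((h2.norm_sq).const_sub (S t)).pow 2).const_mul (-6 * ω t)).mul
    (h2.inner ℝ (hasDerivAt_const (0 : ℝ) v'))
  have h4 := h1.unique h3
  rw [h4]
  simp [barH]
  ring

lemma Adm.trace {d : ℕ} {δ K : ℝ} {a : Matrix (Fin d) (Fin d) ℝ} {b : EE d} {c : ℝ}
    (h : Adm δ K a b c) : ∑ i, a i i ≤ d * δ⁻¹ := by
  have : ∀ k ∈ (Finset.univ : Finset (Fin d)), a k k ≤ δ⁻¹ := by
    intro k _
    have h1 := h.up (eb k)
    have h2 : ‖(eb k : EE d)‖ = 1 := by simp [eb]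
    rw [h2] at h1
    simpa [eb, Pi.single_apply] using h1
  have := Finset.sum_le_sum this
  simpa using this

lemma Adm.quad {d : ℕ} {a : Matrix (Fin d) (Fin d) ℝ} (X : EE d) (p q : ℝ) :
    ∑ i, ∑ j, a i j * (p * inner ℝ X (eb i : EE d) * inner ℝ X (eb j : EE d) - q * inner ℝ (eb i : EE d) (eb j : EE d))
     = p * (∑ i, ∑ j, a i j * X i * X j) - q * ∑ i, a i i := by
  have h1 : ∀ i, inner ℝ X (eb i : EE d) = X i := by intro i; rw [eb, EuclideanSpace.inner_single_right]; simp
  have h2 : ∀ i j, inner ℝ (eb i : EE d) (eb j : EE d) = if i = j then (1 : ℝ) else 0 := by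
    intro i j; rw [eb, eb, EuclideanSpace.inner_single_right]; simp [Pi.single_apply, eq_comm]
  simp only [h1, h2, mul_sub, Finset.sum_sub_distrib, Finset.mul_sum]
  congr 1
  · refine Finset.sum_congr rfl fun i _ => Finset.sum_congr rfl fun j _ => ?_
    ring
  · refine Finset.sum_congr rfl fun i _ => ?_
    simp
    ring

def barB (d : ℕ) (δ K A : ℝ) : ℝ := 9 * A + 6 * d * δ⁻¹ + 7 * K
def barL (d : ℕ) (δ K A : ℝ) : ℝ := barB d δ K A * (24 * δ + barB d δ K A) / (24 * δ)

/-- formula for the operator on the barrier -/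
lemma bar_Lop {d : ℕ} {ω S : ℝ → ℝ} {ξ : ℝ → EE d} {t : ℝ} {x : EE d} {ω' S' : ℝ} {ξ' : EE d}
    (h : ∀ x, ContDiffAt ℝ 2 (bar ω S ξ) (t, x)) (hω : HasDerivAt ω ω' t) (hS : HasDerivAt S S' t)
    (hξ : HasDerivAt ξ ξ' t) (a : Matrix (Fin d) (Fin d) ℝ) (b : EE d) (c : ℝ) :
    Lop a b c (bar ω S ξ) (t, x) =
      ω' * barH S ξ (t, x) ^ 3 + ω t * barH S ξ (t, x) * (
        3 * barH S ξ (t, x) * (S' + 2 * inner ℝ (x - ξ t) ξ') +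
        24 * (∑ i, ∑ j, a i j * (x - ξ t) i * (x - ξ t) j) - 6 * barH S ξ (t, x) * (∑ i, a i i)
        - 6 * barH S ξ (t, x) * inner ℝ (x - ξ t) b - c * barH S ξ (t, x) ^ 2) := by
  unfold Lop
  have hd := (h x).differentiableAt (n := 2) (by norm_num)
  simp only [bar_dxx h, bar_dt hd hω hS hξ, bar_dx hd, Adm.quad]
  unfold bar
  ring

lemma bar_num {d : ℕ} {δ K A : ℝ} (hδ : 0 < δ) (hK : 0 ≤ K) (hA : 0 ≤ A)
    {a : Matrix (Fin d) (Fin d) ℝ} {b : EE d} {c : ℝ} (hAd : Adm δ K a b c)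
    {ω ω' S S' h : ℝ} {X ξ' : EE d} (hω : 0 ≤ ω) (hS1 : S ≤ 1) (hh : 0 < h) (hhX : h = S - ‖X‖ ^ 2)
    (hS' : |S'| ≤ A) (hξ' : ‖X‖ * ‖ξ'‖ ≤ A) (hω' : barL d δ K A * ω ≤ ω' * S) :
    0 ≤ ω' * h ^ 3 + ω * h * (3 * h * (S' + 2 * inner ℝ X ξ') +
        24 * (∑ i, ∑ j, a i j * X i * X j) - 6 * h * (∑ i, a i i)
        - 6 * h * inner ℝ X b - c * h ^ 2) := by
  set B := barB d δ K A with hB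
  have hB0 : 0 ≤ B := by rw [hB, barB]; positivity
  have hX2 : 0 ≤ ‖X‖ ^ 2 := by positivity
  have hhS : h ≤ S := by linarith
  have hS0 : 0 < S := by linarith
  have hX1 : ‖X‖ ≤ 1 := by
    have : ‖X‖ ^ 2 ≤ 1 := by linarith
    nlinarith [norm_nonneg X]
  have hb : ‖b‖ ≤ K := by have := hAd.bc; have := hAd.c0; linarith
  have hc : c ≤ K := by have := hAd.bc; have := norm_nonneg b; linarith
  have i1 : -A ≤ inner ℝ X ξ' := by
    have := (abs_le.1 ((abs_real_inner_le_norm X ξ').trans hξ')).1; exact this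
  have i2 : inner ℝ X b ≤ K := by
    refine (real_inner_le_norm X b).trans ?_
    calc ‖X‖ * ‖b‖ ≤ 1 * K := mul_le_mul hX1 hb (norm_nonneg _) zero_le_one
      _ = K := one_mul K
  have i3 := hAd.trace
  have i4 := hAd.lo X
  have i5 : -A ≤ S' := (abs_le.1 hS').1
  have i6 : c * h ≤ K := by
    calc c * h ≤ K * 1 := mul_le_mul hc (by linarith) hh.le hK
      _ = K := mul_one K
  -- lower bound of the bracket
  have j1 : 24 * δ * (S - h) - B * h ≤ 3 * h * (S' + 2 * inner ℝ X ξ') +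
        24 * (∑ i, ∑ j, a i j * X i * X j) - 6 * h * (∑ i, a i i)
        - 6 * h * inner ℝ X b - c * h ^ 2 := by
    have k1 : h * (-(3 * A)) ≤ h * (S' + 2 * inner ℝ X ξ') := mul_le_mul_of_nonneg_left (by linarith) hh.le
    have k2 : h * (∑ i, a i i) ≤ h * (d * δ⁻¹) := mul_le_mul_of_nonneg_left i3 hh.le
    have k3 : h * inner ℝ X b ≤ h * K := mul_le_mul_of_nonneg_left i2 hh.le
    have k4 : h * (c * h) ≤ h * K := mul_le_mul_of_nonneg_left i6 hh.le
    have k5 : ‖X‖ ^ 2 = S - h := by linarith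
    rw [k5] at i4
    have k6 : B * h = 9 * (h * A) + 6 * (h * (d * δ⁻¹)) + 7 * (h * K) := by rw [hB, barB]; ring
    have k7 : c * h ^ 2 = h * (c * h) := by ring
    rw [k6, k7]
    linarith
  set ℓ := barL d δ K A with hℓ
  have hℓe : ℓ * (24 * δ) = B * (24 * δ + B) := by
    rw [hℓ, barL, ← hB]; field_simp
  have hℓ0 : 0 ≤ ℓ := by rw [hℓ, barL, ← hB]; positivity
  -- combine
  have j2 : 0 ≤ ℓ * h ^ 2 + S * (24 * δ * (S - h) - B * h) := by
    by_cases hcase : B * h ≤ 24 * δ * (S - h)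
    · have : 0 ≤ 24 * δ * (S - h) - B * h := by linarith
      positivity
    · push Not at hcase
      have m1 : 24 * δ * S ≤ (24 * δ + B) * h := by linarith
      have m2 : B * S ≤ ℓ * h := by
        have : 24 * δ * (B * S) ≤ 24 * δ * (ℓ * h) := by
          calc 24 * δ * (B * S) = B * (24 * δ * S) := by ring
            _ ≤ B * ((24 * δ + B) * h) := by gcongr
            _ = (ℓ * (24 * δ)) * h := by rw [hℓe]; ring
            _ = _ := by ring
        exact le_of_mul_le_mul_left this (by positivity)
      have m3 : B * S * h ≤ ℓ * h * h := mul_le_mul_of_nonneg_right m2 hh.le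
      have m4 : 0 ≤ S * (24 * δ * (S - h)) := by
        have : 0 ≤ S - h := by linarith
        positivity
      nlinarith
  have j3 : ω * h * (24 * δ * (S - h) - B * h) ≤ ω * h * (3 * h * (S' + 2 * inner ℝ X ξ') +
        24 * (∑ i, ∑ j, a i j * X i * X j) - 6 * h * (∑ i, a i i)
        - 6 * h * inner ℝ X b - c * h ^ 2) := mul_le_mul_of_nonneg_left j1 (by positivity)
  refine le_trans ?_ (add_le_add_right j3 _)
  have j4 : 0 ≤ S * (ω' * h ^ 3 + ω * h * (24 * δ * (S - h) - B * h)) := by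
    have n1 : ℓ * ω * h ^ 3 ≤ ω' * S * h ^ 3 := mul_le_mul_of_nonneg_right hω' (by positivity)
    have n2 : 0 ≤ ω * h * (ℓ * h ^ 2 + S * (24 * δ * (S - h) - B * h)) := by positivity
    nlinarith
  exact nonneg_of_mul_nonneg_right j4 hS0

lemma Lop_lin {d : ℕ} {u v : ZZ d → ℝ} {z : ZZ d} (hu : ContDiffAt ℝ 2 u z) (hv : ContDiffAt ℝ 2 v z)
    (α β : ℝ) (a : Matrix (Fin d) (Fin d) ℝ) (b : EE d) (c : ℝ) :
    Lop a b c (fun z => α * u z + β * v z) z = α * Lop a b c u z + β * Lop a b c v z := by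
  have h1 : ∀ z', DifferentiableAt ℝ u z' → DifferentiableAt ℝ v z' →
      fderiv ℝ (fun z => α * u z + β * v z) z' = α • fderiv ℝ u z' + β • fderiv ℝ v z' := by
    intro z' h1 h2
    exact ((h1.hasFDerivAt.const_mul α).add (h2.hasFDerivAt.const_mul β)).fderiv
  have h2 : fderiv ℝ (fun z => α * u z + β * v z) =ᶠ[nhds z] fun z' => α • fderiv ℝ u z' + β • fderiv ℝ v z' := by
    filter_upwards [C2_eventually_diff hu, C2_eventually_diff hv] with z' h3 h4
    exact h1 z' h3 h4
  have h3 : fderiv ℝ (fderiv ℝ (fun z => α * u z + β * v z)) z =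
      α • fderiv ℝ (fderiv ℝ u) z + β • fderiv ℝ (fderiv ℝ v) z := by
    rw [h2.fderiv_eq]
    have hu2 := (hu.fderiv_diff.differentiableAt (by norm_num)).hasFDerivAt
    have hv2 := (hv.fderiv_diff.differentiableAt (by norm_num)).hasFDerivAt
    exact ((hu2.const_smul α).add (hv2.const_smul β)).fderiv
  have h4 := h1 z (hu.differentiableAt (by norm_num)) (hv.differentiableAt (by norm_num))
  have e1 : dt (fun z => α * u z + β * v z) z = α * dt u z + β * dt v z := by
    simp [dt, h4]
  have e2 : dx (fun z => α * u z + β * v z) z b = α * dx u z b + β * dx v z b := by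
    simp [dx, h4]
  have e3 : ∀ i j, dxx (fun z => α * u z + β * v z) z (eb i) (eb j) =
      α * dxx u z (eb i) (eb j) + β * dxx v z (eb i) (eb j) := by
    intro i j; simp [dxx, h3]
  unfold Lop
  simp only [e1, e2, e3, mul_add, Finset.sum_add_distrib]
  have e4 : ∀ (γ : ℝ) (v : ZZ d → ℝ), ∑ i, ∑ j, a i j * (γ * dxx v z (eb i) (eb j)) =
      γ * ∑ i, ∑ j, a i j * dxx v z (eb i) (eb j) := by
    intro γ v
    simp only [Finset.mul_sum]
    refine Finset.sum_congr rfl fun i _ => Finset.sum_congr rfl fun j _ => ?_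
    ring
  rw [e4, e4]
  ring

lemma C2_lin {d : ℕ} {u v : ZZ d → ℝ} {z : ZZ d} (hu : ContDiffAt ℝ 2 u z) (hv : ContDiffAt ℝ 2 v z)
    (α β : ℝ) : ContDiffAt ℝ 2 (fun z => α * u z + β * v z) z :=
  (contDiffAt_const.mul hu).add (contDiffAt_const.mul hv)

def MaxPr (d : ℕ) (δ K R τ N : ℝ) : Prop := ∀ (w g : ZZ d → ℝ) (t0 T : ℝ) (y x0 : EE d) (β : ℝ),
      C2on w (cyl t0 T y R) → t0 ≤ T → T - t0 ≤ τ → x0 ∈ Metric.closedBall y R →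
      (∀ t ∈ Icc t0 T, ∀ x, dist x y = R → w (t, x) ≤ 0) →
      (∀ x ∈ Metric.closedBall y R, w (T, x) ≤ 0) →
      (∀ z ∈ cyl t0 T y R, 0 ≤ g z) →
      (∀ z ∈ cyl t0 T y R, 0 < w z → ∃ a b c, Adm δ K a b c ∧ -g z ≤ Lop a b c w z) →
      0 ≤ β → ∫⁻ z in cyl t0 T y R, ENNReal.ofReal (g z) ^ (d + 1) ≤ ENNReal.ofReal (β ^ (d + 1)) →
      w (t0, x0) ≤ N * β

lemma exists_maxp (d : ℕ) {δ K R τ : ℝ} (hδ : 0 < δ) (hK : 0 ≤ K) (hR : 0 < R) (hτ : 0 ≤ τ) :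
    ∃ N : ℝ, 1 ≤ N ∧ MaxPr d δ K R τ N := maxp hδ hK hR hτ

lemma spread_gen {d : ℕ} {δ K R τ N A : ℝ} (hδ : 0 < δ) (hK : 0 ≤ K) (hA : 0 ≤ A)
    (hN : MaxPr d δ K R τ N)
    {u g : ZZ d → ℝ} {t0 t1 : ℝ} {y x0 : EE d} {β U : ℝ}
    (hu : C2on u (cyl t0 t1 y R)) (ht : t0 ≤ t1) (htτ : t1 - t0 ≤ τ) (hx0 : x0 ∈ Metric.closedBall y R)
    (hu0 : ∀ z ∈ cyl t0 t1 y R, 0 ≤ u z) (hg0 : ∀ z ∈ cyl t0 t1 y R, 0 ≤ g z)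
    (hsup : ∀ z ∈ cyl t0 t1 y R, Super δ K u z (g z)) (hβ : 0 ≤ β)
    (hgint : ∫⁻ z in cyl t0 t1 y R, ENNReal.ofReal (g z) ^ (d + 1) ≤ ENNReal.ofReal (β ^ (d + 1)))
    (hU : u (t0, x0) ≤ U) (hU0 : 0 ≤ U)
    {ω S ω' S' : ℝ → ℝ} {ξ ξ' : ℝ → EE d}
    (hω2 : ∀ t ∈ Icc t0 t1, ContDiffAt ℝ 2 ω t) (hS2 : ∀ t ∈ Icc t0 t1, ContDiffAt ℝ 2 S t)
    (hξ2 : ∀ t ∈ Icc t0 t1, ContDiffAt ℝ 2 ξ t)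
    (hω1 : ∀ t ∈ Icc t0 t1, HasDerivAt ω (ω' t) t) (hS1 : ∀ t ∈ Icc t0 t1, HasDerivAt S (S' t) t)
    (hξ1 : ∀ t ∈ Icc t0 t1, HasDerivAt ξ (ξ' t) t)
    (hω0 : ∀ t ∈ Icc t0 t1, 0 < ω t) (hS0 : ∀ t ∈ Icc t0 t1, 0 < S t) (hSle : ∀ t ∈ Icc t0 t1, S t ≤ 1)
    (hS'A : ∀ t ∈ Icc t0 t1, |S' t| ≤ A) (hξA : ∀ t ∈ Icc t0 t1, Real.sqrt (S t) * ‖ξ' t‖ ≤ A)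
    (hωl : ∀ t ∈ Icc t0 t1, barL d δ K A * ω t ≤ ω' t * S t)
    (htube : ∀ t ∈ Icc t0 t1, ‖ξ t - y‖ + Real.sqrt (S t) ≤ R)
    {m : ℝ} (hm : 0 < m) (hmb : m ≤ bar ω S ξ (t0, x0)) :
    ∃ x ∈ Metric.closedBall y R, ‖x - ξ t1‖ ^ 2 ≤ S t1 ∧
      u (t1, x) ≤ (U + N * β + 1) / m * (ω t1 * S t1 ^ 3) := by
  by_contra hcon
  push Not at hcon
  have ht1 : t1 ∈ Icc t0 t1 := ⟨ht, le_rfl⟩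
  have ht0 : t0 ∈ Icc t0 t1 := ⟨le_rfl, ht⟩
  have hNβ : 0 ≤ N * β := by
    have := hN (fun _ => 0) (fun _ => 0) t0 t1 y x0 β (fun z _ => contDiffAt_const) ht htτ hx0 (by simp) (by simp)
      (by simp) (by simp) hβ (by simp)
    simpa using this
  set s := (U + N * β + 1) / m with hs
  have hs0 : 0 < s := by positivity
  set w : ZZ d → ℝ := fun z => s * bar ω S ξ z + (-1) * u z with hw
  have hb2 : ∀ z ∈ cyl t0 t1 y R, ContDiffAt ℝ 2 (bar ω S ξ) z := by
    intro z hz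
    exact bar_C2 (hω2 _ hz.1) (hS2 _ hz.1) (hξ2 _ hz.1) z.2
  have hcube : ∀ h : ℝ, h ≤ 0 → h ^ 3 ≤ 0 := fun h hh => by
    have : h ^ 3 = h * h ^ 2 := by ring
    rw [this]; exact mul_nonpos_of_nonpos_of_nonneg hh (sq_nonneg h)
  have hbneg : ∀ z ∈ cyl t0 t1 y R, barH S ξ z ≤ 0 → w z ≤ 0 := by
    intro z hz hh
    have h1 := hu0 z hz
    have h2 : bar ω S ξ z ≤ 0 := mul_nonpos_of_nonneg_of_nonpos (hω0 _ hz.1).le (hcube _ hh)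
    have := mul_nonpos_of_nonneg_of_nonpos hs0.le h2
    simp only [hw]; linarith
  have key := hN w g t0 t1 y x0 β (fun z hz => C2_lin (hb2 z hz) (hu z hz) _ _) ht htτ hx0 ?_ ?_ hg0 ?_ hβ hgint
  · have h1 : s * m = U + N * β + 1 := by rw [hs]; field_simp
    have h2 := mul_le_mul_of_nonneg_left hmb hs0.le
    simp only [hw] at key
    linarith
  · intro t htt x hx
    refine hbneg (t, x) ⟨htt, by simp [hx]⟩ ?_
    simp only [barH]
    have h1 := htube t htt
    have h2 : R ≤ ‖x - ξ t‖ + ‖ξ t - y‖ := by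
      rw [← hx, dist_eq_norm]
      have := norm_add_le (x - ξ t) (ξ t - y)
      simpa using this
    have h3 : Real.sqrt (S t) ≤ ‖x - ξ t‖ := by linarith
    have h4 := (Real.sqrt_le_left (norm_nonneg _)).1 h3
    linarith
  · intro x hx
    by_cases hh : ‖x - ξ t1‖ ^ 2 ≤ S t1
    · have h1 := hcon x hx hh
      have h2 : bar ω S ξ (t1, x) ≤ ω t1 * S t1 ^ 3 := by
        simp only [bar, barH]
        have : 0 ≤ S t1 - ‖x - ξ t1‖ ^ 2 := by linarith
        have := (hω0 t1 ht1).le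
        gcongr
        have : 0 ≤ ‖x - ξ t1‖ ^ 2 := by positivity
        linarith
      have := mul_le_mul_of_nonneg_left h2 hs0.le
      simp only [hw]; linarith
    · refine hbneg (t1, x) ⟨ht1, hx⟩ ?_
      simp only [barH]; linarith
  · intro z hz hwz
    obtain ⟨a, b, c, hAd, hLu⟩ := hsup z hz
    refine ⟨a, b, c, hAd, ?_⟩
    rw [Lop_lin (hb2 z hz) (hu z hz)]
    have hh : 0 < barH S ξ z := by
      by_contra hneg
      exact absurd (hbneg z hz (not_lt.1 hneg)) (not_le.2 hwz)
    have hX : ‖z.2 - ξ z.1‖ ≤ Real.sqrt (S z.1) := by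
      apply Real.le_sqrt_of_sq_le
      simp only [barH] at hh; linarith
    have h1 : 0 ≤ Lop a b c (bar ω S ξ) z := by
      have := bar_Lop (x := z.2) (fun x => bar_C2 (hω2 _ hz.1) (hS2 _ hz.1) (hξ2 _ hz.1) x)
        (hω1 _ hz.1) (hS1 _ hz.1) (hξ1 _ hz.1) a b c
      rw [show z = (z.1, z.2) from rfl, this]
      refine bar_num hδ hK hA hAd (hω0 _ hz.1).le (hSle _ hz.1) hh rfl (hS'A _ hz.1) ?_ (hωl _ hz.1)
      refine le_trans ?_ (hξA _ hz.1)
      gcongr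
    have := mul_nonneg hs0.le h1
    linarith

/-- spreading along a tube of constant radius -/
lemma spread (d : ℕ) {δ K R τ σ ρ : ℝ} (hδ : 0 < δ) (hK : 0 ≤ K) (hR : 0 < R) (hσ : 0 < σ)
    (hστ : σ ≤ τ) (hρ : 0 < ρ) (hρ1 : ρ ≤ 1) :
    ∃ C : ℝ, 1 ≤ C ∧ ∀ (u g : ZZ d → ℝ) (t0 t1 : ℝ) (y x0 y1 : EE d) (β U : ℝ),
      C2on u (cyl t0 t1 y R) → σ ≤ t1 - t0 → t1 - t0 ≤ τ → ‖x0 - y‖ + ρ ≤ R → ‖y1 - y‖ + ρ ≤ R →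
      (∀ z ∈ cyl t0 t1 y R, 0 ≤ u z) → (∀ z ∈ cyl t0 t1 y R, 0 ≤ g z) →
      (∀ z ∈ cyl t0 t1 y R, Super δ K u z (g z)) → 0 ≤ β →
      (∫⁻ z in cyl t0 t1 y R, ENNReal.ofReal (g z) ^ (d + 1) ≤ ENNReal.ofReal (β ^ (d + 1))) →
      u (t0, x0) ≤ U → 0 ≤ U →
      ∃ x ∈ Metric.closedBall y R, ‖x - y1‖ ≤ ρ ∧ u (t1, x) ≤ C * (U + β + 1) := by
  obtain ⟨N, hN1, hN⟩ := exists_maxp d hδ hK hR (hσ.le.trans hστ)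
  set A := ρ * (2 * R) / σ with hA
  have hA0 : 0 ≤ A := by positivity
  have hL0 : 0 ≤ barL d δ K A := by unfold barL barB; positivity
  set l := barL d δ K A / ρ ^ 2 with hl
  have hl0 : 0 ≤ l := by positivity
  refine ⟨N * Real.exp (l * τ), one_le_mul_of_one_le_of_one_le hN1 (Real.one_le_exp (by nlinarith)), ?_⟩
  intro u g t0 t1 y x0 y1 β U hu h1 h2 hx0 hy1 hu0 hg0 hsup hβ hgint hU hU0
  have h01 : 0 < t1 - t0 := by linarith
  set e := (t1 - t0)⁻¹ • (y1 - x0) with he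
  have hx0' : x0 ∈ Metric.closedBall y R := by rw [mem_closedBall_iff_norm]; linarith
  obtain ⟨x, hx, hx1, hx2⟩ := spread_gen hδ hK hA0 hN hu (by linarith) h2 hx0' hu0 hg0 hsup hβ hgint hU hU0
    (ω := fun t => Real.exp (l * (t - t0))) (S := fun _ => ρ ^ 2) (ω' := fun t => l * Real.exp (l * (t - t0)))
    (S' := fun _ => 0) (ξ := fun t => x0 + (t - t0) • e) (ξ' := fun _ => e)
    (fun t _ => by fun_prop) (fun t _ => by fun_prop) (fun t _ => by fun_prop)
    (fun t _ => by
      have := (((hasDerivAt_id t).sub_const t0).const_mul l).exp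
      simpa [mul_comm] using this)
    (fun t _ => hasDerivAt_const t _)
    (fun t _ => by
      have := (((hasDerivAt_id t).sub_const t0).smul_const e).const_add x0
      simpa using this)
    (fun t _ => Real.exp_pos _) (fun t _ => by positivity) (fun t _ => by nlinarith)
    (fun t _ => by simpa using hA0)
    (fun t _ => by
      rw [Real.sqrt_sq hρ.le, he, norm_smul, norm_inv, Real.norm_of_nonneg h01.le, hA]
      have : ‖y1 - x0‖ ≤ 2 * R := by
        have h5 : y1 - x0 = (y1 - y) - (x0 - y) := by abel
        rw [h5]
        refine (norm_sub_le _ _).trans ?_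
        linarith
      have h6 : (t1 - t0)⁻¹ ≤ σ⁻¹ := by gcongr
      calc ρ * ((t1 - t0)⁻¹ * ‖y1 - x0‖) ≤ ρ * (σ⁻¹ * (2 * R)) := by gcongr
        _ = ρ * (2 * R) / σ := by ring)
    (fun t _ => by
      have : l * ρ ^ 2 = barL d δ K A := by rw [hl]; field_simp
      rw [mul_right_comm, this])
    (fun t ht => by
      rw [Real.sqrt_sq hρ.le]
      set θ := (t - t0) / (t1 - t0) with hθ
      have hθ0 : 0 ≤ θ := div_nonneg (by linarith [ht.1]) h01.le
      have hθ1 : θ ≤ 1 := by rw [hθ, div_le_one h01]; linarith [ht.2]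
      have : x0 + (t - t0) • e - y = (1 - θ) • (x0 - y) + θ • (y1 - y) := by
        rw [he, smul_smul, ← div_eq_mul_inv, ← hθ]
        module
      rw [this]
      have h5 := norm_add_le ((1 - θ) • (x0 - y)) (θ • (y1 - y))
      rw [norm_smul, norm_smul, Real.norm_of_nonneg hθ0, Real.norm_of_nonneg (by linarith : 0 ≤ 1 - θ)] at h5
      nlinarith)
    (m := (ρ ^ 2) ^ 3) (by positivity) (by simp [bar, barH])
  refine ⟨x, hx, ?_, ?_⟩
  · have : x0 + (t1 - t0) • e = y1 := by
      rw [he, smul_smul, mul_inv_cancel₀ h01.ne']; simp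
    simp only [this] at hx1
    exact le_of_sq_le_sq hx1 hρ.le
  · refine hx2.trans ?_
    have h5 : (U + N * β + 1) / (ρ ^ 2) ^ 3 * (Real.exp (l * (t1 - t0)) * (ρ ^ 2) ^ 3) =
        (U + N * β + 1) * Real.exp (l * (t1 - t0)) := by field_simp
    rw [h5]
    have h6 : U + N * β + 1 ≤ N * (U + β + 1) := by nlinarith
    calc (U + N * β + 1) * Real.exp (l * (t1 - t0)) ≤ (N * (U + β + 1)) * Real.exp (l * τ) := by
          gcongr
      _ = _ := by ring

lemma spread_bdry (d : ℕ) {δ K : ℝ} (hδ : 0 < δ) (hK : 0 ≤ K) :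
    ∃ (C : ℝ) (n : ℕ), 1 ≤ C ∧ ∀ (u g : ZZ d → ℝ) (t1 r : ℝ) (y1 : EE d) (β U : ℝ),
      C2on u (cyl 0 t1 0 1) → 1 / 2 ≤ t1 → t1 ≤ 2 → 0 < r → r ≤ 1 / 2 → ‖y1‖ + r ≤ 1 →
      (∀ z ∈ cyl 0 t1 0 1, 0 ≤ u z) → (∀ z ∈ cyl 0 t1 0 1, 0 ≤ g z) →
      (∀ z ∈ cyl 0 t1 0 1, Super δ K u z (g z)) → 0 ≤ β →
      (∫⁻ z in cyl 0 t1 0 1, ENNReal.ofReal (g z) ^ (d + 1) ≤ ENNReal.ofReal (β ^ (d + 1))) →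
      u (0, 0) ≤ U → 0 ≤ U →
      ∃ x ∈ Metric.closedBall 0 1, ‖x - y1‖ ≤ r ∧ u (t1, x) ≤ C * (U + β + 1) * r⁻¹ ^ n := by
  obtain ⟨N, hN1, hN⟩ := exists_maxp d hδ hK one_pos zero_le_two
  have hL0 : 0 ≤ barL d δ K (9 / 8) := by unfold barL barB; positivity
  obtain ⟨n, hn⟩ := exists_nat_gt (barL d δ K (9 / 8) * 32 / 9)
  have hn0 : (0 : ℝ) < n := lt_of_le_of_lt (by positivity) hn
  have hn1 : n ≠ 0 := by rintro rfl; simp at hn0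
  refine ⟨8 * N, 2 * n, by linarith, ?_⟩
  intro u g t1 r y1 β U hu ht1 ht2 hr hr2 hy1 hu0 hg0 hsup hβ hgint hU hU0
  set k := 9 / (16 * t1) with hk
  have hkt : k * t1 = 9 / 16 := by rw [hk]; field_simp
  have hk0 : 0 < k := by positivity
  have hk1 : k ≤ 9 / 8 := by nlinarith
  have hk2 : 9 / 32 ≤ k := by nlinarith
  set S : ℝ → ℝ := fun t => r ^ 2 + k * (t1 - t) with hS
  have hSr : ∀ t ∈ Icc 0 t1, r ^ 2 ≤ S t := fun t ht => by
    simp only [hS]; nlinarith [ht.2]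
  have hSpos : ∀ t ∈ Icc 0 t1, 0 < S t := fun t ht => lt_of_lt_of_le (by positivity) (hSr t ht)
  have hSle : ∀ t ∈ Icc 0 t1, S t ≤ 1 := fun t ht => by
    simp only [hS]; nlinarith [ht.1]
  have hSd : ∀ t, HasDerivAt S (-k) t := by
    intro t
    have := ((((hasDerivAt_id t).const_sub t1)).const_mul k).const_add (r ^ 2)
    exact this.congr_deriv (by simp)
  have hSc : ContDiff ℝ 2 S := by simp only [hS]; fun_prop
  have hr1 : 0 < 1 - r := by linarith
  have hsr : ∀ t ∈ Icc 0 t1, r ≤ Real.sqrt (S t) := fun t ht => Real.le_sqrt_of_sq_le (hSr t ht)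
  have hs1 : ∀ t ∈ Icc 0 t1, Real.sqrt (S t) ≤ 1 := fun t ht => Real.sqrt_le_one.2 (hSle t ht)
  have hy : ‖y1‖ ≤ 1 - r := by linarith
  have ht0 : (0 : ℝ) ∈ Icc 0 t1 := ⟨le_rfl, by linarith⟩
  have hξn : ∀ t ∈ Icc 0 t1, ‖((1 - Real.sqrt (S t)) / (1 - r)) • y1‖ ≤ 1 - Real.sqrt (S t) := by
    intro t ht
    have h1 := hs1 t ht
    rw [norm_smul, Real.norm_of_nonneg (div_nonneg (by linarith) hr1.le), div_mul_eq_mul_div,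
      div_le_iff₀ hr1]
    have : 0 ≤ 1 - Real.sqrt (S t) := by linarith
    gcongr
  obtain ⟨x, hx, hx1, hx2⟩ := spread_gen hδ hK (by norm_num : (0:ℝ) ≤ 9 / 8) hN hu (by linarith)
    (by linarith : t1 - 0 ≤ 2) (x0 := 0) (by simp) hu0 hg0 hsup hβ hgint hU hU0
    (ω := fun t => (S t ^ n)⁻¹) (S := S) (ω' := fun t => n * k * S t ^ (n - 1) / (S t ^ n) ^ 2)
    (S' := fun _ => -k) (ξ := fun t => ((1 - Real.sqrt (S t)) / (1 - r)) • y1)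
    (ξ' := fun t => (k / (2 * Real.sqrt (S t)) / (1 - r)) • y1)
    (fun t ht => (hSc.contDiffAt.pow n).inv (pow_ne_zero _ (hSpos t ht).ne')) (fun t ht => hSc.contDiffAt)
    (fun t ht => ((contDiffAt_const.sub (hSc.contDiffAt.sqrt (hSpos t ht).ne')).div_const _).smul contDiffAt_const)
    (fun t ht => by
      have := ((hSd t).pow n).inv (pow_ne_zero _ (hSpos t ht).ne')
      refine this.congr_deriv ?_
      simp; ring)
    (fun t _ => hSd t)
    (fun t ht => by
      have := ((((hSd t).sqrt (hSpos t ht).ne').const_sub 1).div_const (1 - r)).smul_const y1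
      refine this.congr_deriv ?_
      congr 1; ring)
    (fun t ht => by have := hSpos t ht; positivity) hSpos hSle
    (fun t _ => by rw [abs_neg, abs_of_pos hk0]; exact hk1)
    (fun t ht => by
      have h1 := hSpos t ht
      have h2 : 0 < Real.sqrt (S t) := Real.sqrt_pos.2 h1
      rw [norm_smul, Real.norm_of_nonneg (by positivity)]
      have h3 : Real.sqrt (S t) * (k / (2 * Real.sqrt (S t)) / (1 - r) * ‖y1‖) = k / 2 * (‖y1‖ / (1 - r)) := by
        field_simp
      rw [h3]
      have h4 : ‖y1‖ / (1 - r) ≤ 1 := by rw [div_le_one hr1]; exact hy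
      nlinarith)
    (fun t ht => by
      have h1 := hSpos t ht
      have h2 : n * k * S t ^ (n - 1) / (S t ^ n) ^ 2 * S t = n * k * (S t ^ n)⁻¹ := by
        have h3 : S t ^ n = S t ^ (n - 1) * S t := by rw [← pow_succ, Nat.sub_add_cancel (Nat.one_le_iff_ne_zero.2 hn1)]
        rw [h3]; field_simp
      rw [h2]
      gcongr
      rw [mul_div_assoc] at hn
      nlinarith)
    (fun t ht => by
      have := hξn t ht
      simp only [sub_zero]; linarith)
    (m := 1 / 8) (by norm_num)
    (by
      have h1 := hξn 0 ht0
      have e : S 0 = r ^ 2 + 9 / 16 := by simp only [hS]; rw [sub_zero, hkt]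
      have h2 : 3 / 4 ≤ Real.sqrt (S 0) := by
        apply Real.le_sqrt_of_sq_le; rw [e]; nlinarith
      simp only [bar, barH, zero_sub, norm_neg]
      have h3 : 1 ≤ (S 0 ^ n)⁻¹ := (one_le_inv₀ (pow_pos (hSpos 0 ht0) n)).2 (pow_le_one₀ (hSpos 0 ht0).le (hSle 0 ht0))
      set q := ‖((1 - Real.sqrt (S 0)) / (1 - r)) • y1‖ with hq
      have hq0 : 0 ≤ q := norm_nonneg _
      have h4 : 1 / 2 ≤ S 0 - q ^ 2 := by rw [e]; nlinarith
      have h5 : (1 / 2 : ℝ) ^ 3 ≤ (S 0 - q ^ 2) ^ 3 := by gcongr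
      nlinarith)
  have hSt1 : S t1 = r ^ 2 := by simp [hS]
  refine ⟨x, hx, ?_, ?_⟩
  · rw [hSt1, Real.sqrt_sq hr.le, div_self hr1.ne', one_smul] at hx1
    exact le_of_sq_le_sq hx1 hr.le
  · refine hx2.trans ?_
    simp only [hSt1]
    have h6 : U + N * β + 1 ≤ N * (U + β + 1) := by nlinarith
    have h7 : ((r ^ 2) ^ n)⁻¹ * (r ^ 2) ^ 3 ≤ r⁻¹ ^ (2 * n) := by
      rw [← pow_mul, ← inv_pow]
      have : (r ^ 2) ^ 3 ≤ 1 := pow_le_one₀ (by positivity) (by nlinarith)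
      have h8 : 0 ≤ r⁻¹ ^ (2 * n) := by positivity
      nlinarith
    have h9 : (U + N * β + 1) / (1 / 8) ≤ 8 * N * (U + β + 1) := by
      have : (U + N * β + 1) / (1 / 8) = 8 * (U + N * β + 1) := by ring
      rw [this]; linarith
    refine mul_le_mul h9 h7 (by positivity) (by positivity)

def omA (l t : ℝ) : ℝ := (1 - t) * Real.exp (l * t)
def omA' (l t : ℝ) : ℝ := l * omA l t - Real.exp (l * t)

lemma omA_deriv (l t : ℝ) : HasDerivAt (omA l) (omA' l t) t := by
  have := ((hasDerivAt_id t).const_sub 1).mul (((hasDerivAt_id t).const_mul l).exp)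
  refine this.congr_deriv ?_
  simp [omA', omA]; ring

lemma omA_C2 (l t : ℝ) : ContDiffAt ℝ 2 (omA l) t := by unfold omA; fun_prop

lemma omA_bd {l t : ℝ} (hl : 0 ≤ l) (h0 : 0 ≤ t) (h1 : t ≤ 1) : 0 ≤ omA l t ∧ omA l t ≤ Real.exp l := by
  unfold omA
  have h2 : Real.exp (l * t) ≤ Real.exp l := Real.exp_le_exp.2 (by nlinarith)
  have h3 := Real.exp_pos (l * t)
  constructor
  · exact mul_nonneg (by linarith) h3.le
  · nlinarith

lemma omA_lip {l t τ : ℝ} (hl : 0 ≤ l) (h0 : 0 ≤ t) (h1 : τ ≤ 1) (htτ : t ≤ τ) :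
    |omA l τ - omA l t| ≤ (l + 1) * Real.exp l * (τ - t) := by
  have := (convex_Icc (0 : ℝ) 1).norm_image_sub_le_of_norm_hasDerivWithin_le (f := omA l) (f' := omA' l)
    (C := (l + 1) * Real.exp l) (fun x _ => (omA_deriv l x).hasDerivWithinAt) ?_
    (x := t) (y := τ) ⟨h0, by linarith⟩ ⟨by linarith, h1⟩
  · rwa [Real.norm_eq_abs, Real.norm_of_nonneg (by linarith)] at this
  · intro x hx
    obtain ⟨b1, b2⟩ := omA_bd hl hx.1 hx.2
    have h2 : Real.exp (l * x) ≤ Real.exp l := Real.exp_le_exp.2 (by nlinarith [hx.2])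
    have h3 := Real.exp_pos (l * x)
    rw [Real.norm_eq_abs, abs_le, omA']
    have := mul_le_mul_of_nonneg_left b2 hl
    have := mul_nonneg hl b1
    constructor <;> nlinarith

set_option maxHeartbeats 4000000 in
lemma taylorA {d : ℕ} {l R t τ : ℝ} {x y c : EE d} (hl : 0 ≤ l) (h0 : 0 ≤ t) (h1 : τ ≤ 1) (htτ : t ≤ τ)
    (hR : ‖c‖ + 1 ≤ R) (hy : ‖y‖ ≤ R) (hx : 0 < 1 / 4 - ‖x - c‖ ^ 2) :
    omA l t * (1 / 4 - ‖x - c‖ ^ 2) ^ 3 + (-6 * omA l t * (1 / 4 - ‖x - c‖ ^ 2) ^ 2) * inner ℝ (x - c) (y - x)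
      - ((l + 1) * Real.exp l * (64 * R ^ 6) + Real.exp l * (1 + 64 * R ^ 4)) * (‖y - x‖ ^ 2 + (τ - t)) ≤
      omA l τ * (1 / 4 - ‖y - c‖ ^ 2) ^ 3 := by
  have hR1 : 1 ≤ R := by have := norm_nonneg c; linarith
  obtain ⟨b1, b2⟩ := omA_bd hl h0 (htτ.trans h1)
  have b3 := omA_lip hl h0 h1 htτ
  set X := x - c with hX
  set v := y - x with hv
  have hY : y - c = X + v := by rw [hX, hv]; abel
  have hYn : ‖y - c‖ ≤ 2 * R := by
    refine (norm_sub_le _ _).trans ?_; linarith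
  have hXn : ‖X‖ ≤ 1 / 2 := by nlinarith [norm_nonneg X]
  set h := 1 / 4 - ‖X‖ ^ 2 with hh
  set H := 1 / 4 - ‖y - c‖ ^ 2 with hH
  have hHh : H - h = -2 * inner ℝ X v - ‖v‖ ^ 2 := by
    rw [hH, hh, hY, norm_add_sq_real]; ring
  have hvn : ‖v‖ ≤ 3 * R := by
    have : v = (y - c) - X := by rw [hX, hv]; abel
    rw [this]; refine (norm_sub_le _ _).trans ?_; linarith
  have hin : |inner ℝ X v| ≤ 1 / 2 * ‖v‖ := (abs_real_inner_le_norm X v).trans (by gcongr)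
  have hdif : |H - h| ≤ 4 * R * ‖v‖ := by
    rw [hHh]
    have hi := abs_le.1 hin
    have hv0 := norm_nonneg v
    rw [abs_le]
    have hvv : ‖v‖ ^ 2 ≤ 3 * R * ‖v‖ := by rw [sq]; exact mul_le_mul_of_nonneg_right hvn hv0
    have hvR : ‖v‖ ≤ R * ‖v‖ := le_mul_of_one_le_left hv0 hR1
    have hv2 : 0 ≤ ‖v‖ ^ 2 := sq_nonneg _
    constructor <;> linarith
  have hdif2 : (H - h) ^ 2 ≤ 16 * R ^ 2 * ‖v‖ ^ 2 := by
    rw [← sq_abs]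
    calc |H - h| ^ 2 ≤ (4 * R * ‖v‖) ^ 2 := by gcongr
      _ = _ := by ring
  have hh1 : h ≤ 1 / 4 := by rw [hh]; have : 0 ≤ ‖X‖ ^ 2 := by positivity
                             linarith
  have hH1 : H ≤ 1 / 4 := by rw [hH]; have : 0 ≤ ‖y - c‖ ^ 2 := by positivity
                             linarith
  have hH2 : -(4 * R ^ 2) ≤ H := by
    rw [hH]; have : ‖y - c‖ ^ 2 ≤ (2 * R) ^ 2 := by gcongr
    nlinarith
  have hRR : 1 ≤ R ^ 2 := one_le_pow₀ hR1
  have hHabs : |H| ≤ 4 * R ^ 2 := by rw [abs_le]; constructor <;> linarith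
  have hH3 : |H ^ 3| ≤ 64 * R ^ 6 := by
    rw [abs_pow]
    calc |H| ^ 3 ≤ (4 * R ^ 2) ^ 3 := by gcongr
      _ = _ := by ring
  -- first part
  have p1 : -((l + 1) * Real.exp l * (64 * R ^ 6) * (τ - t)) ≤ (omA l τ - omA l t) * H ^ 3 := by
    have : |(omA l τ - omA l t) * H ^ 3| ≤ ((l + 1) * Real.exp l * (τ - t)) * (64 * R ^ 6) := by
      rw [abs_mul]; gcongr
    have := (abs_le.1 this).1
    linarith
  have p2 : -((1 + 64 * R ^ 4) * ‖v‖ ^ 2) ≤ H ^ 3 - h ^ 3 + 6 * h ^ 2 * inner ℝ X v := by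
    have e : H ^ 3 - h ^ 3 + 6 * h ^ 2 * inner ℝ X v = -3 * h ^ 2 * ‖v‖ ^ 2 + (H - h) ^ 2 * (H + 2 * h) := by
      have e1 : H ^ 3 - h ^ 3 = 3 * h ^ 2 * (H - h) + (H - h) ^ 2 * (H + 2 * h) := by ring
      rw [e1, hHh]; ring
    rw [e]
    have k1 : 3 * h ^ 2 ≤ 1 := by
      have : h ^ 2 ≤ (1 / 4) ^ 2 := by gcongr
      linarith
    have k2 : 3 * h ^ 2 * ‖v‖ ^ 2 ≤ 1 * ‖v‖ ^ 2 := mul_le_mul_of_nonneg_right k1 (by positivity)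
    have k3 : (H - h) ^ 2 * (-(4 * R ^ 2)) ≤ (H - h) ^ 2 * (H + 2 * h) :=
      mul_le_mul_of_nonneg_left (by linarith) (sq_nonneg _)
    have k4 : (H - h) ^ 2 * (4 * R ^ 2) ≤ 16 * R ^ 2 * ‖v‖ ^ 2 * (4 * R ^ 2) :=
      mul_le_mul_of_nonneg_right hdif2 (by positivity)
    linarith
  have p3 : -(Real.exp l * ((1 + 64 * R ^ 4) * ‖v‖ ^ 2)) ≤ omA l t * (H ^ 3 - h ^ 3 + 6 * h ^ 2 * inner ℝ X v) := by
    have q1 := mul_le_mul_of_nonneg_left p2 b1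
    have q2 : omA l t * ((1 + 64 * R ^ 4) * ‖v‖ ^ 2) ≤ Real.exp l * ((1 + 64 * R ^ 4) * ‖v‖ ^ 2) := by gcongr
    linarith
  have p4 : 0 ≤ (l + 1) * Real.exp l * (64 * R ^ 6) * ‖v‖ ^ 2 := by positivity
  have p5 : 0 ≤ Real.exp l * (1 + 64 * R ^ 4) * (τ - t) := mul_nonneg (by positivity) (by linarith)
  linarith

set_option maxHeartbeats 4000000 in
/-- the touching lemma -/
lemma touch (d : ℕ) {δ K R U : ℝ} (hδ : 0 < δ) (hK : 0 ≤ K) (hR : 0 < R) (hU0 : 0 ≤ U) :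
    ∃ C κ : ℝ, 1 ≤ C ∧ 0 < κ ∧ ∀ (u f g : ZZ d → ℝ) (x1 c : EE d),
      C2on u (cyl (-1/2) 1 0 R) → ‖c‖ + 1 ≤ R → ‖x1 - c‖ ≤ 1 / 4 →
      (∀ z ∈ cyl (-1/2) 1 0 R, 0 ≤ u z) → (∀ z ∈ cyl (-1/2) 1 0 R, 0 ≤ f z) →
      (∀ z ∈ cyl (-1/2) 1 0 R, 0 ≤ g z) →
      (∀ z ∈ cyl (-1/2) 1 0 R, Super δ K u z (g z - f z)) →
      (∫⁻ z in cyl (-1/2) 1 0 R, ENNReal.ofReal (g z) ^ (d + 1) ≤ 1) →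
      u (-1/2, x1) ≤ U →
      ∃ G : Set (ZZ d), G ⊆ Ico (1/2) 1 ×ˢ Metric.ball c (1/2) ∧ MeasurableSet G ∧
        ENNReal.ofReal κ ≤ volume G ∧ ∀ z ∈ G, f z ≤ g z + C ∧ u z ≤ C ∧ ∃ p : EE d, ‖p‖ ≤ C ∧
        ∀ τ ∈ Icc z.1 1, ∀ y ∈ Metric.closedBall 0 R,
          u z + inner ℝ p (y - z.2) - C * (‖y - z.2‖ ^ 2 + (τ - z.1)) ≤ u (τ, y) := by
  have hL0 : 0 ≤ barL d δ K 0 := by unfold barL barB; positivity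
  set l := 4 * barL d δ K 0 + 2 with hl
  have hl0 : 0 ≤ l := by linarith
  obtain ⟨ε, hε0, hε1, -, hε2⟩ := exists_eps (d := d) (τ := 3/2) hδ hK hR (by norm_num)
  set D := δ⁻¹ ^ d * 2 ^ d with hD
  have hD0 : 0 < D := by positivity
  have hv := vb_pos d
  have hVR := vR_nonneg d R
  set M := max 1 (16 * D / (ε ^ d * vb d)) with hM
  have hM1 : 1 ≤ M := le_max_left _ _
  have hM0 : 0 < M := by linarith
  have hMD : 2 * D ≤ M ^ (d + 1) * (ε ^ d * vb d / 8) := by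
    have h1 : M ≤ M ^ (d + 1) := le_self_pow₀ hM1 (by simp)
    have h2 : 16 * D / (ε ^ d * vb d) ≤ M := le_max_right _ _
    rw [div_le_iff₀ (by positivity)] at h2
    have h3 : M * (ε ^ d * vb d) ≤ M ^ (d + 1) * (ε ^ d * vb d) := by gcongr
    linarith
  set m0 := (3 / 2 : ℝ) * Real.exp (l * (-1/2)) * (1 / 8) ^ 3 with hm0
  have hm00 : 0 < m0 := by positivity
  set s := (M + U) / m0 with hs
  have hs0 : 0 < s := by positivity
  set E := Real.exp l with hE
  have hE0 : 0 < E := Real.exp_pos _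
  set η := ε * M with hη
  have hη0 : 0 < η := by positivity
  set C1 := ((l + 1) * Real.exp l * (64 * R ^ 6) + Real.exp l * (1 + 64 * R ^ 4)) with hC1
  have hC10 : 0 ≤ C1 := by positivity
  set κ := M ^ (d + 1) * (ε ^ d * vb d / 8) / (D * (s * E + K * η) ^ (d + 1)) with hκ
  have hκ0 : 0 < κ := by positivity
  refine ⟨1 + s * E + K * η + s * C1 + s * (6 * E) + η, κ, by
    have : 0 ≤ s * E + K * η + s * C1 + s * (6 * E) + η := by positivity
    linarith, hκ0, ?_⟩
  intro u f g x1 c hu hc hx1 hu0 hf0 hg0 hsup hgint hU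
  set φ : ZZ d → ℝ := bar (omA l) (fun _ => 1 / 4) (fun _ => c) with hφ
  have hφ2 : ∀ z, ContDiffAt ℝ 2 φ z := fun z =>
    bar_C2 (omA_C2 l z.1) contDiffAt_const contDiffAt_const z.2
  set w : ZZ d → ℝ := fun z => s * φ z + (-1) * u z with hw
  have hw2 : C2on w (cyl (-1/2) 1 0 R) := fun z hz => C2_lin (hφ2 z) (hu z hz) _ _
  have hcube : ∀ h : ℝ, h ≤ 0 → h ^ 3 ≤ 0 := fun h hh => by
    have : h ^ 3 = h * h ^ 2 := by ring
    rw [this]; exact mul_nonpos_of_nonpos_of_nonneg hh (sq_nonneg h)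
  have hom : ∀ t : ℝ, t ≤ 1 → 0 ≤ omA l t := fun t ht =>
    mul_nonneg (by linarith) (Real.exp_pos _).le
  have hwpos : ∀ z ∈ cyl (-1/2) 1 0 R, 0 < w z → 0 < 1 / 4 - ‖z.2 - c‖ ^ 2 := by
    intro z hz hwz
    by_contra hneg
    have h2 : φ z ≤ 0 := mul_nonpos_of_nonneg_of_nonpos (hom _ hz.1.2) (hcube _ (not_lt.1 hneg))
    have := mul_nonpos_of_nonneg_of_nonpos hs0.le h2
    have := hu0 z hz
    simp only [hw] at hwz
    linarith
  have hR1 : 1 ≤ R := by have := norm_nonneg c; linarith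
  have hx1R : x1 ∈ Metric.closedBall (0 : EE d) R := by
    rw [mem_closedBall_zero_iff]
    have : x1 = (x1 - c) + c := by abel
    rw [this]; refine (norm_add_le _ _).trans ?_; linarith
  have hlat : ∀ t ∈ Icc (-1/2 : ℝ) 1, ∀ x : EE d, dist x 0 = R → w (t, x) ≤ 0 := by
    intro t ht x hx
    by_contra hcon
    have h1 := hwpos (t, x) ⟨ht, by simp [← hx]⟩ (not_le.1 hcon)
    simp only at h1
    have h2 : R ≤ ‖x - c‖ + ‖c‖ := by
      rw [← hx, dist_zero_right]
      have := norm_add_le (x - c) c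
      simpa using this
    nlinarith
  have htop : ∀ x ∈ Metric.closedBall (0 : EE d) R, w (1, x) ≤ 0 := by
    intro x hx
    have : φ (1, x) = 0 := by simp [hφ, bar, omA]
    have h2 := hu0 (1, x) ⟨⟨by norm_num, le_rfl⟩, hx⟩
    simp only [hw, this]; linarith
  have hMw : M ≤ w (-1/2, x1) := by
    have h1 : m0 ≤ φ (-1/2, x1) := by
      simp only [hφ, bar, barH, omA, hm0]
      have h3 : ‖x1 - c‖ ^ 2 ≤ (1 / 4) ^ 2 := by gcongr
      have h4 : (1 / 8 : ℝ) ^ 3 ≤ (1 / 4 - ‖x1 - c‖ ^ 2) ^ 3 := by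
        have : (1 / 8 : ℝ) ≤ 1 / 4 - ‖x1 - c‖ ^ 2 := by linarith
        gcongr
      have h5 : (1 - -1 / 2 : ℝ) = 3 / 2 := by norm_num
      rw [h5]
      gcongr
    have h2 : s * m0 = M + U := by rw [hs]; field_simp
    have := mul_le_mul_of_nonneg_left h1 hs0.le
    simp only [hw]; linarith
  have hpos0 : ∀ (z : ZZ d) (a : Matrix (Fin d) (Fin d) ℝ) (b : EE d) (e : ℝ), Adm δ K a b e → z ∈ cyl (-1/2) 1 0 R →
      0 < w z → -(if 1 / 2 ≤ z.1 then E else 0) ≤ Lop a b e φ z := by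
    intro z a b e hAd hz hwz
    have hh := hwpos z hz hwz
    have hform := bar_Lop (x := z.2) (t := z.1) (fun x => hφ2 (z.1, x)) (omA_deriv l z.1)
      (hasDerivAt_const z.1 (1 / 4 : ℝ)) (hasDerivAt_const z.1 c) a b e
    have hh1 : 1 / 4 - ‖z.2 - c‖ ^ 2 ≤ 1 / 4 := by
      have : 0 ≤ ‖z.2 - c‖ ^ 2 := by positivity
      linarith
    rw [show z = (z.1, z.2) from rfl, hform]
    split_ifs with ht
    · have hn := bar_num (A := 0) (ω := omA l z.1) (ω' := l * omA l z.1) (S := 1 / 4) (S' := 0) (ξ' := 0)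
        (X := z.2 - c) hδ hK le_rfl hAd (hom _ hz.1.2) (by norm_num) hh rfl (by simp) (by simp)
        (by rw [hl]; have := hom _ hz.1.2; nlinarith)
      have h3 : (1 / 4 - ‖z.2 - c‖ ^ 2) ^ 3 ≤ 1 := pow_le_one₀ hh.le (by linarith)
      have h4 : Real.exp (l * z.1) ≤ E := Real.exp_le_exp.2 (by nlinarith [hz.1.2])
      have h5 : Real.exp (l * z.1) * (1 / 4 - ‖z.2 - c‖ ^ 2) ^ 3 ≤ E * 1 := by gcongr
      simp only [barH, omA'] at hn ⊢
      nlinarith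
    · rw [neg_zero]
      push Not at ht
      refine bar_num (A := 0) hδ hK le_rfl hAd (hom _ hz.1.2) (by norm_num) hh rfl (by simp) (by simp) ?_
      have h6 : Real.exp (l * z.1) ≤ 2 * omA l z.1 := by
        unfold omA; have := Real.exp_pos (l * z.1); nlinarith
      unfold omA'
      have h7 := hom z.1 hz.1.2
      nlinarith
  set q : ZZ d → ℝ := fun z => g z + (if 1 / 2 ≤ z.1 then s * E else 0) with hq
  have hLw : ∀ z ∈ cyl (-1/2) 1 0 R, 0 < w z → ∃ a b e, Adm δ K a b e ∧ -q z + f z ≤ Lop a b e w z := by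
    intro z hz hwz
    obtain ⟨a, b, e, hAd, hLu⟩ := hsup z hz
    refine ⟨a, b, e, hAd, ?_⟩
    rw [Lop_lin (hφ2 z) (hu z hz)]
    have h1 := mul_le_mul_of_nonneg_left (hpos0 z a b e hAd hz hwz) hs0.le
    have h2 : s * -(if 1 / 2 ≤ z.1 then E else 0) = -(if 1 / 2 ≤ z.1 then s * E else 0) := by
      split_ifs <;> ring
    rw [h2] at h1
    simp only [hq]
    linarith
  have hA := abp (q := q) (η := η) hδ hw2 (by norm_num) hx1R hlat htop hMw (by rw [hη]; nlinarith) hη0 hM0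
    (fun z hz hwz => by
      obtain ⟨a, b, e, h1, h2⟩ := hLw z hz hwz
      exact ⟨a, b, e, h1, by have := hf0 z hz; linarith⟩)
  set Γ := Contact w (-1/2) 1 0 R η with hΓ
  have hΓm : MeasurableSet Γ := contact_measurable hw2
  have htm : MeasurableSet {z : ZZ d | 1 / 2 ≤ z.1} := measurableSet_le measurable_const measurable_fst
  set Γ2 := Γ ∩ {z : ZZ d | 1 / 2 ≤ z.1} with hΓ2
  set Γ1 := Γ \ {z : ZZ d | 1 / 2 ≤ z.1} with hΓ1
  have hmΓ2 : MeasurableSet Γ2 := hΓm.inter htm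
  have hmΓ1 : MeasurableSet Γ1 := hΓm.diff htm
  have hsub1 : Γ1 ⊆ cyl (-1/2) 1 0 R := fun z hz => hz.1.1
  have hsub2 : Γ2 ⊆ cyl (-1/2) 1 0 R := fun z hz => hz.1.1
  refine ⟨Γ2, ?_, hmΓ2, ?_, ?_⟩
  · intro z hz
    have h1 := (contact_int hlat htop hz.1).1
    refine ⟨⟨hz.2, h1⟩, ?_⟩
    have h2 := hwpos z hz.1.1 hz.1.2.1
    rw [mem_ball_iff_norm]
    nlinarith [norm_nonneg (z.2 - c)]
  · have h1 := hA.2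
    rw [← lintegral_inter_add_sdiff _ Γ htm] at h1
    have i1 : ∫⁻ z in Γ1, ENNReal.ofReal (δ⁻¹ ^ d * (q z + K * η) ^ (d + 1)) ≤
        ENNReal.ofReal D * (1 + ENNReal.ofReal ((K * η) ^ (d + 1)) * ENNReal.ofReal (3 / 2 * vR d R)) := by
      have e : ∫⁻ z in Γ1, ENNReal.ofReal (δ⁻¹ ^ d * (q z + K * η) ^ (d + 1)) =
          ∫⁻ z in Γ1, ENNReal.ofReal (δ⁻¹ ^ d * (g z + K * η) ^ (d + 1)) := by
        refine setLIntegral_congr_fun hmΓ1 ?_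
        intro z hz
        have : ¬ (1 / 2 ≤ z.1) := hz.2
        simp only [hq, if_neg this, add_zero]
      rw [e]
      refine (lint_bound hmΓ1 hsub1 (by positivity) (by positivity) (fun z hz => hg0 z (hsub1 hz))).trans ?_
      gcongr
      refine (measure_mono hsub1).trans ?_
      rw [vol_cyl, vR_eq, ← ENNReal.ofReal_mul (by norm_num)]
      norm_num
    have i2 : ∫⁻ z in Γ2, ENNReal.ofReal (δ⁻¹ ^ d * (q z + K * η) ^ (d + 1)) ≤
        ENNReal.ofReal D * (1 + ENNReal.ofReal ((s * E + K * η) ^ (d + 1)) * volume Γ2) := by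
      have e : ∫⁻ z in Γ2, ENNReal.ofReal (δ⁻¹ ^ d * (q z + K * η) ^ (d + 1)) =
          ∫⁻ z in Γ2, ENNReal.ofReal (δ⁻¹ ^ d * (g z + (s * E + K * η)) ^ (d + 1)) := by
        refine setLIntegral_congr_fun hmΓ2 ?_
        intro z hz
        have : (1 / 2 ≤ z.1) := hz.2
        simp only [hq, if_pos this, add_assoc]
      rw [e]
      refine (lint_bound hmΓ2 hsub2 (by positivity) (by positivity) (fun z hz => hg0 z (hsub2 hz))).trans ?_
      gcongr
    by_contra hcon
    push Not at hcon
    have hfin : volume Γ2 = ENNReal.ofReal (volume Γ2).toReal := (ENNReal.ofReal_toReal hcon.ne_top).symm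
    set ν := (volume Γ2).toReal with hν
    have hν0 : 0 ≤ ν := ENNReal.toReal_nonneg
    have hνκ : ν < κ := by
      rw [hfin] at hcon
      exact (ENNReal.ofReal_lt_ofReal_iff hκ0).1 hcon
    rw [hfin] at i2
    have h2 := h1.trans (add_le_add i2 i1)
    rw [vb_eq, ← ENNReal.ofReal_one, ← ENNReal.ofReal_mul (by positivity), ← ENNReal.ofReal_mul (by positivity),
      ← ENNReal.ofReal_mul (by positivity), ← ENNReal.ofReal_add zero_le_one (by positivity),
      ← ENNReal.ofReal_add zero_le_one (by positivity), ← ENNReal.ofReal_mul (by positivity),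
      ← ENNReal.ofReal_mul (by positivity), ← ENNReal.ofReal_add (by positivity) (by positivity),
      ENNReal.ofReal_le_ofReal_iff (by positivity)] at h2
    have e1 : M / 2 * η ^ d * vb d = M ^ (d + 1) * (ε ^ d * vb d / 2) := by
      rw [hη, mul_pow]; ring
    have e2 : (K * η) ^ (d + 1) = M ^ (d + 1) * (K * ε) ^ (d + 1) := by
      rw [hη, ← mul_assoc K, mul_pow _ M]; ring
    have e3 : D * ((s * E + K * η) ^ (d + 1) * ν) < M ^ (d + 1) * (ε ^ d * vb d / 8) := by
      rw [hκ, lt_div_iff₀ (by positivity)] at hνκ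
      linarith
    have e4 := mul_le_mul_of_nonneg_left hε2 (by positivity : 0 ≤ M ^ (d + 1))
    rw [e1, e2] at h2
    nlinarith
  · intro z hz
    have hzc := hsub2 hz
    have hwz : 0 < w z := hz.1.2.1
    have hh := hwpos z hzc hwz
    have ht0 : (1 / 2 : ℝ) ≤ z.1 := hz.2
    obtain ⟨b1, b2⟩ := omA_bd hl0 (by linarith : 0 ≤ z.1) hzc.1.2
    have hhle : 1 / 4 - ‖z.2 - c‖ ^ 2 ≤ 1 := by
      have : 0 ≤ ‖z.2 - c‖ ^ 2 := by positivity
      linarith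
    have hφE : φ z ≤ E := by
      simp only [hφ, bar, barH]
      calc _ ≤ E * 1 := mul_le_mul b2 (pow_le_one₀ hh.le hhle) (by positivity) hE0.le
        _ = E := mul_one E
    have n1 : 0 ≤ s * E := by positivity
    have n2 : 0 ≤ K * η := by positivity
    have n3 : 0 ≤ s * C1 := by positivity
    refine ⟨?_, ?_, s • ((-6 * omA l z.1 * (1 / 4 - ‖z.2 - c‖ ^ 2) ^ 2) • (z.2 - c)) - grd w z, ?_, ?_⟩
    · obtain ⟨a, b, e, hAd, hL⟩ := hLw z hzc hwz
      obtain ⟨c1, c2⟩ := contact_int hlat htop hz.1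
      have := (contact_pt hδ hw2 hz.1 c1 c2 hAd).1
      simp only [hq, if_pos ht0] at hL
      linarith
    · have := mul_le_mul_of_nonneg_left hφE hs0.le
      simp only [hw] at hwz
      linarith
    · refine (norm_sub_le _ _).trans ?_
      have k1 : ‖grd w z‖ ≤ η := hz.1.2.2.1
      have k2 : ‖z.2 - c‖ ≤ 1 := by nlinarith [norm_nonneg (z.2 - c)]
      have k3 : ‖s • ((-6 * omA l z.1 * (1 / 4 - ‖z.2 - c‖ ^ 2) ^ 2) • (z.2 - c))‖ ≤ s * (6 * E) := by
        rw [norm_smul, norm_smul, Real.norm_of_nonneg hs0.le]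
        have : ‖-6 * omA l z.1 * (1 / 4 - ‖z.2 - c‖ ^ 2) ^ 2‖ ≤ 6 * E := by
          rw [norm_mul, norm_mul, Real.norm_of_nonneg b1, Real.norm_of_nonneg (sq_nonneg (1 / 4 - ‖z.2 - c‖ ^ 2))]
          have k5 : (1 / 4 - ‖z.2 - c‖ ^ 2) ^ 2 ≤ 1 := pow_le_one₀ hh.le hhle
          have k6 : ‖(-6 : ℝ)‖ = 6 := by norm_num
          rw [k6]
          calc 6 * omA l z.1 * (1 / 4 - ‖z.2 - c‖ ^ 2) ^ 2 ≤ 6 * E * 1 := by gcongr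
            _ = 6 * E := mul_one _
        calc s * (_ * _) ≤ s * (6 * E * 1) := by gcongr
          _ = _ := by ring
      linarith
    · intro τ hτ y hy
      have k1 := hz.1.2.2.2 τ y hτ hy
      rw [dx_eq_inner] at k1
      have k2 := taylorA (x := z.2) hl0 (by linarith : 0 ≤ z.1) hτ.2 hτ.1 hc (mem_closedBall_zero_iff.1 hy) hh
      have k3 := mul_le_mul_of_nonneg_left k2 hs0.le
      rw [inner_sub_left, real_inner_smul_left, real_inner_smul_left]
      have k1' : s * (omA l τ * (1 / 4 - ‖y - c‖ ^ 2) ^ 3) + (-1) * u (τ, y) ≤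
        s * (omA l z.1 * (1 / 4 - ‖z.2 - c‖ ^ 2) ^ 3) + (-1) * u z + inner ℝ (grd w z) (y - z.2) := k1
      have k4 : 0 ≤ ‖y - z.2‖ ^ 2 + (τ - z.1) := add_nonneg (by positivity) (by linarith [hτ.1])
      have k5 : s * C1 * (‖y - z.2‖ ^ 2 + (τ - z.1)) ≤
          (1 + s * E + K * η + s * C1 + s * (6 * E) + η) * (‖y - z.2‖ ^ 2 + (τ - z.1)) := by
        refine mul_le_mul_of_nonneg_right ?_ k4
        linarith
      simp only [← hC1] at k3
      clear_value C1
      linarith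

def sc {d : ℕ} (t0 ρ : ℝ) (x0 : EE d) (r : ℝ) (z : ZZ d) : ZZ d := (t0 + ρ * z.1, x0 + r • z.2)

def scL (d : ℕ) (ρ r : ℝ) : ZZ d →L[ℝ] ZZ d :=
  (ρ • ContinuousLinearMap.fst ℝ ℝ (EE d)).prod (r • ContinuousLinearMap.snd ℝ ℝ (EE d))

lemma scL_apply {d : ℕ} (ρ r : ℝ) (z : ZZ d) : scL d ρ r z = (ρ * z.1, r • z.2) := rfl

lemma sc_eq {d : ℕ} (t0 ρ : ℝ) (x0 : EE d) (r : ℝ) (z : ZZ d) : sc t0 ρ x0 r z = (t0, x0) + scL d ρ r z := rfl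

lemma sc_hasFDerivAt {d : ℕ} (t0 ρ : ℝ) (x0 : EE d) (r : ℝ) (z : ZZ d) :
    HasFDerivAt (sc t0 ρ x0 r) (scL d ρ r) z := by
  have : sc t0 ρ x0 r = fun z => (t0, x0) + scL d ρ r z := rfl
  rw [this]
  exact ((scL d ρ r).hasFDerivAt).const_add _

lemma sc_contDiff {d : ℕ} (t0 ρ : ℝ) (x0 : EE d) (r : ℝ) : ContDiff ℝ 2 (sc t0 ρ x0 r) := by
  have : sc t0 ρ x0 r = fun z => (t0, x0) + scL d ρ r z := rfl
  rw [this]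
  exact contDiff_const.add (scL d ρ r).contDiff

lemma C2_sc {d : ℕ} {u : ZZ d → ℝ} {t0 ρ : ℝ} {x0 : EE d} {r : ℝ} {z : ZZ d}
    (hu : ContDiffAt ℝ 2 u (sc t0 ρ x0 r z)) : ContDiffAt ℝ 2 (fun z => u (sc t0 ρ x0 r z)) z :=
  hu.comp z (sc_contDiff t0 ρ x0 r).contDiffAt

lemma Lop_sc {d : ℕ} {u : ZZ d → ℝ} {t0 ρ : ℝ} {x0 : EE d} {r : ℝ} {z : ZZ d} (hr : r ≠ 0)
    (hu : ContDiffAt ℝ 2 u (sc t0 ρ x0 r z)) (a : Matrix (Fin d) (Fin d) ℝ) (b : EE d) (c : ℝ) :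
    Lop ((ρ / r ^ 2) • a) ((ρ / r) • b) (ρ * c) (fun z => u (sc t0 ρ x0 r z)) z
      = ρ * Lop a b c u (sc t0 ρ x0 r z) := by
  set S := sc t0 ρ x0 r with hS
  set A := scL d ρ r with hA
  have h1 : ∀ z', DifferentiableAt ℝ u (S z') → fderiv ℝ (fun z => u (S z)) z' = (fderiv ℝ u (S z')).comp A := by
    intro z' h
    exact (h.hasFDerivAt.comp z' (sc_hasFDerivAt t0 ρ x0 r z')).fderiv
  have hcont : ContinuousAt S z := (sc_contDiff t0 ρ x0 r).continuous.continuousAt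
  have h2 : fderiv ℝ (fun z => u (S z)) =ᶠ[nhds z] fun z' => (fderiv ℝ u (S z')).comp A := by
    filter_upwards [hcont.eventually (C2_eventually_diff hu)] with z' h3
    exact h1 z' h3
  have h3 : ∀ v w, fderiv ℝ (fderiv ℝ (fun z => u (S z))) z v w = fderiv ℝ (fderiv ℝ u) (S z) (A v) (A w) := by
    intro v w
    rw [h2.fderiv_eq]
    have hu2 := ((hu.fderiv_diff.differentiableAt (by norm_num)).hasFDerivAt).comp z (sc_hasFDerivAt t0 ρ x0 r z)
    have := (hu2.clm_comp (hasFDerivAt_const A z)).fderiv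
    simp only [Function.comp_apply] at this
    rw [this]
    simp [hA]
  have h4 := h1 z (hu.differentiableAt (by norm_num))
  have hA1 : ∀ s v, A (s, v) = (ρ * s, r • v) := fun s v => rfl
  have e1 : dt (fun z => u (S z)) z = ρ * dt u (S z) := by
    unfold dt; rw [h4]
    have : A (1, 0) = ρ • ((1 : ℝ), (0 : EE d)) := by rw [hA1]; simp
    simp [this, -Prod.smul_mk]
  have hA2 : ∀ v : EE d, A (0, v) = r • ((0 : ℝ), v) := by intro v; rw [hA1]; simp
  have e2 : ∀ v, dx (fun z => u (S z)) z v = r * dx u (S z) v := by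
    intro v
    unfold dx; rw [h4]
    simp [hA2, -Prod.smul_mk]
  have e3 : ∀ v w, dxx (fun z => u (S z)) z v w = r ^ 2 * dxx u (S z) v w := by
    intro v w
    unfold dxx; rw [h3, hA2, hA2]
    simp [-Prod.smul_mk]; ring
  unfold Lop
  rw [e1, e2, dx_smul]
  simp only [e3, Matrix.smul_apply, smul_eq_mul]
  have : ∀ i j, ρ / r ^ 2 * a i j * (r ^ 2 * dxx u (S z) (eb i) (eb j)) = ρ * (a i j * dxx u (S z) (eb i) (eb j)) := by
    intro i j; field_simp
  simp only [this, ← Finset.mul_sum]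
  field_simp

/-- the quadratic lower barrier -/
def qd {d : ℕ} (q0 C : ℝ) (p : EE d) (z1 z : ZZ d) : ℝ :=
  q0 + inner ℝ p (z.2 - z1.2) - C * (‖z.2 - z1.2‖ ^ 2 + (z.1 - z1.1))

lemma qd_C2 {d : ℕ} (q0 C : ℝ) (p : EE d) (z1 z : ZZ d) : ContDiffAt ℝ 2 (qd q0 C p z1) z := by
  unfold qd
  have h : ContDiff ℝ 2 fun z : ZZ d => ‖z.2 - z1.2‖ ^ 2 := by
    apply ContDiff.norm_sq ℝ; fun_prop
  have h2 : ContDiff ℝ 2 fun z : ZZ d => inner ℝ p (z.2 - z1.2) := by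
    apply ContDiff.inner ℝ <;> fun_prop
  fun_prop

lemma qd_Lop {d : ℕ} {δ K C q0 P Y : ℝ} {p : EE d} {z1 z : ZZ d} {a : Matrix (Fin d) (Fin d) ℝ} {b : EE d} {c : ℝ}
    (hAd : Adm δ K a b c) (hC : 0 ≤ C) (hq : 0 ≤ q0) (hP : ‖p‖ ≤ P) (hY : ‖z.2 - z1.2‖ ≤ Y)
    (ht : z1.1 ≤ z.1) :
    -(C + 2 * C * (d * δ⁻¹) + K * (P + 2 * C * Y) + K * (q0 + P * Y)) ≤ Lop a b c (qd q0 C p z1) z := by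
  have hdif : ∀ z, DifferentiableAt ℝ (qd q0 C p z1) z := fun z => (qd_C2 q0 C p z1 z).differentiableAt (by norm_num)
  have e1 : dt (qd q0 C p z1) z = -C := by
    have h1 := hasDerivAt_time (hdif (z.1, z.2))
    have h2 : HasDerivAt (fun s => qd q0 C p z1 (s, z.2)) (-C) z.1 := by
      unfold qd
      have := ((((hasDerivAt_id z.1).sub_const z1.1).const_add (‖z.2 - z1.2‖ ^ 2)).const_mul C).const_sub
        (q0 + inner ℝ p (z.2 - z1.2))
      simpa using this
    exact h1.unique h2
  have e2 : ∀ (z : ZZ d) v, dx (qd q0 C p z1) z v = inner ℝ p v - 2 * C * inner ℝ (z.2 - z1.2) v := by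
    intro z v
    have h1 := hasDerivAt_line (s := 0) (v := v) (hdif (z.1, z.2 + (0 : ℝ) • v))
    have h2 : HasDerivAt (fun s : ℝ => z.2 + s • v - z1.2) v 0 := by
      simpa using (((hasDerivAt_id (0:ℝ)).smul_const v).const_add z.2).sub_const z1.2
    have h3 := (((hasDerivAt_const (0 : ℝ) p).inner ℝ h2).const_add q0).sub
      (((h2.norm_sq).add_const (z.1 - z1.1)).const_mul C)
    have h4 := h1.unique h3
    simp only [zero_smul, add_zero] at h4
    rw [h4]; simp; ring
  have e3 : ∀ v w, dxx (qd q0 C p z1) z v w = 0 * inner ℝ (z.2 - z1.2) v * inner ℝ (z.2 - z1.2) w - 2 * C * inner ℝ v w := by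
    intro v w
    have h1 := hasDerivAt_dx_line (v := v) (v' := w) (qd_C2 q0 C p z1 (z.1, z.2))
    simp only [e2] at h1
    have h2 : HasDerivAt (fun s : ℝ => z.2 + s • v - z1.2) v 0 := by
      simpa using (((hasDerivAt_id (0:ℝ)).smul_const v).const_add z.2).sub_const z1.2
    have h3 := ((h2.inner ℝ (hasDerivAt_const (0 : ℝ) w)).const_mul (2 * C)).const_sub (inner ℝ p w)
    have h4 := h1.unique h3
    simp only [Prod.mk.eta] at h4
    rw [h4]; simp
  unfold Lop
  simp only [e1, e2, e3, Adm.quad]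
  have t1 := hAd.trace
  have k0 : 0 ≤ K := by linarith [hAd.bc, hAd.c0, norm_nonneg b]
  have kb : ‖b‖ ≤ K := by linarith [hAd.bc, hAd.c0]
  have kc : c ≤ K := by linarith [hAd.bc, norm_nonneg b]
  have hY0 : 0 ≤ Y := (norm_nonneg _).trans hY
  have hP0 : 0 ≤ P := (norm_nonneg _).trans hP
  have i1 : |inner ℝ p b| ≤ P * K := (abs_real_inner_le_norm _ _).trans (by gcongr)
  have i2 : |inner ℝ (z.2 - z1.2) b| ≤ Y * K := (abs_real_inner_le_norm _ _).trans (by gcongr)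
  have i3 : |inner ℝ p (z.2 - z1.2)| ≤ P * Y := (abs_real_inner_le_norm _ _).trans (by gcongr)
  have j1 := (abs_le.1 i1).1
  have j2 := (abs_le.1 i2).2
  have j3 := (abs_le.1 i3).2
  have j4 : qd q0 C p z1 z ≤ q0 + P * Y := by
    unfold qd
    have : 0 ≤ C * (‖z.2 - z1.2‖ ^ 2 + (z.1 - z1.1)) := mul_nonneg hC (add_nonneg (by positivity) (by linarith))
    linarith
  have j5 : c * qd q0 C p z1 z ≤ K * (q0 + P * Y) :=
    (mul_le_mul_of_nonneg_left j4 hAd.c0).trans (mul_le_mul_of_nonneg_right kc (by positivity))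
  have j6 := mul_le_mul_of_nonneg_left j2 (by positivity : 0 ≤ 2 * C)
  have j7 := mul_le_mul_of_nonneg_left t1 (by positivity : 0 ≤ 2 * C)
  linarith

lemma Adm.scale {d : ℕ} {δ K r : ℝ} {a : Matrix (Fin d) (Fin d) ℝ} {b : EE d} {c : ℝ}
    (h : Adm δ K a b c) (hr : 0 ≤ r) (hr1 : r ≤ 1) : Adm δ K a (r • b) (r ^ 2 * c) := by
  refine ⟨h.lo, h.up, ?_, by have := h.c0; positivity⟩
  have h0 := h.c0
  have h1 := norm_nonneg b
  rw [norm_smul, Real.norm_of_nonneg hr]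
  have : r * ‖b‖ ≤ ‖b‖ := mul_le_of_le_one_left h1 hr1
  have : r ^ 2 * c ≤ c := mul_le_of_le_one_left h0 (pow_le_one₀ hr hr1)
  linarith [h.bc]

structure Cls (d : ℕ) (δ K R m1 X0 : ℝ) (u f g : ZZ d → ℝ) (τ0 : ℝ) (x0 : EE d) : Prop where
  t1 : 1 ≤ τ0
  t2 : τ0 ≤ m1
  hx : ‖x0‖ ≤ X0
  hu : C2on u (cyl (-τ0) 1 0 R)
  u0 : ∀ z ∈ cyl (-τ0) 1 0 R, 0 ≤ u z
  f0 : ∀ z ∈ cyl (-τ0) 1 0 R, 0 ≤ f z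
  g0 : ∀ z ∈ cyl (-τ0) 1 0 R, 0 ≤ g z
  sup : ∀ z ∈ cyl (-τ0) 1 0 R, Super δ K u z (g z - f z)
  int : ∫⁻ z in cyl (-τ0) 1 0 R, ENNReal.ofReal (g z) ^ (d + 1) ≤ 1
  vx : u (-τ0, x0) ≤ 1

lemma sc_vol_map {d : ℕ} (t0 : ℝ) {ρ : ℝ} (x0 : EE d) {r : ℝ} (hρ : 0 < ρ) (hr : 0 < r) (F : ZZ d → ℝ≥0∞) (s : Set (ZZ d)) :
    ∫⁻ z in sc t0 ρ x0 r ⁻¹' s, F (sc t0 ρ x0 r z) = ENNReal.ofReal ((ρ * r ^ d)⁻¹) * ∫⁻ z in s, F z := by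
  have hdet : (scL d ρ r : ZZ d →ₗ[ℝ] ZZ d).det = ρ * r ^ d := by
    have : (scL d ρ r : ZZ d →ₗ[ℝ] ZZ d) = LinearMap.prodMap (ρ • LinearMap.id) (r • LinearMap.id) := by
      ext <;> simp [scL]
    rw [this, LinearMap.det_prodMap]
    simp
  have hne : (scL d ρ r : ZZ d →ₗ[ℝ] ZZ d).det ≠ 0 := by rw [hdet]; positivity
  let e : ZZ d ≃L[ℝ] ZZ d := ((scL d ρ r : ZZ d →ₗ[ℝ] ZZ d).equivOfDetNeZero hne).toContinuousLinearEquiv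
  have he : ∀ z, e z = scL d ρ r z := fun z => rfl
  have hS : sc t0 ρ x0 r = fun z => (t0, x0) + e z := by
    funext z; rw [sc_eq, he]
  have hmap : Measure.map (sc t0 ρ x0 r) volume = ENNReal.ofReal ((ρ * r ^ d)⁻¹) • (volume : Measure (ZZ d)) := by
    have h1 : Measure.map e (volume : Measure (ZZ d)) = ENNReal.ofReal ((ρ * r ^ d)⁻¹) • volume := by
      have := Measure.map_linearMap_addHaar_eq_smul_addHaar (volume : Measure (ZZ d)) hne
      rw [hdet, abs_of_pos (by positivity)] at this
      exact this
    have h2 : sc t0 ρ x0 r = (fun z => (t0, x0) + z) ∘ e := hS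
    rw [h2, ← Measure.map_map (measurable_const_add _) e.continuous.measurable, h1, Measure.map_smul,
      map_add_left_eq_self]
  have hemb : MeasurableEmbedding (sc t0 ρ x0 r) := by
    rw [hS]
    exact (MeasurableEquiv.measurableEmbedding (MeasurableEquiv.addLeft ((t0, x0) : ZZ d))).comp
      e.toHomeomorph.measurableEmbedding
  rw [← hemb.lintegral_map, ← hemb.restrict_map, hmap, Measure.restrict_smul, lintegral_smul_measure, smul_eq_mul]

lemma sc_pre {d : ℕ} {tb t1 r R : ℝ} {xb : EE d} (hr : 0 < r) :
    sc tb (r ^ 2) xb r ⁻¹' cyl t1 (tb + r ^ 2) xb (R * r) = cyl (-((tb - t1) / r ^ 2)) 1 0 R := by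
  ext z
  simp only [mem_preimage, cyl, mem_prod, sc, mem_Icc, Metric.mem_closedBall, dist_eq_norm, add_sub_cancel_left,
    sub_zero, norm_smul, Real.norm_of_nonneg hr.le]
  have h2 : 0 < r ^ 2 := by positivity
  have a1 : t1 ≤ tb + r ^ 2 * z.1 ↔ -((tb - t1) / r ^ 2) ≤ z.1 := by
    rw [← neg_div, div_le_iff₀ h2]
    constructor <;> intro h <;> linarith
  have a2 : tb + r ^ 2 * z.1 ≤ tb + r ^ 2 ↔ z.1 ≤ 1 := by
    rw [add_le_add_iff_left]; exact mul_le_iff_le_one_right h2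
  have a3 : r * ‖z.2‖ ≤ R * r ↔ ‖z.2‖ ≤ R := by
    rw [mul_comm]; exact mul_le_mul_iff_left₀ hr
  rw [a1, a2, a3]

lemma cls_step {d : ℕ} {δ K R m1 X0 C1 Λ A : ℝ} (hC1 : 0 ≤ C1) (hΛ : 0 ≤ Λ) (hA : 0 < A)
    (hA2 : 2 ^ d * (Λ + C1 ^ (d + 1) * ((m1 + 1) * vR d R)) ≤ A ^ (d + 1))
    {u f g l : ZZ d → ℝ} {tb t1 r : ℝ} {xb x1 : EE d} (hr : 0 < r) (hr1 : r ≤ 1)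
    (ht1 : r ^ 2 ≤ tb - t1) (ht2 : tb - t1 ≤ m1 * r ^ 2) (hx : ‖x1 - xb‖ ≤ X0 * r)
    (hu : C2on u (cyl t1 (tb + r ^ 2) xb (R * r)))
    (hl : ∀ z, ContDiffAt ℝ 2 l z)
    (hul : ∀ z ∈ cyl t1 (tb + r ^ 2) xb (R * r), l z ≤ u z)
    (hf : ∀ z ∈ cyl t1 (tb + r ^ 2) xb (R * r), 0 ≤ f z)
    (hg : ∀ z ∈ cyl t1 (tb + r ^ 2) xb (R * r), 0 ≤ g z)
    (hsup : ∀ z ∈ cyl t1 (tb + r ^ 2) xb (R * r), Super δ K u z (g z - f z))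
    (hLl : ∀ z ∈ cyl t1 (tb + r ^ 2) xb (R * r), ∀ a b c, Adm δ K a b c → -C1 ≤ Lop a b c l z)
    (hgint : ∫⁻ z in cyl t1 (tb + r ^ 2) xb (R * r), ENNReal.ofReal (g z) ^ (d + 1) ≤ ENNReal.ofReal (Λ * r ^ (d + 2)))
    (hvx : u (t1, x1) - l (t1, x1) ≤ A * r ^ 2) :
    Cls d δ K R m1 X0
      (fun z => (A * r ^ 2)⁻¹ * u (sc tb (r ^ 2) xb r z) + (-(A * r ^ 2)⁻¹) * l (sc tb (r ^ 2) xb r z))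
      (fun z => A⁻¹ * f (sc tb (r ^ 2) xb r z)) (fun z => A⁻¹ * (g (sc tb (r ^ 2) xb r z) + C1))
      ((tb - t1) / r ^ 2) (r⁻¹ • (x1 - xb)) := by
  have h2 : 0 < r ^ 2 := by positivity
  have hpre := sc_pre (d := d) (tb := tb) (t1 := t1) (R := R) (xb := xb) hr
  have hmem : ∀ z ∈ cyl (-((tb - t1) / r ^ 2)) 1 0 R, sc tb (r ^ 2) xb r z ∈ cyl t1 (tb + r ^ 2) xb (R * r) := by
    intro z hz; rw [← hpre] at hz; exact hz
  refine ⟨?_, ?_, ?_, ?_, ?_, ?_, ?_, ?_, ?_, ?_⟩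
  · rwa [one_le_div h2]
  · rwa [div_le_iff₀ h2]
  · rw [norm_smul, norm_inv, Real.norm_of_nonneg hr.le, inv_mul_le_iff₀ hr]; linarith
  · intro z hz
    exact C2_lin (C2_sc (hu _ (hmem z hz))) (C2_sc (hl _)) _ _
  · intro z hz
    have := hul _ (hmem z hz)
    have h3 : 0 ≤ (A * r ^ 2)⁻¹ := by positivity
    have := mul_le_mul_of_nonneg_left this h3
    linarith
  · intro z hz
    have := hf _ (hmem z hz)
    positivity
  · intro z hz
    have := hg _ (hmem z hz)
    positivity
  · intro z hz
    obtain ⟨a, b, c, hAd, hL⟩ := hsup _ (hmem z hz)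
    refine ⟨a, r • b, r ^ 2 * c, hAd.scale hr.le hr1, ?_⟩
    rw [Lop_lin (C2_sc (hu _ (hmem z hz))) (C2_sc (hl _))]
    have e1 := Lop_sc hr.ne' (hu _ (hmem z hz)) a b c
    have e2 := Lop_sc hr.ne' (hl (sc tb (r ^ 2) xb r z)) a b c
    rw [div_self (by positivity), one_smul, show r ^ 2 / r = r by field_simp] at e1 e2
    rw [e1, e2]
    have hl1 := hLl _ (hmem z hz) a b c hAd
    have h3 : 0 < A⁻¹ := by positivity
    have e3 : (A * r ^ 2)⁻¹ = A⁻¹ * (r ^ 2)⁻¹ := mul_inv _ _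
    have e4 : ∀ X, (A * r ^ 2)⁻¹ * (r ^ 2 * X) = A⁻¹ * X := by intro X; rw [e3]; field_simp
    rw [neg_mul, e4, e4]
    have := mul_le_mul_of_nonneg_left (sub_le_sub hL hl1) h3.le
    linarith
  · rw [← hpre]
    have := sc_vol_map tb xb h2 hr (fun z => ENNReal.ofReal (A⁻¹ * (g z + C1)) ^ (d + 1)) (cyl t1 (tb + r ^ 2) xb (R * r))
    rw [this]
    have hm : MeasurableSet (cyl t1 (tb + r ^ 2) xb (R * r)) := (isCompact_cyl _ _ _ _).measurableSet
    have i1 : ∫⁻ z in cyl t1 (tb + r ^ 2) xb (R * r), ENNReal.ofReal (A⁻¹ * (g z + C1)) ^ (d + 1) ≤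
        ENNReal.ofReal ((A⁻¹) ^ (d + 1) * 2 ^ d) * (ENNReal.ofReal (Λ * r ^ (d + 2)) +
        ENNReal.ofReal (C1 ^ (d + 1)) * volume (cyl t1 (tb + r ^ 2) xb (R * r))) := by
      refine le_trans (le_of_eq ?_) ((lint_bound hm subset_rfl (D := (A⁻¹) ^ (d + 1)) (by positivity) hC1 hg).trans ?_)
      · refine setLIntegral_congr_fun hm fun z hz => ?_
        have := hg z hz
        rw [← ENNReal.ofReal_pow (by positivity), mul_pow]
      · gcongr
    have hvol : volume (cyl t1 (tb + r ^ 2) xb (R * r)) ≤ ENNReal.ofReal ((m1 + 1) * vR d R * r ^ (d + 2)) := by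
      have hR2 : volume (Metric.closedBall (0 : EE d) (R * r)) = ENNReal.ofReal (r ^ d * vR d R) := by
        rw [mul_comm R, ENNReal.ofReal_mul (by positivity), ← vR_eq]
        have := Measure.addHaar_closedBall_mul_of_pos (volume : Measure (EE d)) 0 hr R
        simpa using this
      rw [vol_cyl, hR2, ← ENNReal.ofReal_mul (by linarith)]
      apply ENNReal.ofReal_le_ofReal
      have hv := vR_nonneg d R
      have : (tb + r ^ 2 - t1) * (r ^ d * vR d R) ≤ ((m1 + 1) * r ^ 2) * (r ^ d * vR d R) := by
        gcongr; linarith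
      calc _ ≤ _ := this
        _ = _ := by ring
    have hm1 : 0 ≤ m1 := by
      by_contra h
      have : m1 * r ^ 2 < 0 := mul_neg_of_neg_of_pos (not_le.1 h) h2
      linarith
    have hv := vR_nonneg d R
    calc _ ≤ ENNReal.ofReal ((r ^ 2 * r ^ d)⁻¹) * (ENNReal.ofReal ((A⁻¹) ^ (d + 1) * 2 ^ d) * (ENNReal.ofReal (Λ * r ^ (d + 2)) +
        ENNReal.ofReal (C1 ^ (d + 1)) * ENNReal.ofReal ((m1 + 1) * vR d R * r ^ (d + 2)))) := by
          gcongr; exact i1.trans (by gcongr)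
      _ = ENNReal.ofReal ((A⁻¹) ^ (d + 1) * (2 ^ d * (Λ + C1 ^ (d + 1) * ((m1 + 1) * vR d R)))) := by
          rw [← ENNReal.ofReal_mul (by positivity), ← ENNReal.ofReal_add (by positivity) (by positivity),
            ← ENNReal.ofReal_mul (by positivity), ← ENNReal.ofReal_mul (by positivity)]
          congr 1
          field_simp
          ring
      _ ≤ 1 := by
          rw [ENNReal.ofReal_le_one, inv_pow, inv_mul_le_iff₀ (by positivity)]
          linarith
  · have e : sc tb (r ^ 2) xb r (-((tb - t1) / r ^ 2), r⁻¹ • (x1 - xb)) = (t1, x1) := by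
      simp only [sc]
      refine Prod.ext ?_ ?_
      · simp only; field_simp; ring
      · simp [smul_smul, hr.ne']
    simp only [e]
    have h3 : 0 < A * r ^ 2 := by positivity
    have := mul_le_mul_of_nonneg_left hvx (inv_pos.2 h3).le
    rw [inv_mul_cancel₀ h3.ne'] at this
    linarith

lemma gap1d {Kc : Set ℝ} (hKc : IsCompact Kc) (hK1 : Kc ⊆ Icc 0 1) {m : ℝ} (hm : 1 < m) :
    volume {t | t ∈ Kc ∧ ∃ ρ, 0 < ρ ∧ m * ρ ≤ 1 ∧ ∀ s ∈ Icc (t - m * ρ) (t - ρ), s ∉ Kc} ≤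
      ENNReal.ofReal (3 / (m - 1)) := by
  set U : Set ℝ := Ioo (-2) 1 \ Kc with hU
  have hUo : IsOpen U := isOpen_Ioo.sdiff hKc.isClosed
  set F : Set (Set ℝ) := (fun x => connectedComponentIn U x) '' U with hF
  have hFsub : ∀ J ∈ F, J ⊆ U := by
    rintro J ⟨x, hx, rfl⟩; exact connectedComponentIn_subset U x
  have hFo : ∀ J ∈ F, IsOpen J := by
    rintro J ⟨x, hx, rfl⟩; exact hUo.connectedComponentIn
  have hFne : ∀ J ∈ F, J.Nonempty := by
    rintro J ⟨x, hx, rfl⟩; exact ⟨x, mem_connectedComponentIn hx⟩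
  have hFd : F.PairwiseDisjoint id := by
    rintro J ⟨x, hx, rfl⟩ J' ⟨y, hy, rfl⟩ hne
    rw [Function.onFun, Set.disjoint_left]
    intro z hz hz'
    exact hne ((connectedComponentIn_eq hz).trans (connectedComponentIn_eq hz').symm)
  have hFc : F.Countable := hFd.countable_of_isOpen hFo hFne
  have hsum : ∑' J : F, volume (J : Set ℝ) ≤ ENNReal.ofReal 3 := by
    have h1 := measure_biUnion (μ := volume) hFc hFd (fun J hJ => (hFo J hJ).measurableSet)
    simp only [id] at h1
    rw [← h1]
    calc volume (⋃ J ∈ F, J) ≤ volume (Ioo (-2 : ℝ) 1) := by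
          apply measure_mono
          exact iUnion₂_subset fun J hJ => (hFsub J hJ).trans sdiff_subset
      _ = ENNReal.ofReal 3 := by rw [Real.volume_Ioo]; norm_num
  have hcov : {t | t ∈ Kc ∧ ∃ ρ, 0 < ρ ∧ m * ρ ≤ 1 ∧ ∀ s ∈ Icc (t - m * ρ) (t - ρ), s ∉ Kc} ⊆
      ⋃ J ∈ F, Icc (sSup J) (sSup J + (volume J).toReal / (m - 1)) := by
    rintro t ⟨htK, ρ, hρ, hmρ, hgap⟩
    have hsub : Icc (t - m * ρ) (t - ρ) ⊆ U := by
      intro s hs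
      have h1 := hK1 htK
      exact ⟨⟨by linarith [hs.1, h1.1], by linarith [hs.2, h1.2]⟩, hgap s hs⟩
    have hle : t - m * ρ ≤ t - ρ := by nlinarith
    have hmem : t - ρ ∈ Icc (t - m * ρ) (t - ρ) := ⟨hle, le_rfl⟩
    set J := connectedComponentIn U (t - ρ) with hJ
    have hJF : J ∈ F := ⟨t - ρ, hsub hmem, rfl⟩
    have hIJ : Icc (t - m * ρ) (t - ρ) ⊆ J := isPreconnected_Icc.subset_connectedComponentIn hmem hsub
    have htJ : t ∉ J := fun h => (hFsub J hJF h).2 htK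
    have hord : J.OrdConnected := isPreconnected_connectedComponentIn.ordConnected
    have hub : ∀ s ∈ J, s ≤ t := by
      intro s hs
      by_contra hlt
      push Not at hlt
      exact htJ (hord.out (hIJ hmem) hs ⟨by linarith, hlt.le⟩)
    have hs1 : sSup J ≤ t := csSup_le ⟨_, hIJ hmem⟩ hub
    have hs2 : t - ρ ≤ sSup J := le_csSup ⟨t, hub⟩ (hIJ hmem)
    have hfin : volume J ≠ ⊤ := by
      have : volume J ≤ volume (Ioo (-2 : ℝ) 1) := measure_mono ((hFsub J hJF).trans sdiff_subset)
      exact ne_top_of_le_ne_top (by simp) this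
    have hvol : (m - 1) * ρ ≤ (volume J).toReal := by
      have h1 : volume (Icc (t - m * ρ) (t - ρ)) ≤ volume J := measure_mono hIJ
      rw [Real.volume_Icc] at h1
      have := (ENNReal.ofReal_le_iff_le_toReal hfin).1 h1
      linarith
    refine mem_biUnion hJF ⟨hs1, ?_⟩
    have : ρ ≤ (volume J).toReal / (m - 1) := by
      rw [le_div_iff₀ (by linarith)]; linarith
    linarith
  refine (measure_mono hcov).trans ((measure_biUnion_le volume hFc _).trans ?_)
  have : ∀ J : F, volume (Icc (sSup (J : Set ℝ)) (sSup (J : Set ℝ) + (volume (J : Set ℝ)).toReal / (m - 1))) ≤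
      volume (J : Set ℝ) * ENNReal.ofReal (1 / (m - 1)) := by
    intro J
    rw [Real.volume_Icc, add_sub_cancel_left, div_eq_mul_one_div, ENNReal.ofReal_mul ENNReal.toReal_nonneg]
    gcongr
    exact ENNReal.ofReal_toReal_le
  refine (ENNReal.tsum_le_tsum this).trans ?_
  rw [ENNReal.tsum_mul_right]
  refine (mul_le_mul_left hsum _).trans ?_
  rw [← ENNReal.ofReal_mul (by norm_num)]
  apply ENNReal.ofReal_le_ofReal
  rw [mul_one_div]

lemma good_set {d : ℕ} {Kc : Set (ZZ d)} (hKc : IsCompact Kc) {B : Set (EE d)} (hB : MeasurableSet B)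
    (hK1 : Kc ⊆ Icc 0 1 ×ˢ B) {m : ℝ} (hm : 1 < m) (ρ : ℕ → ℝ) (hρ : ∀ k, 0 < ρ k) (hρ1 : ∀ k, m * ρ k ≤ 1) :
    ∃ K' ⊆ Kc, IsCompact K' ∧ volume Kc ≤ volume K' + ENNReal.ofReal (3 / (m - 1)) * volume B ∧
      ∀ z ∈ K', ∀ k, ∃ s ∈ Icc (z.1 - m * ρ k) (z.1 - ρ k), (s, z.2) ∈ Kc := by
  set P : ℕ → Set (ZZ d) := fun k => (fun q : ZZ d × ℝ => ((q.1.1 + q.2, q.1.2) : ZZ d)) '' (Kc ×ˢ Icc (ρ k) (m * ρ k)) with hP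
  have hPc : ∀ k, IsCompact (P k) := fun k => (hKc.prod isCompact_Icc).image (by fun_prop)
  have hPm : ∀ k z, z ∈ P k ↔ ∃ s ∈ Icc (z.1 - m * ρ k) (z.1 - ρ k), (s, z.2) ∈ Kc := by
    intro k z
    constructor
    · rintro ⟨⟨⟨t, x⟩, σ⟩, ⟨h1, h2⟩, rfl⟩
      simp only at h1 h2 ⊢
      exact ⟨t, ⟨by linarith [h2.2], by linarith [h2.1]⟩, h1⟩
    · rintro ⟨s, hs, hsK⟩
      refine ⟨((s, z.2), z.1 - s), ⟨hsK, ⟨by simp only; linarith [hs.2], by simp only; linarith [hs.1]⟩⟩, ?_⟩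
      exact Prod.ext (by simp) rfl
  set K' := Kc ∩ ⋂ k, P k with hK'
  have hK'c : IsCompact K' := hKc.inter_right (isClosed_iInter fun k => (hPc k).isClosed)
  refine ⟨K', inter_subset_left, hK'c, ?_, ?_⟩
  · have hbad : volume (Kc \ K') ≤ ENNReal.ofReal (3 / (m - 1)) * volume B := by
      have hmeas : MeasurableSet (Kc \ K') := hKc.measurableSet.diff hK'c.measurableSet
      rw [Measure.volume_eq_prod, Measure.prod_apply_symm hmeas]
      have : ∀ x : EE d, volume ((fun t : ℝ => ((t, x) : ZZ d)) ⁻¹' (Kc \ K')) ≤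
          B.indicator (fun _ => ENNReal.ofReal (3 / (m - 1))) x := by
        intro x
        by_cases hx : x ∈ B
        · rw [indicator_of_mem hx]
          have hcc : IsCompact {t : ℝ | (t, x) ∈ Kc} := by
            have : {t : ℝ | (t, x) ∈ Kc} = (fun t : ℝ => ((t, x) : ZZ d)) ⁻¹' Kc := rfl
            rw [this]
            refine IsCompact.of_isClosed_subset (isCompact_Icc (a := (0 : ℝ)) (b := 1))
              (hKc.isClosed.preimage (by fun_prop)) ?_
            intro t ht; exact (hK1 ht).1
          refine le_trans (measure_mono ?_) (gap1d hcc (fun t ht => (hK1 ht).1) hm)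
          rintro t ⟨h1, h2⟩
          refine ⟨h1, ?_⟩
          have h3 : ∃ k, (t, x) ∉ P k := by
            by_contra hcon
            push Not at hcon
            exact h2 ⟨h1, mem_iInter.2 hcon⟩
          obtain ⟨k, hk⟩ := h3
          refine ⟨ρ k, hρ k, hρ1 k, fun s hs hsK => hk ((hPm k _).2 ⟨s, hs, hsK⟩)⟩
        · rw [indicator_of_notMem hx]
          have : (fun t : ℝ => ((t, x) : ZZ d)) ⁻¹' (Kc \ K') = ∅ := by
            ext t; simp only [mem_preimage, mem_empty_iff_false, iff_false]
            intro h; exact hx (hK1 h.1).2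
          rw [this]; simp
      refine (lintegral_mono this).trans ?_
      rw [lintegral_indicator hB, setLIntegral_const]
    calc volume Kc ≤ volume (K' ∪ Kc \ K') := measure_mono (by rw [union_sdiff_self]; exact subset_union_right)
      _ ≤ _ := (measure_union_le _ _).trans (by gcongr)
  · intro z hz k
    exact (hPm k z).1 (mem_iInter.1 hz.2 k)

/-- parabolic cylinders centered at a point -/
def pc {d : ℕ} (M r : ℝ) (z : ZZ d) : Set (ZZ d) := cyl (z.1 - M * r ^ 2) (z.1 + M * r ^ 2) z.2 (M * r)

lemma pc_vol {d : ℕ} {M r : ℝ} (hr : 0 < r) (z : ZZ d) :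
    volume (pc M r z) = ENNReal.ofReal (2 * M * vR d M * r ^ (d + 2)) := by
  unfold pc
  have hR2 : volume (Metric.closedBall (0 : EE d) (M * r)) = ENNReal.ofReal (r ^ d * vR d M) := by
    rw [mul_comm M, ENNReal.ofReal_mul (by positivity), ← vR_eq]
    have := Measure.addHaar_closedBall_mul_of_pos (volume : Measure (EE d)) 0 hr M
    simpa using this
  have hv := vR_nonneg d M
  rw [vol_cyl, hR2, ← ENNReal.ofReal_mul' (by positivity)]
  congr 1; ring

/-- weak type maximal inequality -/
lemma maximal_bd {d : ℕ} {M Λ : ℝ} (hM : 0 < M) (hΛ : 0 < Λ) (F : ZZ d → ℝ≥0∞) (D : Set (ZZ d))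
    (hF : ∫⁻ z in D, F z ≤ 1) :
    volume {z : ZZ d | ∃ r, 0 < r ∧ r ≤ 1 ∧ pc M r z ⊆ D ∧ ENNReal.ofReal (Λ * r ^ (d + 2)) < ∫⁻ z in pc M r z, F z} ≤
      ENNReal.ofReal (2 * (13 * M) * vR d (13 * M) / Λ) := by
  set T : Set (ZZ d × ℝ) := {a | 0 < a.2 ∧ a.2 ≤ 1 ∧ pc M a.2 a.1 ⊆ D ∧
    ENNReal.ofReal (Λ * a.2 ^ (d + 2)) < ∫⁻ z in pc M a.2 a.1, F z} with hT
  have hself : ∀ (z : ZZ d) (r M' : ℝ), 0 < r → 0 < M' → z ∈ pc M' r z := by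
    intro z r M' hr hM'
    refine ⟨⟨?_, ?_⟩, ?_⟩
    · have : 0 < M' * r ^ 2 := by positivity
      linarith
    · have : 0 < M' * r ^ 2 := by positivity
      linarith
    · simp; positivity
  obtain ⟨v, hvT, hvd, hvc⟩ := Vitali.exists_disjoint_subfamily_covering_enlargement
    (fun a : ZZ d × ℝ => pc M a.2 a.1) T (fun a => a.2) 2 (by norm_num) (fun a ha => ha.1.le) 1 (fun a ha => ha.2.1)
    (fun a ha => ⟨a.1, hself _ _ _ ha.1 hM⟩)
  have hvcount : v.Countable := by
    refine hvd.countable_of_nonempty_interior ?_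
    intro a ha
    have ha' := hvT ha
    refine ⟨a.1, ?_⟩
    have hsub : Ioo (a.1.1 - M * a.2 ^ 2) (a.1.1 + M * a.2 ^ 2) ×ˢ Metric.ball a.1.2 (M * a.2) ⊆ pc M a.2 a.1 :=
      prod_mono Ioo_subset_Icc_self Metric.ball_subset_closedBall
    refine interior_maximal hsub (isOpen_Ioo.prod Metric.isOpen_ball) ?_
    have h0 := ha'.1
    have : 0 < M * a.2 ^ 2 := by positivity
    exact ⟨⟨by linarith, by linarith⟩, by simp; positivity⟩
  have hcov : {z : ZZ d | ∃ r, 0 < r ∧ r ≤ 1 ∧ pc M r z ⊆ D ∧ ENNReal.ofReal (Λ * r ^ (d + 2)) < ∫⁻ z in pc M r z, F z} ⊆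
      ⋃ a ∈ v, pc (13 * M) a.2 a.1 := by
    rintro z ⟨r, hr⟩
    obtain ⟨b, hb, ⟨y, hy1, hy2⟩, hrb⟩ := hvc (z, r) hr
    refine mem_biUnion hb ?_
    have hb0 := (hvT hb).1
    have hr0 : 0 < r := hr.1
    simp only at hrb hy1
    have hr2 : r ^ 2 ≤ 4 * b.2 ^ 2 := by nlinarith
    have hMr : M * r ^ 2 ≤ M * (4 * b.2 ^ 2) := by gcongr
    have hMr' : M * r ≤ M * (2 * b.2) := by gcongr
    have hMb : 0 < M * b.2 ^ 2 := by positivity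
    have hMb' : 0 < M * b.2 := by positivity
    obtain ⟨⟨p1, p2⟩, p3⟩ := hy1
    obtain ⟨⟨q1, q2⟩, q3⟩ := hy2
    simp only [Metric.mem_closedBall] at p3 q3 p1 p2 q1 q2
    refine ⟨⟨by linarith, by linarith⟩, ?_⟩
    rw [Metric.mem_closedBall]
    have := dist_triangle z.2 y.2 b.1.2
    rw [dist_comm z.2 y.2] at this
    linarith
  have hC0 : 0 ≤ 2 * (13 * M) * vR d (13 * M) := by have := vR_nonneg d (13 * M); positivity
  refine (measure_mono hcov).trans ((measure_biUnion_le volume hvcount _).trans ?_)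
  have h1 : ∀ a : v, volume (pc (13 * M) (a : ZZ d × ℝ).2 (a : ZZ d × ℝ).1) ≤
      ENNReal.ofReal (2 * (13 * M) * vR d (13 * M) / Λ) * ∫⁻ z in pc M (a : ZZ d × ℝ).2 (a : ZZ d × ℝ).1, F z := by
    rintro ⟨a, ha⟩
    have ha' := hvT ha
    rw [pc_vol ha'.1]
    calc _ = ENNReal.ofReal (2 * (13 * M) * vR d (13 * M) / Λ) * ENNReal.ofReal (Λ * a.2 ^ (d + 2)) := by
          rw [← ENNReal.ofReal_mul (by positivity)]
          congr 1; field_simp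
      _ ≤ _ := by gcongr; exact ha'.2.2.2.le
  refine (ENNReal.tsum_le_tsum h1).trans ?_
  rw [ENNReal.tsum_mul_left]
  have h2 : ∑' a : v, ∫⁻ z in pc M (a : ZZ d × ℝ).2 (a : ZZ d × ℝ).1, F z ≤ 1 := by
    have := lintegral_biUnion (μ := volume) hvcount (s := fun a : ZZ d × ℝ => pc M a.2 a.1)
      (fun a _ => (isCompact_cyl _ _ _ _).measurableSet) hvd F
    rw [← this]
    refine le_trans (lintegral_mono_set ?_) hF
    exact iUnion₂_subset fun a ha => (hvT ha).2.2.1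
  exact mul_le_of_le_one_right' h2

/-- dyadic parabolic index -/
def dy {d : ℕ} (k : ℕ) (z : ZZ d) : ℤ × (Fin d → ℤ) := (⌊(4 : ℝ) ^ k * z.1⌋, fun i => ⌊(2 : ℝ) ^ k * z.2 i⌋)

def cube {d : ℕ} (k : ℕ) (q : ℤ × (Fin d → ℤ)) : Set (ZZ d) := {z | dy k z = q}

def Q0 (d : ℕ) : Set (ZZ d) := cube 0 0

lemma floor_mul_nat (n : ℤ) (hn : 0 < n) (x : ℝ) : ⌊x⌋ = ⌊(n : ℝ) * x⌋ / n := by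
  rw [Int.floor_eq_iff]
  have h1 := Int.floor_le ((n : ℝ) * x)
  have h2 := Int.lt_floor_add_one ((n : ℝ) * x)
  set N := ⌊(n : ℝ) * x⌋
  have h3 := Int.mul_ediv_add_emod N n
  have h4 := Int.emod_nonneg N hn.ne'
  have h5 := Int.emod_lt_of_pos N hn
  have h6 : n * (N / n) ≤ N := by linarith
  have h7 : N + 1 ≤ n * (N / n) + n := by linarith
  have h6' : (n : ℝ) * ((N / n : ℤ) : ℝ) ≤ N := by exact_mod_cast h6
  have h7' : (N : ℝ) + 1 ≤ n * ((N / n : ℤ) : ℝ) + n := by exact_mod_cast h7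
  have hn' : (0 : ℝ) < n := by exact_mod_cast hn
  constructor
  · refine le_of_mul_le_mul_left ?_ hn'
    linarith
  · refine lt_of_mul_lt_mul_left ?_ hn'.le
    linarith

lemma dy_succ {d : ℕ} {k : ℕ} {z z' : ZZ d} (h : dy (k + 1) z = dy (k + 1) z') : dy k z = dy k z' := by
  unfold dy at *
  have h1 : ∀ t : ℝ, ⌊(4 : ℝ) ^ k * t⌋ = ⌊(4 : ℝ) ^ (k + 1) * t⌋ / 4 := by
    intro t
    rw [floor_mul_nat 4 (by norm_num) ((4 : ℝ) ^ k * t), pow_succ]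
    push_cast
    congr 2; ring
  have h2 : ∀ t : ℝ, ⌊(2 : ℝ) ^ k * t⌋ = ⌊(2 : ℝ) ^ (k + 1) * t⌋ / 2 := by
    intro t
    rw [floor_mul_nat 2 (by norm_num) ((2 : ℝ) ^ k * t), pow_succ]
    push_cast
    congr 2; ring
  rw [Prod.mk.injEq] at h ⊢
  refine ⟨by rw [h1, h1, h.1], ?_⟩
  funext i
  rw [h2, h2, congrFun h.2 i]

lemma dy_le {d : ℕ} {k l : ℕ} (hkl : k ≤ l) {z z' : ZZ d} (h : dy l z = dy l z') : dy k z = dy k z' := by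
  induction l, hkl using Nat.le_induction with
  | base => exact h
  | succ n _ ih => exact ih (dy_succ h)

def tbq {d : ℕ} (k : ℕ) (q : ℤ × (Fin d → ℤ)) : ℝ := q.1 / 4 ^ k
def xbq {d : ℕ} (k : ℕ) (q : ℤ × (Fin d → ℤ)) : EE d := WithLp.toLp 2 (fun i => (q.2 i : ℝ) / 2 ^ k)
def rk (k : ℕ) : ℝ := (1 / 2) ^ k

lemma rk_pos (k : ℕ) : 0 < rk k := by unfold rk; positivity
lemma rk_le (k : ℕ) : rk k ≤ 1 := by unfold rk; exact pow_le_one₀ (by norm_num) (by norm_num)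
lemma rk_inv (k : ℕ) : (2 : ℝ) ^ k * rk k = 1 := by
  unfold rk; rw [← mul_pow]; norm_num
lemma rk_inv2 (k : ℕ) : (4 : ℝ) ^ k * rk k ^ 2 = 1 := by
  have : (4 : ℝ) ^ k = (2 ^ k) ^ 2 := by rw [← pow_mul, mul_comm, pow_mul]; norm_num
  rw [this, ← mul_pow, rk_inv, one_pow]

lemma sc_cube {d : ℕ} (k : ℕ) (q : ℤ × (Fin d → ℤ)) :
    sc (tbq k q) (rk k ^ 2) (xbq k q) (rk k) ⁻¹' cube k q = Q0 d := by
  ext z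
  simp only [mem_preimage, cube, Q0, mem_ofPred_eq, dy, sc, Prod.ext_iff]
  have e1 : (4 : ℝ) ^ k * (tbq k q + rk k ^ 2 * z.1) = q.1 + z.1 := by
    rw [mul_add, ← mul_assoc, rk_inv2, tbq]; field_simp
  have e2 : ∀ i, (2 : ℝ) ^ k * (xbq k q + rk k • z.2) i = q.2 i + z.2 i := by
    intro i
    have : (xbq k q + rk k • z.2) i = (q.2 i : ℝ) / 2 ^ k + rk k * z.2 i := rfl
    rw [this, mul_add, ← mul_assoc, rk_inv]; field_simp
  simp only [e1, e2, Int.floor_intCast_add, pow_zero, one_mul, Prod.fst_zero, Prod.snd_zero]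
  constructor
  · rintro ⟨h1, h2⟩
    exact ⟨by linarith, by funext i; have := congrFun h2 i; simp only [Pi.zero_apply]; linarith⟩
  · rintro ⟨h1, h2⟩
    exact ⟨by linarith, by funext i; have := congrFun h2 i; simp only [Pi.zero_apply] at this; linarith⟩

lemma cube_measurable {d : ℕ} (k : ℕ) (q : ℤ × (Fin d → ℤ)) : MeasurableSet (cube k q) := by
  have : Measurable (dy (d := d) k) := by
    unfold dy
    refine Measurable.prodMk (Int.measurable_floor.comp (by fun_prop)) ?_
    refine measurable_pi_lambda _ fun i => Int.measurable_floor.comp (by fun_prop)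
  exact this (measurableSet_singleton q)

lemma mem_Q0 {d : ℕ} (z : ZZ d) : z ∈ Q0 d ↔ z.1 ∈ Ico 0 1 ∧ ∀ i, z.2 i ∈ Ico (0 : ℝ) 1 := by
  simp only [Q0, cube, dy, mem_ofPred_eq, Prod.ext_iff, pow_zero, one_mul, Prod.fst_zero, Prod.snd_zero,
    Int.floor_eq_zero_iff, funext_iff, Pi.zero_apply]

lemma vol_Q0 (d : ℕ) : volume (Q0 d) = 1 := by
  have : Q0 d = Ico (0 : ℝ) 1 ×ˢ ((@WithLp.ofLp 2 (Fin d → ℝ)) ⁻¹' (univ.pi fun _ => Ico (0 : ℝ) 1)) := by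
    ext z; rw [mem_Q0]; simp
  rw [this, Measure.volume_eq_prod, Measure.prod_prod,
    (PiLp.volume_preserving_ofLp (Fin d)).measure_preimage ?_]
  · rw [Real.volume_pi_Ico]; simp
  · exact (MeasurableSet.univ_pi fun _ => measurableSet_Ico).nullMeasurableSet

lemma vol_cube {d : ℕ} (k : ℕ) (q : ℤ × (Fin d → ℤ)) : volume (cube k q) = ENNReal.ofReal (rk k ^ (d + 2)) := by
  have h := sc_vol_map (tbq k q) (xbq k q) (pow_pos (rk_pos k) 2) (rk_pos k) (fun _ => 1) (cube k q)
  rw [sc_cube] at h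
  simp only [lintegral_const, Measure.restrict_apply, MeasurableSet.univ, univ_inter, one_mul, vol_Q0] at h
  have hp : 0 < rk k ^ (d + 2) := pow_pos (rk_pos k) _
  have e : rk k ^ 2 * rk k ^ d = rk k ^ (d + 2) := by ring
  rw [e, ENNReal.ofReal_inv_of_pos hp] at h
  have h0 : ENNReal.ofReal (rk k ^ (d + 2)) ≠ 0 := by simpa using hp
  have := congrArg (fun x => ENNReal.ofReal (rk k ^ (d + 2)) * x) h
  simp only [← mul_assoc] at this
  rw [ENNReal.mul_inv_cancel h0 ENNReal.ofReal_ne_top] at this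
  simpa using this.symm

lemma cube_int {d : ℕ} (k : ℕ) (q : ℤ × (Fin d → ℤ)) (F : ZZ d → ℝ≥0∞) :
    ∫⁻ z in cube k q, F z = volume (cube k q) *
      ∫⁻ z in Q0 d, F (sc (tbq k q) (rk k ^ 2) (xbq k q) (rk k) z) := by
  have h := sc_vol_map (tbq k q) (xbq k q) (pow_pos (rk_pos k) 2) (rk_pos k) F (cube k q)
  rw [sc_cube] at h
  have hp : 0 < rk k ^ (d + 2) := pow_pos (rk_pos k) _
  have e : rk k ^ 2 * rk k ^ d = rk k ^ (d + 2) := by ring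
  have h0 : ENNReal.ofReal (rk k ^ (d + 2)) ≠ 0 := by simpa using hp
  rw [h, vol_cube, e, ENNReal.ofReal_inv_of_pos hp, ← mul_assoc, ENNReal.mul_inv_cancel h0 ENNReal.ofReal_ne_top,
    one_mul]

lemma norm_le_of_coord {d : ℕ} {x : EE d} {r : ℝ} (hr : 0 ≤ r) (h : ∀ i, |x i| ≤ r) : ‖x‖ ≤ Real.sqrt d * r := by
  rw [EuclideanSpace.norm_eq]
  apply Real.sqrt_le_iff.2
  refine ⟨by positivity, ?_⟩
  rw [mul_pow, Real.sq_sqrt (by positivity)]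
  calc ∑ i, ‖x i‖ ^ 2 ≤ ∑ _i : Fin d, r ^ 2 := by
        refine Finset.sum_le_sum fun i _ => ?_
        rw [Real.norm_eq_abs]; have := h i; gcongr
    _ = d * r ^ 2 := by simp

/-- points of a cube -/
lemma cube_pt {d : ℕ} {k : ℕ} {q : ℤ × (Fin d → ℤ)} {z : ZZ d} (hz : z ∈ cube k q) :
    tbq k q ≤ z.1 ∧ z.1 < tbq k q + rk k ^ 2 ∧ ∀ i, xbq k q i ≤ z.2 i ∧ z.2 i < xbq k q i + rk k := by
  have h1 : ⌊(4 : ℝ) ^ k * z.1⌋ = q.1 := congrArg Prod.fst hz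
  have h2 : ∀ i, ⌊(2 : ℝ) ^ k * z.2 i⌋ = q.2 i := fun i => congrFun (congrArg Prod.snd hz) i
  have p4 : (0 : ℝ) < 4 ^ k := by positivity
  have p2 : (0 : ℝ) < 2 ^ k := by positivity
  rw [Int.floor_eq_iff] at h1
  have ht : (4 : ℝ) ^ k * tbq k q = q.1 := by rw [tbq]; field_simp
  refine ⟨?_, ?_, ?_⟩
  · refine le_of_mul_le_mul_left ?_ p4; linarith
  · refine lt_of_mul_lt_mul_left ?_ p4.le; rw [mul_add, rk_inv2]; linarith
  · intro i
    have h3 := h2 i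
    rw [Int.floor_eq_iff] at h3
    have hx : (2 : ℝ) ^ k * xbq k q i = q.2 i := by
      have : xbq k q i = (q.2 i : ℝ) / 2 ^ k := rfl
      rw [this]; field_simp
    refine ⟨?_, ?_⟩
    · refine le_of_mul_le_mul_left ?_ p2; linarith
    · refine lt_of_mul_lt_mul_left ?_ p2.le; rw [mul_add, rk_inv]; linarith

lemma cube_base {d : ℕ} (k : ℕ) (q : ℤ × (Fin d → ℤ)) : (tbq k q, xbq k q) ∈ cube k q := by
  have := sc_cube k q
  have h0 : ((0 : ℝ), (0 : EE d)) ∈ Q0 d := by rw [mem_Q0]; simp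
  rw [← this] at h0
  simpa [sc] using h0

lemma cube_dist {d : ℕ} {k : ℕ} {z z' : ZZ d} (h : dy k z = dy k z') :
    |z.1 - z'.1| ≤ rk k ^ 2 ∧ ‖z.2 - z'.2‖ ≤ Real.sqrt d * rk k := by
  obtain ⟨a1, a2, a3⟩ := cube_pt (q := dy k z') (z := z) h
  obtain ⟨b1, b2, b3⟩ := cube_pt (q := dy k z') (z := z') rfl
  refine ⟨by rw [abs_le]; constructor <;> linarith, ?_⟩
  refine norm_le_of_coord (rk_pos k).le fun i => ?_
  have h1 := a3 i
  have h2 := b3 i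
  have : (z.2 - z'.2) i = z.2 i - z'.2 i := rfl
  rw [this, abs_le]; constructor <;> linarith

/-- index set of the stopping cubes -/
def stopI {d : ℕ} (k0 : ℕ) (G : Set (ZZ d)) : Set (ℕ × (ℤ × (Fin d → ℤ))) :=
  {a | k0 ≤ a.1 ∧ cube a.1 a.2 ⊆ Q0 d ∧ Disjoint (cube a.1 a.2) G ∧
    (a.1 = k0 ∨ ∃ k, a.1 = k + 1 ∧ k0 ≤ k ∧ ∃ z' ∈ G, ∃ z ∈ cube a.1 a.2, dy k z' = dy k z)}

lemma stop_disj {d : ℕ} (k0 : ℕ) (G : Set (ZZ d)) :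
    (stopI k0 G).PairwiseDisjoint fun a => cube a.1 a.2 := by
  have key : ∀ a ∈ stopI k0 G, ∀ b ∈ stopI k0 G, ∀ z ∈ cube a.1 a.2, z ∈ cube b.1 b.2 → b.1 ≤ a.1 := by
    intro a ha b hb z hza hzb
    by_contra hlt
    push Not at hlt
    rcases hb.2.2.2 with h | ⟨k, hk, hk0, z', hz', z2, hz2, hd⟩
    · have := ha.1; omega
    · have e1 : dy b.1 z = dy b.1 z2 := (show dy b.1 z = b.2 from hzb).trans (show dy b.1 z2 = b.2 from hz2).symm
      rw [hk] at e1
      have e2 : dy k z' = dy k z := hd.trans (dy_succ e1).symm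
      have e3 : dy a.1 z' = dy a.1 z := dy_le (by omega) e2
      exact Set.disjoint_left.1 ha.2.2.1 (show dy a.1 z' = a.2 from e3.trans hza) hz'
  intro a ha b hb hab
  rw [Function.onFun, Set.disjoint_left]
  intro z hza hzb
  apply hab
  have h1 := key a ha b hb z hza hzb
  have h2 := key b hb a ha z hzb hza
  have h3 : a.1 = b.1 := le_antisymm h2 h1
  refine Prod.ext h3 ?_
  have e1 : dy a.1 z = a.2 := hza
  have e2 : dy b.1 z = b.2 := hzb
  rw [← e1, ← e2, h3]

lemma stop_cover {d : ℕ} (k0 : ℕ) {G : Set (ZZ d)} (hG : IsClosed G) :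
    Q0 d \ G ⊆ ⋃ a ∈ stopI k0 G, cube a.1 a.2 := by
  rintro z ⟨hzQ, hzG⟩
  have hex : ∃ k, k0 ≤ k ∧ Disjoint (cube k (dy k z)) G := by
    obtain ⟨ε, hε, hball⟩ := Metric.isOpen_iff.1 hG.isOpen_compl z hzG
    have hten : Filter.Tendsto (fun k : ℕ => (1 + Real.sqrt d) * rk k) Filter.atTop (nhds 0) := by
      have := (tendsto_pow_atTop_nhds_zero_of_lt_one (by norm_num : (0 : ℝ) ≤ 1 / 2) (by norm_num)).const_mul (1 + Real.sqrt d)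
      simpa [rk] using this
    obtain ⟨k, hk, hk0⟩ := ((hten.eventually (gt_mem_nhds hε)).and (Filter.eventually_ge_atTop k0)).exists
    refine ⟨k, hk0, Set.disjoint_left.2 fun z' hz' hz'G => ?_⟩
    refine hball ?_ hz'G
    obtain ⟨h1, h2⟩ := cube_dist (show dy k z' = dy k z from hz')
    have hr := rk_pos k
    have hr1 := rk_le k
    rw [Metric.mem_ball, Prod.dist_eq, Real.dist_eq, dist_eq_norm]
    have hs := Real.sqrt_nonneg d
    have : 0 ≤ Real.sqrt d * rk k := by positivity
    refine max_lt ?_ ?_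
    · nlinarith
    · nlinarith
  classical
  set k := Nat.find hex with hk
  have hks := Nat.find_spec hex
  refine mem_biUnion (x := (k, dy k z)) ⟨hks.1, ?_, hks.2, ?_⟩ (show dy k z = dy k z from rfl)
  · intro z' hz'
    have : dy 0 z' = dy 0 z := dy_le (Nat.zero_le k) hz'
    exact this.trans hzQ
  · by_cases h : k = k0
    · exact Or.inl h
    · right
      have h1 : k0 < k := lt_of_le_of_ne hks.1 (Ne.symm h)
      refine ⟨k - 1, by simp only; omega, by omega, ?_⟩
      have h2 := Nat.find_min hex (m := k - 1) (by omega)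
      have h3 : ¬ Disjoint (cube (k - 1) (dy (k - 1) z)) G := fun hd => h2 ⟨by omega, hd⟩
      obtain ⟨z', hz', hz'G⟩ := Set.not_disjoint_iff.1 h3
      exact ⟨z', hz'G, z, rfl, hz'⟩

lemma stop_int {d : ℕ} (k0 : ℕ) {G : Set (ZZ d)} (hG : IsClosed G) (hGQ : G ⊆ Q0 d) (F : ZZ d → ℝ≥0∞) {B : ℝ≥0∞}
    (hB : ∀ a ∈ stopI k0 G, ∫⁻ z in Q0 d, F (sc (tbq a.1 a.2) (rk a.1 ^ 2) (xbq a.1 a.2) (rk a.1) z) ≤ B) :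
    ∫⁻ z in Q0 d, F z ≤ (∫⁻ z in G, F z) + (1 - volume G) * B := by
  have hc : (stopI k0 G).Countable := Set.to_countable _
  have h1 : ∫⁻ z in Q0 d, F z ≤ (∫⁻ z in G, F z) + ∫⁻ z in ⋃ a ∈ stopI k0 G, cube a.1 a.2, F z := by
    refine le_trans (lintegral_mono_set ?_) (lintegral_union_le _ _ _)
    intro z hz
    by_cases h : z ∈ G
    · exact Or.inl h
    · exact Or.inr (stop_cover k0 hG ⟨hz, h⟩)
  refine h1.trans ?_
  gcongr
  rw [lintegral_biUnion hc (fun a _ => cube_measurable _ _) (stop_disj k0 G)]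
  have h2 : ∀ a : stopI k0 G, ∫⁻ z in cube (a : ℕ × (ℤ × (Fin d → ℤ))).1 (a : ℕ × (ℤ × (Fin d → ℤ))).2, F z ≤
      volume (cube (a : ℕ × (ℤ × (Fin d → ℤ))).1 (a : ℕ × (ℤ × (Fin d → ℤ))).2) * B := by
    rintro ⟨a, ha⟩
    rw [cube_int]
    gcongr
    exact hB a ha
  refine (ENNReal.tsum_le_tsum h2).trans ?_
  rw [ENNReal.tsum_mul_right, ← measure_biUnion hc (stop_disj k0 G) (fun a _ => cube_measurable _ _)]
  gcongr
  rw [← vol_Q0 d, ← measure_sdiff hGQ hG.measurableSet.nullMeasurableSet]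
  · apply measure_mono
    refine iUnion₂_subset fun a ha z hz => ⟨ha.2.1 hz, Set.disjoint_left.1 ha.2.2.1 hz⟩
  · exact ne_top_of_le_ne_top (by rw [vol_Q0]; simp) (measure_mono hGQ)

lemma touchU (d : ℕ) {δ K R : ℝ} (hδ : 0 < δ) (hK : 0 ≤ K) (hR : 0 < R) :
    ∃ C κ : ℝ, 1 ≤ C ∧ 0 < κ ∧ ∀ (U : ℝ) (_ : 1 ≤ U) (u f g : ZZ d → ℝ) (x1 c : EE d),
      C2on u (cyl (-1/2) 1 0 R) → ‖c‖ + 1 ≤ R → ‖x1 - c‖ ≤ 1 / 4 →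
      (∀ z ∈ cyl (-1/2) 1 0 R, 0 ≤ u z) → (∀ z ∈ cyl (-1/2) 1 0 R, 0 ≤ f z) →
      (∀ z ∈ cyl (-1/2) 1 0 R, 0 ≤ g z) →
      (∀ z ∈ cyl (-1/2) 1 0 R, Super δ K u z (g z - f z)) →
      (∫⁻ z in cyl (-1/2) 1 0 R, ENNReal.ofReal (g z) ^ (d + 1) ≤ 1) →
      u (-1/2, x1) ≤ U →
      ∃ G : Set (ZZ d), G ⊆ Ico (1/2) 1 ×ˢ Metric.ball c (1/2) ∧ MeasurableSet G ∧
        ENNReal.ofReal κ ≤ volume G ∧ ∀ z ∈ G, f z ≤ g z + C * U ∧ u z ≤ C * U ∧ ∃ p : EE d, ‖p‖ ≤ C * U ∧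
        ∀ τ ∈ Icc z.1 1, ∀ y ∈ Metric.closedBall 0 R,
          u z + inner ℝ p (y - z.2) - C * U * (‖y - z.2‖ ^ 2 + (τ - z.1)) ≤ u (τ, y) := by
  obtain ⟨C, κ, hC, hκ, H⟩ := touch d (U := 1) hδ hK hR zero_le_one
  refine ⟨C, κ, hC, hκ, ?_⟩
  intro U hU u f g x1 c hu hc hx1 hu0 hf0 hg0 hsup hgint hv
  have hU0 : 0 < U := by linarith
  have hUi : 0 < U⁻¹ := by positivity
  have hUi1 : U⁻¹ ≤ 1 := inv_le_one_of_one_le₀ hU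
  have H1 : ∀ z ∈ cyl (-1/2) 1 0 R, Super δ K (fun z => U⁻¹ * u z + 0 * u z) z (U⁻¹ * g z - U⁻¹ * f z) := by
    intro z hz
    obtain ⟨a, b, c, hA, hL⟩ := hsup z hz
    refine ⟨a, b, c, hA, ?_⟩
    rw [Lop_lin (hu z hz) (hu z hz)]
    have := mul_le_mul_of_nonneg_left hL hUi.le
    linarith
  have H2 : ∫⁻ z in cyl (-1/2) 1 0 R, ENNReal.ofReal (U⁻¹ * g z) ^ (d + 1) ≤ 1 := by
    refine le_trans (lintegral_mono_ae ?_) hgint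
    refine (ae_restrict_iff' (isCompact_cyl _ _ _ _).measurableSet).2 (Filter.Eventually.of_forall fun z hz => ?_)
    have := hg0 z hz
    gcongr
    nlinarith
  have H3 : U⁻¹ * u (-1/2, x1) + 0 * u (-1/2, x1) ≤ 1 := by
    simp only [zero_mul, add_zero]
    rw [inv_mul_le_iff₀ hU0]; linarith
  obtain ⟨G, hG1, hG2, hG3, hG4⟩ := H (fun z => U⁻¹ * u z + 0 * u z) (fun z => U⁻¹ * f z) (fun z => U⁻¹ * g z) x1 c
    (fun z hz => C2_lin (hu z hz) (hu z hz) _ _) hc hx1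
    (fun z hz => by have := hu0 z hz; simp only [zero_mul, add_zero]; positivity)
    (fun z hz => by have := hf0 z hz; positivity)
    (fun z hz => by have := hg0 z hz; positivity) H1 H2 H3
  refine ⟨G, hG1, hG2, hG3, fun z hz => ?_⟩
  obtain ⟨h1, h2, p, hp, h3⟩ := hG4 z hz
  simp only [zero_mul, add_zero] at h1 h2 h3
  have e : ∀ x : ℝ, U * (U⁻¹ * x) = x := fun x => by field_simp
  refine ⟨?_, ?_, U • p, ?_, ?_⟩
  · have := mul_le_mul_of_nonneg_left h1 hU0.le
    rw [mul_add, e, e] at this; linarith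
  · have := mul_le_mul_of_nonneg_left h2 hU0.le
    rw [e] at this; linarith
  · rw [norm_smul, Real.norm_of_nonneg hU0.le]; nlinarith
  · intro τ hτ y hy
    have := mul_le_mul_of_nonneg_left (h3 τ hτ y hy) hU0.le
    rw [mul_sub, mul_add, e, e] at this
    rw [inner_smul_left]
    simp only [conj_trivial]
    linarith

lemma cyl_mono {d : ℕ} {t0 t1 s0 s1 : ℝ} {x y : EE d} {r R : ℝ} (h0 : s0 ≤ t0) (h1 : t1 ≤ s1) (h : ‖x - y‖ + r ≤ R) :
    cyl t0 t1 x r ⊆ cyl s0 s1 y R := by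
  refine prod_mono (Icc_subset_Icc h0 h1) (Metric.closedBall_subset_closedBall' ?_)
  rw [dist_eq_norm]; linarith

/-- center of the unit cube -/
def ctr (d : ℕ) : EE d := WithLp.toLp 2 (fun _ => 1 / 2)

lemma ctr_norm (d : ℕ) : ‖ctr d‖ ≤ Real.sqrt d := by
  have := norm_le_of_coord (x := ctr d) (r := 1) zero_le_one (fun i => by
    show |(1 / 2 : ℝ)| ≤ 1
    rw [abs_of_pos] <;> norm_num)
  linarith

lemma coord_le {d : ℕ} (x : EE d) (i : Fin d) : |x i| ≤ ‖x‖ := by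
  have := PiLp.norm_apply_le x i
  simpa using this

lemma ball_Q0 {d : ℕ} : Ico (1/2 : ℝ) 1 ×ˢ Metric.ball (ctr d) (1/2) ⊆ Q0 d := by
  rintro ⟨t, x⟩ ⟨ht, hx⟩
  rw [mem_Q0]
  refine ⟨⟨by linarith [ht.1], ht.2⟩, fun i => ?_⟩
  rw [Metric.mem_ball, dist_eq_norm] at hx
  have h := (coord_le (x - ctr d) i).trans_lt hx
  have e : (x - ctr d) i = x i - 1 / 2 := rfl
  rw [e, abs_lt] at h
  simp only at h ⊢
  constructor <;> linarith

lemma Q0_norm {d : ℕ} {z : ZZ d} (hz : z ∈ Q0 d) : ‖z.2‖ ≤ Real.sqrt d := by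
  rw [mem_Q0] at hz
  have := norm_le_of_coord (x := z.2) (r := 1) zero_le_one (fun i => by
    rw [abs_of_nonneg (hz.2 i).1]; exact (hz.2 i).2.le)
  linarith

lemma cube_top {d : ℕ} {k : ℕ} {q : ℤ × (Fin d → ℤ)} (h : cube k q ⊆ Q0 d) :
    0 ≤ tbq k q ∧ tbq k q + rk k ^ 2 ≤ 1 := by
  have hb := (mem_Q0 _).1 (h (cube_base k q))
  refine ⟨hb.1.1, ?_⟩
  have hp := pow_pos (rk_pos k) 2
  refine le_of_forall_lt fun t ht => ?_
  rcases lt_or_ge t (tbq k q) with h1 | h1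
  · linarith [hb.1.2]
  · have hz : ((t, xbq k q) : ZZ d) ∈ cube k q := by
      have hzz : ((t - tbq k q) / rk k ^ 2, (0 : EE d)) ∈ Q0 d := by
        rw [mem_Q0]
        refine ⟨⟨div_nonneg (by linarith) hp.le, by rw [div_lt_one hp]; linarith⟩, fun i => by simp⟩
      rw [← sc_cube k q] at hzz
      have e : sc (tbq k q) (rk k ^ 2) (xbq k q) (rk k) ((t - tbq k q) / rk k ^ 2, (0 : EE d)) = (t, xbq k q) := by
        unfold sc
        refine Prod.ext ?_ ?_
        · simp only; rw [mul_div_cancel₀ _ hp.ne']; ring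
        · simp
      rw [mem_preimage, e] at hzz
      exact hzz
    exact ((mem_Q0 _).1 (h hz)).1.2

def R0 (d : ℕ) : ℝ := 4 * Real.sqrt d + 8
def X0 (d : ℕ) : ℝ := 2 * Real.sqrt d + 1

lemma R0_pos (d : ℕ) : 0 < R0 d := by unfold R0; positivity

lemma Super.mono {d : ℕ} {δ K : ℝ} {u : ZZ d → ℝ} {z : ZZ d} {v w : ℝ} (h : Super δ K u z v) (hvw : v ≤ w) :
    Super δ K u z w := by
  obtain ⟨a, b, c, hA, hL⟩ := h
  exact ⟨a, b, c, hA, hL.trans hvw⟩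

lemma cls_G (d : ℕ) {δ K : ℝ} (hδ : 0 < δ) (hK : 0 ≤ K) :
    ∃ κ : ℝ, 0 < κ ∧ ∀ m1 : ℝ, 1 ≤ m1 → ∃ C : ℝ, 1 ≤ C ∧ ∀ (u f g : ZZ d → ℝ) (τ0 : ℝ) (x0 : EE d),
      Cls d δ K (R0 d) m1 (X0 d) u f g τ0 x0 →
      ∃ G : Set (ZZ d), G ⊆ Ico (1/2) 1 ×ˢ Metric.ball (ctr d) (1/2) ∧ MeasurableSet G ∧
        ENNReal.ofReal κ ≤ volume G ∧ ∀ z ∈ G, f z ≤ g z + C ∧ u z ≤ C ∧ ∃ p : EE d, ‖p‖ ≤ C ∧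
        ∀ τ ∈ Icc z.1 1, ∀ y ∈ Metric.closedBall 0 (R0 d),
          u z + inner ℝ p (y - z.2) - C * (‖y - z.2‖ ^ 2 + (τ - z.1)) ≤ u (τ, y) := by
  obtain ⟨C, κ, hC, hκ, H⟩ := touchU d hδ hK (R0_pos d)
  refine ⟨κ, hκ, fun m1 hm1 => ?_⟩
  obtain ⟨S, hS, HS⟩ := spread d (τ := m1) (σ := 1/2) (ρ := 1/4) hδ hK (R0_pos d) (by norm_num) (by linarith)
    (by norm_num) (by norm_num)
  refine ⟨C * (S * 3), by nlinarith, ?_⟩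
  intro u f g τ0 x0 hc
  have ht1 := hc.t1
  have ht2 := hc.t2
  have hs := Real.sqrt_nonneg d
  have hsub1 : cyl (d := d) (-τ0) (-1/2) 0 (R0 d) ⊆ cyl (-τ0) 1 0 (R0 d) := cyl_mono le_rfl (by norm_num) (by simp)
  have hsub2 : cyl (d := d) (-1/2) 1 0 (R0 d) ⊆ cyl (-τ0) 1 0 (R0 d) := cyl_mono (by linarith) le_rfl (by simp)
  have hctr := ctr_norm d
  have hx := hc.hx
  unfold X0 at hx
  obtain ⟨x1, hx1, hx1c, hux1⟩ := HS u g (-τ0) (-1/2) 0 x0 (ctr d) 1 1 (fun z hz => hc.hu z (hsub1 hz)) (by linarith)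
    (by linarith) (by rw [sub_zero, R0]; linarith) (by rw [sub_zero, R0]; linarith)
    (fun z hz => hc.u0 z (hsub1 hz)) (fun z hz => hc.g0 z (hsub1 hz))
    (fun z hz => (hc.sup z (hsub1 hz)).mono (by have := hc.f0 z (hsub1 hz); linarith)) zero_le_one
    ((lintegral_mono_set hsub1).trans (hc.int.trans (by simp))) hc.vx zero_le_one
  have hux : u (-1/2, x1) ≤ S * 3 := by linarith
  exact H (S * 3) (by linarith) u f g x1 (ctr d) (fun z hz => hc.hu z (hsub2 hz)) (by rw [R0]; linarith)
    hx1c (fun z hz => hc.u0 z (hsub2 hz)) (fun z hz => hc.f0 z (hsub2 hz)) (fun z hz => hc.g0 z (hsub2 hz))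
    (fun z hz => hc.sup z (hsub2 hz)) ((lintegral_mono_set hsub2).trans hc.int) hux

/-- combinatorial selection of the good set -/
lemma select (d : ℕ) {κ : ℝ} (hκ : 0 < κ) : ∃ (m : ℝ) (k0 : ℕ), 1 < m ∧ 1 ≤ k0 ∧ ∀ M : ℝ, 0 < M → ∃ Λ : ℝ, 1 ≤ Λ ∧
    ∀ (F : ZZ d → ℝ≥0∞) (_ : ∫⁻ z, F z ≤ 1) (G : Set (ZZ d)),
      G ⊆ Ico (1/2) 1 ×ˢ Metric.ball (ctr d) (1/2) → MeasurableSet G → ENNReal.ofReal κ ≤ volume G →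
      ∃ G' ⊆ G, IsClosed G' ∧ ENNReal.ofReal (κ / 8) ≤ volume G' ∧ ∀ z ∈ G', ∀ k, k0 < k →
        (∃ s ∈ Icc (z.1 - m * (5 * rk k ^ 2)) (z.1 - 5 * rk k ^ 2), (s, z.2) ∈ G) ∧
        ∫⁻ w in pc M (rk k) z, F w ≤ ENNReal.ofReal (Λ * rk k ^ (d + 2)) := by
  set vB := (volume (Metric.ball (ctr d) (1/2))).toReal with hvB
  have hvBe : volume (Metric.ball (ctr d) (1/2)) = ENNReal.ofReal vB := by
    rw [hvB, ENNReal.ofReal_toReal measure_ball_lt_top.ne]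
  have hvB0 : 0 ≤ vB := ENNReal.toReal_nonneg
  set m := 2 + 12 * vB / κ with hm
  have hm1 : 1 < m := by have : 0 ≤ 12 * vB / κ := by positivity
                         linarith
  have hmv : 3 / (m - 1) * vB ≤ κ / 4 := by
    rw [div_mul_eq_mul_div, div_le_iff₀ (by linarith)]
    have : κ * (12 * vB / κ) = 12 * vB := by field_simp
    have h2 : κ / 4 * (m - 1) = κ / 4 + (κ * (12 * vB / κ)) / 4 := by rw [hm]; ring
    rw [h2, this]; linarith
  have hten : Filter.Tendsto (fun k : ℕ => m * (5 * rk k)) Filter.atTop (nhds 0) := by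
    have := ((tendsto_pow_atTop_nhds_zero_of_lt_one (by norm_num : (0 : ℝ) ≤ 1 / 2) (by norm_num)).const_mul 5).const_mul m
    simpa [rk] using this
  obtain ⟨k0, hk0, hk1⟩ := ((hten.eventually (gt_mem_nhds one_pos)).and (Filter.eventually_ge_atTop 1)).exists
  refine ⟨m, k0, hm1, hk1, fun M hM => ?_⟩
  have hvR := vR_nonneg d (13 * M)
  set Λ := 1 + 4 * (2 * (13 * M) * vR d (13 * M)) / κ with hΛ
  have hΛ1 : 1 ≤ Λ := by have : 0 ≤ 4 * (2 * (13 * M) * vR d (13 * M)) / κ := by positivity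
                         linarith
  have hΛ2 : 2 * (13 * M) * vR d (13 * M) / Λ ≤ κ / 4 := by
    rw [div_le_iff₀ (by linarith)]
    have : κ * (4 * (2 * (13 * M) * vR d (13 * M)) / κ) = 4 * (2 * (13 * M) * vR d (13 * M)) := by field_simp
    have h2 : κ / 4 * Λ = κ / 4 + κ * (4 * (2 * (13 * M) * vR d (13 * M)) / κ) / 4 := by rw [hΛ]; ring
    rw [h2, this]; linarith
  refine ⟨Λ, hΛ1, ?_⟩
  intro F hF G hG1 hG2 hG3
  obtain ⟨Kc, hKG, hKc, hKv⟩ := hG2.exists_lt_isCompact (μ := volume) (r := ENNReal.ofReal (3 * κ / 4))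
    (lt_of_lt_of_le (by rw [ENNReal.ofReal_lt_ofReal_iff hκ]; linarith) hG3)
  have hrk : ∀ j : ℕ, rk (j + k0 + 1) ≤ rk k0 := fun j =>
    pow_le_pow_of_le_one (by norm_num) (by norm_num) (by omega)
  obtain ⟨K', hK'K, hK'c, hK'v, hK'⟩ := good_set hKc (B := Metric.ball (ctr d) (1/2)) measurableSet_ball
    (fun z hz => by
      have := hG1 (hKG hz)
      exact ⟨⟨by linarith [this.1.1], this.1.2.le⟩, this.2⟩) hm1 (fun j => 5 * rk (j + k0 + 1) ^ 2)
    (fun j => by have := rk_pos (j + k0 + 1); positivity)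
    (fun j => by
      have h1 := rk_pos (j + k0 + 1)
      have h2 := rk_le (j + k0 + 1)
      have h3 := hrk j
      have h4 : rk (j + k0 + 1) ^ 2 ≤ rk k0 := by nlinarith
      have h5 : m * (5 * rk (j + k0 + 1) ^ 2) ≤ m * (5 * rk k0) := by
        have : 0 < m := by linarith
        gcongr
      linarith)
  have hbad := maximal_bd (M := M) (Λ := Λ) hM (by linarith) F univ (by simpa using hF)
  set Bd := {z : ZZ d | ∃ r, 0 < r ∧ r ≤ 1 ∧ pc M r z ⊆ univ ∧
    ENNReal.ofReal (Λ * r ^ (d + 2)) < ∫⁻ z in pc M r z, F z} with hBd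
  have hHv : volume (toMeasurable volume Bd) ≤ ENNReal.ofReal (κ / 4) := by
    rw [measure_toMeasurable]
    exact hbad.trans (ENNReal.ofReal_le_ofReal hΛ2)
  have hmeas : MeasurableSet (K' \ toMeasurable volume Bd) :=
    hK'c.measurableSet.diff (measurableSet_toMeasurable _ _)
  have hlow : ENNReal.ofReal (κ / 4) ≤ volume (K' \ toMeasurable volume Bd) := by
    have h1 : volume K' ≤ volume (K' \ toMeasurable volume Bd) + ENNReal.ofReal (κ / 4) := by
      refine (measure_mono (t := (K' \ toMeasurable volume Bd) ∪ toMeasurable volume Bd) (by intro z hz; by_cases h : z ∈ toMeasurable volume Bd <;> simp [hz, h])).trans ?_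
      exact (measure_union_le _ _).trans (by gcongr)
    have h2 : ENNReal.ofReal (3 * κ / 4) ≤ volume (K' \ toMeasurable volume Bd) + ENNReal.ofReal (κ / 4) + ENNReal.ofReal (κ / 4) := by
      refine hKv.le.trans (hK'v.trans ?_)
      gcongr
      rw [hvBe, ← ENNReal.ofReal_mul (by have : 0 < m - 1 := by linarith
                                         positivity)]
      exact ENNReal.ofReal_le_ofReal hmv
    have h3 : ENNReal.ofReal (3 * κ / 4) = ENNReal.ofReal (κ / 4) + ENNReal.ofReal (κ / 4) + ENNReal.ofReal (κ / 4) := by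
      rw [← ENNReal.ofReal_add (by positivity) (by positivity), ← ENNReal.ofReal_add (by positivity) (by positivity)]
      congr 1; ring
    rw [h3, ENNReal.add_le_add_iff_right ENNReal.ofReal_ne_top, ENNReal.add_le_add_iff_right ENNReal.ofReal_ne_top] at h2
    exact h2
  obtain ⟨G', hG'1, hG'c, hG'v⟩ := hmeas.exists_lt_isCompact (μ := volume) (r := ENNReal.ofReal (κ / 8))
    (lt_of_lt_of_le (by rw [ENNReal.ofReal_lt_ofReal_iff (by positivity)]; linarith) hlow)
  refine ⟨G', fun z hz => hKG (hK'K (hG'1 hz).1), hG'c.isClosed, hG'v.le, fun z hz k hk => ⟨?_, ?_⟩⟩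
  · obtain ⟨j, rfl⟩ : ∃ j, k = j + k0 + 1 := ⟨k - k0 - 1, by omega⟩
    obtain ⟨s, hs, hsK⟩ := hK' z (hG'1 hz).1 j
    exact ⟨s, hs, hKG hsK⟩
  · by_contra hcon
    push Not at hcon
    exact (hG'1 hz).2 (subset_toMeasurable _ _ ⟨rk k, rk_pos k, rk_le k, subset_univ _, hcon⟩)

set_option maxHeartbeats 1000000 in
lemma cls_dec (d : ℕ) {δ K : ℝ} (hδ : 0 < δ) (hK : 0 ≤ K) :
    ∃ (m1 κ C A : ℝ) (k0 : ℕ), 1 ≤ m1 ∧ 0 < κ ∧ 1 ≤ C ∧ 1 ≤ A ∧ ∀ (u f g : ZZ d → ℝ) (τ0 : ℝ) (x0 : EE d),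
      Cls d δ K (R0 d) m1 (X0 d) u f g τ0 x0 →
      ∃ G : Set (ZZ d), IsClosed G ∧ G ⊆ Q0 d ∧ ENNReal.ofReal κ ≤ volume G ∧ (∀ z ∈ G, f z ≤ g z + C) ∧
        ∀ a ∈ stopI k0 G, ∃ u' g' τ' x', Cls d δ K (R0 d) m1 (X0 d) u'
          (fun z => A⁻¹ * f (sc (tbq a.1 a.2) (rk a.1 ^ 2) (xbq a.1 a.2) (rk a.1) z)) g' τ' x' := by
  obtain ⟨κ, hκ, HG⟩ := cls_G d hδ hK
  obtain ⟨m, k0, hm, hk0, HS⟩ := select d hκ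
  have hs := Real.sqrt_nonneg d
  have hR := R0_pos d
  set m1 := 5 * m + 4 with hm1
  obtain ⟨C, hC, HG⟩ := HG m1 (by linarith)
  set M := 5 * m + 5 + R0 d + 2 * Real.sqrt d with hM
  obtain ⟨Λ1, hΛ1, HS⟩ := HS M (by positivity)
  obtain ⟨S, hS, Hsp⟩ := spread d (τ := m1 + 1) (σ := 1/2) (ρ := rk k0) hδ hK (R0_pos d) (by norm_num) (by linarith)
    (rk_pos k0) (rk_le k0)
  have hr0 := rk_pos k0
  set Λ := Λ1 + (rk k0 ^ (d + 2))⁻¹ with hΛ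
  have hΛ0 : 0 ≤ Λ := by have := pow_pos hr0 (d + 2); positivity
  set C1 := C + 2 * C * (d * δ⁻¹) + K * (C + 2 * C * (2 * R0 d)) + K * (C + C * (2 * R0 d)) with hC1
  have hC10 : 0 ≤ C1 := by positivity
  have hvR := vR_nonneg d (R0 d)
  set A := 1 + 2 ^ d * (Λ + C1 ^ (d + 1) * ((m1 + 1) * vR d (R0 d))) + S * 3 * (rk k0 ^ 2)⁻¹ with hA
  have hA0 : 0 ≤ 2 ^ d * (Λ + C1 ^ (d + 1) * ((m1 + 1) * vR d (R0 d))) := by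
    have : 0 ≤ m1 + 1 := by linarith
    positivity
  have hA00 : 0 ≤ S * 3 * (rk k0 ^ 2)⁻¹ := by positivity
  have hA1 : 1 ≤ A := by linarith
  have hA2 : 2 ^ d * (Λ + C1 ^ (d + 1) * ((m1 + 1) * vR d (R0 d))) ≤ A ^ (d + 1) := by
    refine le_trans ?_ (le_self_pow₀ hA1 (by simp : d + 1 ≠ 0))
    linarith
  refine ⟨m1, κ / 8, C, A, k0, by linarith, by positivity, hC, hA1, ?_⟩
  intro u f g τ0 x0 hc
  have ht1 := hc.t1
  have ht2 := hc.t2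
  obtain ⟨G, hG1, hG2, hG3, hG4⟩ := HG u f g τ0 x0 hc
  set D : Set (ZZ d) := cyl (-τ0) 1 0 (R0 d) with hD
  have hDm : MeasurableSet D := (isCompact_cyl _ _ _ _).measurableSet
  set F : ZZ d → ℝ≥0∞ := D.indicator (fun z => ENNReal.ofReal (g z) ^ (d + 1)) with hF
  have hF1 : ∫⁻ z, F z ≤ 1 := by rw [hF, lintegral_indicator hDm]; exact hc.int
  have hFle : ∀ s : Set (ZZ d), MeasurableSet s → s ⊆ D → ∀ t, s ⊆ t →
      ∫⁻ z in s, ENNReal.ofReal (g z) ^ (d + 1) ≤ ∫⁻ z in t, F z := by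
    intro s hs hsD t hst
    refine le_trans (le_of_eq ?_) (lintegral_mono_set hst)
    refine setLIntegral_congr_fun hs fun z hz => ?_
    rw [hF, indicator_of_mem (hsD hz)]
  obtain ⟨G', hG'G, hG'c, hG'v, hG'⟩ := HS F hF1 G hG1 hG2 hG3
  refine ⟨G', hG'c, fun z hz => ball_Q0 (hG1 (hG'G hz)), hG'v, fun z hz => (hG4 z (hG'G hz)).1, ?_⟩
  rintro ⟨k, q⟩ ⟨hk, hQ, hdj, hcase⟩
  simp only at hk hQ hdj hcase ⊢
  have hbase := hQ (cube_base k q)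
  have hxb := Q0_norm hbase
  simp only at hxb
  obtain ⟨htb0, htb1⟩ := cube_top hQ
  set r := rk k with hr
  have hrp : 0 < r := rk_pos k
  have hr1 : r ≤ 1 := rk_le k
  have hrh : r ≤ 1 / 2 := by
    have : rk k ≤ rk 1 := pow_le_pow_of_le_one (by norm_num) (by norm_num) (by omega)
    have h1 : rk 1 = 1 / 2 := by simp [rk]
    rw [hr]; linarith
  have hr2 : 0 < r ^ 2 := by positivity
  have hr2h : r ^ 2 ≤ 1 / 4 := by nlinarith
  have hRr : R0 d * r ≤ R0 d / 2 := by nlinarith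
  have hXr : ∀ y ∈ Metric.closedBall (xbq k q) (R0 d * r), ‖y‖ ≤ R0 d := by
    intro y hy
    rw [Metric.mem_closedBall, dist_eq_norm] at hy
    have h1 := norm_le_norm_add_norm_sub' y (xbq k q)
    have h2 : R0 d = 4 * Real.sqrt d + 8 := rfl
    linarith
  have hsubD : ∀ t1, -τ0 ≤ t1 → cyl t1 (tbq k q + r ^ 2) (xbq k q) (R0 d * r) ⊆ D := by
    intro t1 ht
    refine cyl_mono ht htb1 ?_
    rw [sub_zero]
    have h2 : R0 d = 4 * Real.sqrt d + 8 := rfl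
    linarith
  rcases hcase with hkk | ⟨k', hk', hk'0, z', hz', z, hz, hdy⟩
  · -- first generation
    have hrr : r = rk k0 := by rw [hr, hkk]
    have hsub1 : cyl (-τ0) (tbq k q - r ^ 2) 0 (R0 d) ⊆ D := cyl_mono le_rfl (by linarith) (by simp)
    have hx := hc.hx
    have hR0 : R0 d = 4 * Real.sqrt d + 8 := rfl
    have hX0 : X0 d = 2 * Real.sqrt d + 1 := rfl
    obtain ⟨x1, hx1, hx1c, hux1⟩ := Hsp u g (-τ0) (tbq k q - r ^ 2) 0 x0 (xbq k q) 1 1 (fun z hz => hc.hu z (hsub1 hz))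
      (by linarith) (by linarith) (by rw [sub_zero]; linarith) (by rw [sub_zero]; linarith)
      (fun z hz => hc.u0 z (hsub1 hz)) (fun z hz => hc.g0 z (hsub1 hz))
      (fun z hz => (hc.sup z (hsub1 hz)).mono (by have := hc.f0 z (hsub1 hz); linarith)) zero_le_one
      ((lintegral_mono_set hsub1).trans (hc.int.trans (by simp))) hc.vx zero_le_one
    have hsub := hsubD (tbq k q - r ^ 2) (by linarith)
    have hLam : 1 ≤ Λ * r ^ (d + 2) := by
      have h1 : 0 < r ^ (d + 2) := by positivity
      have h2 : (rk k0 ^ (d + 2))⁻¹ * r ^ (d + 2) = 1 := by rw [hrr]; field_simp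
      rw [hΛ, add_mul, h2]
      have : 0 ≤ Λ1 * r ^ (d + 2) := by positivity
      linarith
    have hAr : S * 3 ≤ A * r ^ 2 := by
      have h2 : S * 3 * (rk k0 ^ 2)⁻¹ * r ^ 2 = S * 3 := by rw [hrr]; field_simp
      have h3 : S * 3 * (rk k0 ^ 2)⁻¹ * r ^ 2 ≤ A * r ^ 2 := by
        apply mul_le_mul_of_nonneg_right _ hr2.le
        linarith
      linarith
    have := cls_step (δ := δ) (K := K) (R := R0 d) (m1 := m1) (X0 := X0 d) (u := u) (f := f) (g := g) (l := fun _ => 0)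
      (tb := tbq k q) (t1 := tbq k q - r ^ 2) (xb := xbq k q) (x1 := x1)
      hC10 hΛ0 (by linarith : 0 < A) hA2 hrp hr1 (by linarith) (by nlinarith)
      (by rw [hrr] at *; nlinarith) (fun z hz => hc.hu z (hsub hz)) (fun z => contDiffAt_const)
      (fun z hz => hc.u0 z (hsub hz)) (fun z hz => hc.f0 z (hsub hz)) (fun z hz => hc.g0 z (hsub hz))
      (fun z hz => hc.sup z (hsub hz)) ?_ ?_ ?_
    · exact ⟨_, _, _, _, this⟩
    · intro z hz a b c _
      have : Lop a b c (fun _ => (0 : ℝ)) z = 0 := by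
        have := Lop_lin (u := fun _ => (0 : ℝ)) (v := fun _ => (0 : ℝ)) (z := z) contDiffAt_const contDiffAt_const 0 0 a b c
        simpa using this
      rw [this]; linarith
    · refine (lintegral_mono_set hsub).trans (hc.int.trans ?_)
      rw [← ENNReal.ofReal_one]
      exact ENNReal.ofReal_le_ofReal hLam
    · simp only [sub_zero]; linarith
  · -- later generations
    obtain ⟨⟨s, hs1, hsG⟩, hmax⟩ := hG' z' hz' k (by omega)
    have hdy2 : dy k' ((tbq k q, xbq k q) : ZZ d) = dy k' z' := by
      rw [hdy]
      apply dy_succ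
      rw [← hk']
      exact (show dy k ((tbq k q, xbq k q) : ZZ d) = q from cube_base k q).trans (show dy k z = q from hz).symm
    obtain ⟨hd1, hd2⟩ := cube_dist hdy2
    have hrk' : rk k' = 2 * r := by
      rw [hr, hk']; unfold rk; rw [pow_succ]; ring
    rw [hrk'] at hd1 hd2
    simp only at hd1 hd2
    rw [abs_le] at hd1
    obtain ⟨-, hus, p, hp, hlow⟩ := hG4 _ hsG
    have hGs := hG1 hsG
    have hGs1 : (1/2 : ℝ) ≤ s := hGs.1.1
    have hsub := hsubD s (by linarith)
    have hz'Q := Q0_norm (ball_Q0 (hG1 (hG'G hz')))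
    have hR0 : R0 d = 4 * Real.sqrt d + 8 := rfl
    have hX0 : X0 d = 2 * Real.sqrt d + 1 := rfl
    have hrd : 0 ≤ Real.sqrt d * r := by positivity
    have hmr : 0 ≤ m * r ^ 2 := by positivity
    have hRr2 : 0 ≤ R0 d * r ^ 2 := by positivity
    have hsr2 : 0 ≤ Real.sqrt d * r ^ 2 := by positivity
    have hmr' : 0 ≤ m * r := by positivity
    have hRr' : 0 ≤ R0 d * r := by positivity
    have := cls_step (δ := δ) (K := K) (R := R0 d) (m1 := m1) (X0 := X0 d) (u := u) (f := f) (g := g)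
      (l := qd (u (s, z'.2)) C p (s, z'.2))
      (tb := tbq k q) (t1 := s) (xb := xbq k q) (x1 := z'.2)
      hC10 hΛ0 (by linarith : 0 < A) hA2 hrp hr1 (by linarith [hs1.2]) (by rw [hm1]; linarith [hs1.1])
      (by rw [norm_sub_rev, hX0]; nlinarith) (fun z hz => hc.hu z (hsub hz)) (fun z => qd_C2 _ _ _ _ _)
      ?_ (fun z hz => hc.f0 z (hsub hz)) (fun z hz => hc.g0 z (hsub hz))
      (fun z hz => hc.sup z (hsub hz)) ?_ ?_ ?_
    · exact ⟨_, _, _, _, this⟩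
    · intro z hz
      exact hlow z.1 ⟨hz.1.1, hz.1.2.trans htb1⟩ z.2 (by simpa using hXr _ hz.2)
    · intro w hw a b c hAd
      have hY : ‖w.2 - z'.2‖ ≤ 2 * R0 d := by
        have h1 := norm_sub_le w.2 z'.2
        have h2 := hXr _ hw.2
        linarith
      have hu0 := hc.u0 (s, z'.2) ⟨⟨by linarith, by linarith [hGs.1.2]⟩, by
        rw [Metric.mem_closedBall, dist_zero_right]; show ‖z'.2‖ ≤ R0 d; linarith⟩
      have h3 := qd_Lop (δ := δ) (K := K) (C := C) (P := C) (Y := 2 * R0 d) (z1 := (s, z'.2)) (z := w) hAd (by linarith) hu0 hp hY hw.1.1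
      refine le_trans ?_ h3
      have h4 : K * (u (s, z'.2) + C * (2 * R0 d)) ≤ K * (C + C * (2 * R0 d)) := by gcongr
      rw [hC1]; linarith
    · refine (hFle _ (isCompact_cyl _ _ _ _).measurableSet hsub (pc M r z') ?_).trans (hmax.trans ?_)
      · refine cyl_mono ?_ ?_ ?_
        · rw [hM]; linarith [hs1.1]
        · rw [hM]; linarith
        · rw [hM]; linarith
      · apply ENNReal.ofReal_le_ofReal
        have : 0 ≤ (rk k0 ^ (d + 2))⁻¹ := by positivity
        gcongr
        linarith
    · have : qd (u (s, z'.2)) C p (s, z'.2) (s, z'.2) = u (s, z'.2) := by simp [qd]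
      rw [this, sub_self]; positivity

lemma rpow_le_one_add {x : ℝ≥0∞} {γ : ℝ} (h0 : 0 ≤ γ) (h1 : γ ≤ 1) : x ^ γ ≤ 1 + x := by
  rcases le_total x 1 with h | h
  · exact (ENNReal.rpow_le_one h h0).trans le_self_add
  · calc x ^ γ ≤ x ^ (1 : ℝ) := ENNReal.rpow_le_rpow_of_exponent_le h h1
      _ = x := ENNReal.rpow_one x
      _ ≤ 1 + x := le_add_self

lemma le_one_add_pow (x : ℝ≥0∞) (d : ℕ) : x ≤ 1 + x ^ (d + 1) := by
  rcases le_total x 1 with h | h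
  · exact h.trans le_self_add
  · exact (le_self_pow₀ h (by simp)).trans le_add_self

lemma Q0_sub (d : ℕ) {τ0 : ℝ} (h : 1 ≤ τ0) : Q0 d ⊆ cyl (-τ0) 1 0 (R0 d) := by
  intro z hz
  have h1 := Q0_norm hz
  rw [mem_Q0] at hz
  have hs := Real.sqrt_nonneg d
  refine ⟨⟨by linarith [hz.1.1], hz.1.2.le⟩, ?_⟩
  rw [Metric.mem_closedBall, dist_zero_right, R0]; linarith

lemma min_mul_le {A : ℝ} (hA : 1 ≤ A) (x : ℝ) (n : ℕ) :
    min (ENNReal.ofReal x) n ≤ ENNReal.ofReal A * min (ENNReal.ofReal (A⁻¹ * x)) n := by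
  have hA0 : 0 < A := by linarith
  rcases le_total (ENNReal.ofReal (A⁻¹ * x)) n with h | h
  · rw [min_eq_left h, ← ENNReal.ofReal_mul hA0.le, mul_inv_cancel_left₀ hA0.ne']
    exact min_le_left _ _
  · rw [min_eq_right h]
    refine (min_le_right _ _).trans ?_
    have : (1 : ℝ≥0∞) ≤ ENNReal.ofReal A := by simpa using hA
    calc (n : ℝ≥0∞) = 1 * n := (one_mul _).symm
      _ ≤ _ := by gcongr

lemma exists_gamma {A κ : ℝ} (hA : 1 ≤ A) (hκ : 0 < κ) : ∃ γ : ℝ, 0 < γ ∧ γ ≤ 1 ∧ A ^ γ ≤ 1 + κ := by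
  have hc : Filter.Tendsto (fun γ : ℝ => A ^ γ) (nhdsWithin 0 (Ioi 0)) (nhds (A ^ (0 : ℝ))) := by
    have : ContinuousAt (fun γ : ℝ => A ^ γ) 0 := Real.continuousAt_const_rpow (by linarith)
    exact this.tendsto.mono_left nhdsWithin_le_nhds
  rw [Real.rpow_zero] at hc
  have h1 := hc.eventually (gt_mem_nhds (show (1 : ℝ) < 1 + κ by linarith))
  have h2 : ∀ᶠ γ : ℝ in nhdsWithin 0 (Ioi 0), γ ∈ Ioo 0 1 := Ioo_mem_nhdsGT one_pos
  obtain ⟨γ, h3, h4⟩ := (h1.and h2).exists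
  exact ⟨γ, h4.1, h4.2.le, h3.le⟩

lemma cls_trunc (d : ℕ) {δ K : ℝ} (hδ : 0 < δ) (hK : 0 ≤ K) :
    ∃ m1 γ N : ℝ, 1 ≤ m1 ∧ 0 < γ ∧ γ ≤ 1 ∧ 0 < N ∧ ∀ (u f g : ZZ d → ℝ) (τ0 : ℝ) (x0 : EE d),
      Cls d δ K (R0 d) m1 (X0 d) u f g τ0 x0 → ∀ n : ℕ,
      ∫⁻ z in Q0 d, (min (ENNReal.ofReal (f z)) n) ^ γ ≤ ENNReal.ofReal N := by
  obtain ⟨m1, κ', C, A, k0, hm1, hκ', hC, hA, H⟩ := cls_dec d hδ hK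
  set κ := min κ' (1 / 2) with hκd
  have hκ : 0 < κ := lt_min hκ' (by norm_num)
  have hκh : κ ≤ 1 / 2 := min_le_right _ _
  obtain ⟨γ, hγ0, hγ1, hγA⟩ := exists_gamma hA (half_pos hκ)
  refine ⟨m1, γ, 2 * (3 + C) / κ, hm1, hγ0, hγ1, by positivity, ?_⟩
  suffices hI : ∀ n : ℕ, (⨆ (u : ZZ d → ℝ) (f : ZZ d → ℝ) (g : ZZ d → ℝ) (τ0 : ℝ) (x0 : EE d)
      (_ : Cls d δ K (R0 d) m1 (X0 d) u f g τ0 x0), ∫⁻ z in Q0 d, (min (ENNReal.ofReal (f z)) n) ^ γ) ≤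
        ENNReal.ofReal (2 * (3 + C) / κ) by
    intro u f g τ0 x0 h n
    refine le_trans ?_ (hI n)
    exact le_iSup_of_le u (le_iSup_of_le f (le_iSup_of_le g (le_iSup_of_le τ0 (le_iSup_of_le x0 (le_iSup_of_le h le_rfl)))))
  intro n
  set I := (⨆ (u : ZZ d → ℝ) (f : ZZ d → ℝ) (g : ZZ d → ℝ) (τ0 : ℝ) (x0 : EE d)
      (_ : Cls d δ K (R0 d) m1 (X0 d) u f g τ0 x0), ∫⁻ z in Q0 d, (min (ENNReal.ofReal (f z)) n) ^ γ) with hIdef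
  have hIle : ∀ (u f g : ZZ d → ℝ) (τ0 : ℝ) (x0 : EE d),
      Cls d δ K (R0 d) m1 (X0 d) u f g τ0 x0 → ∫⁻ z in Q0 d, (min (ENNReal.ofReal (f z)) n) ^ γ ≤ I := by
    intro u f g τ0 x0 h
    exact le_iSup_of_le u (le_iSup_of_le f (le_iSup_of_le g (le_iSup_of_le τ0 (le_iSup_of_le x0 (le_iSup_of_le h le_rfl)))))
  have hIn : I ≤ (n : ℝ≥0∞) ^ γ := by
    refine iSup_le fun u => iSup_le fun f => iSup_le fun g => iSup_le fun τ0 => iSup_le fun x0 => iSup_le fun h => ?_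
    calc ∫⁻ z in Q0 d, (min (ENNReal.ofReal (f z)) n) ^ γ ≤ ∫⁻ z in Q0 d, (n : ℝ≥0∞) ^ γ := by
          refine lintegral_mono fun z => ?_
          gcongr
          exact min_le_right _ _
      _ = (n : ℝ≥0∞) ^ γ := by simp [vol_Q0]
  have hItop : I ≠ ⊤ := ne_top_of_le_ne_top (ENNReal.rpow_ne_top_of_nonneg hγ0.le (by simp)) hIn
  have hrec : I ≤ ENNReal.ofReal (3 + C) + ENNReal.ofReal (1 - κ / 2) * I := by
    refine iSup_le fun u => iSup_le fun f => iSup_le fun g => iSup_le fun τ0 => iSup_le fun x0 => iSup_le fun h => ?_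
    obtain ⟨G, hGc, hGQ, hGv, hGf, hGs⟩ := H u f g τ0 x0 h
    have hst := stop_int k0 hGc hGQ (fun z => (min (ENNReal.ofReal (f z)) n) ^ γ) (B := ENNReal.ofReal (1 + κ / 2) * I) ?_
    · refine hst.trans (add_le_add ?_ ?_)
      · have hG1 : volume G ≤ 1 := by rw [← vol_Q0 d]; exact measure_mono hGQ
        have hGD : G ⊆ cyl (-τ0) 1 0 (R0 d) := hGQ.trans (Q0_sub d h.t1)
        calc ∫⁻ z in G, (min (ENNReal.ofReal (f z)) n) ^ γ
            ≤ ∫⁻ z in G, (ENNReal.ofReal (2 + C) + ENNReal.ofReal (g z) ^ (d + 1)) := by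
              refine lintegral_mono_ae ?_
              refine (ae_restrict_iff' hGc.measurableSet).2 (Filter.Eventually.of_forall fun z hz => ?_)
              calc (min (ENNReal.ofReal (f z)) n) ^ γ ≤ (ENNReal.ofReal (f z)) ^ γ := by
                    gcongr; exact min_le_left _ _
                _ ≤ 1 + ENNReal.ofReal (f z) := rpow_le_one_add hγ0.le hγ1
                _ ≤ 1 + ENNReal.ofReal (g z + C) := by
                    have := hGf z hz
                    gcongr
                _ ≤ 1 + (ENNReal.ofReal (g z) + ENNReal.ofReal C) := by gcongr; exact ENNReal.ofReal_add_le
                _ ≤ 1 + ((1 + ENNReal.ofReal (g z) ^ (d + 1)) + ENNReal.ofReal C) := by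
                    gcongr; exact le_one_add_pow _ _
                _ = ENNReal.ofReal (2 + C) + ENNReal.ofReal (g z) ^ (d + 1) := by
                    rw [show (2 : ℝ) + C = 1 + 1 + C by ring, ENNReal.ofReal_add (by norm_num) (by linarith),
                      ENNReal.ofReal_add (by norm_num) (by norm_num), ENNReal.ofReal_one]
                    ring
          _ = ENNReal.ofReal (2 + C) * volume G + ∫⁻ z in G, ENNReal.ofReal (g z) ^ (d + 1) := by
              rw [lintegral_add_left measurable_const]; simp
          _ ≤ ENNReal.ofReal (2 + C) * 1 + 1 := by
              gcongr
              exact (lintegral_mono_set hGD).trans h.int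
          _ = ENNReal.ofReal (3 + C) := by
              rw [mul_one, ← ENNReal.ofReal_one, ← ENNReal.ofReal_add (by linarith) (by norm_num)]
              congr 1; ring
      · rw [← mul_assoc]
        gcongr
        have h1 : 1 - volume G ≤ ENNReal.ofReal (1 - κ) := by
          rw [ENNReal.ofReal_sub _ hκ.le, ENNReal.ofReal_one]
          gcongr
          exact (ENNReal.ofReal_le_ofReal (min_le_left _ _)).trans hGv
        refine (mul_le_mul_left h1 _).trans ?_
        rw [← ENNReal.ofReal_mul (by linarith)]
        apply ENNReal.ofReal_le_ofReal
        nlinarith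
    · intro a ha
      obtain ⟨u', g', τ', x', hcl⟩ := hGs a ha
      have h2 := hIle _ _ _ _ _ hcl
      calc ∫⁻ z in Q0 d, (min (ENNReal.ofReal (f (sc (tbq a.1 a.2) (rk a.1 ^ 2) (xbq a.1 a.2) (rk a.1) z))) n) ^ γ
          ≤ ∫⁻ z in Q0 d, ENNReal.ofReal (A ^ γ) *
              (min (ENNReal.ofReal (A⁻¹ * f (sc (tbq a.1 a.2) (rk a.1 ^ 2) (xbq a.1 a.2) (rk a.1) z))) n) ^ γ := by
            refine lintegral_mono fun z => ?_
            rw [← ENNReal.ofReal_rpow_of_nonneg (by linarith) hγ0.le, ← ENNReal.mul_rpow_of_nonneg _ _ hγ0.le]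
            gcongr
            exact min_mul_le hA _ _
        _ = ENNReal.ofReal (A ^ γ) * ∫⁻ z in Q0 d, 
              (min (ENNReal.ofReal (A⁻¹ * f (sc (tbq a.1 a.2) (rk a.1 ^ 2) (xbq a.1 a.2) (rk a.1) z))) n) ^ γ :=
            lintegral_const_mul' _ _ ENNReal.ofReal_ne_top
        _ ≤ ENNReal.ofReal (1 + κ / 2) * I := by gcongr
  have hreal : I.toReal ≤ (3 + C) + (1 - κ / 2) * I.toReal := by
    have h1 := ENNReal.toReal_mono (ENNReal.add_ne_top.2 ⟨ENNReal.ofReal_ne_top, ENNReal.mul_ne_top ENNReal.ofReal_ne_top hItop⟩) hrec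
    rwa [ENNReal.toReal_add ENNReal.ofReal_ne_top (ENNReal.mul_ne_top ENNReal.ofReal_ne_top hItop), ENNReal.toReal_mul,
      ENNReal.toReal_ofReal (by linarith), ENNReal.toReal_ofReal (by linarith)] at h1
  rw [← ENNReal.ofReal_toReal hItop]
  apply ENNReal.ofReal_le_ofReal
  rw [le_div_iff₀ hκ]
  linarith

/-- interior estimate on the unit cube -/
lemma cls_bound (d : ℕ) {δ K : ℝ} (hδ : 0 < δ) (hK : 0 ≤ K) :
    ∃ m1 γ N : ℝ, 1 ≤ m1 ∧ 0 < γ ∧ γ ≤ 1 ∧ 0 < N ∧ ∀ (u f g : ZZ d → ℝ) (τ0 : ℝ) (x0 : EE d),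
      Measurable f → Cls d δ K (R0 d) m1 (X0 d) u f g τ0 x0 →
      ∫⁻ z in Q0 d, ENNReal.ofReal (f z) ^ γ ≤ ENNReal.ofReal N := by
  obtain ⟨m1, γ, N, hm1, hγ0, hγ1, hN, H⟩ := cls_trunc d hδ hK
  refine ⟨m1, γ, N, hm1, hγ0, hγ1, hN, fun u f g τ0 x0 hf hc => ?_⟩
  have h1 : ∀ z, ENNReal.ofReal (f z) ^ γ = ⨆ n : ℕ, (min (ENNReal.ofReal (f z)) n) ^ γ := by
    intro z
    apply le_antisymm
    · obtain ⟨n, hn⟩ := exists_nat_ge (f z)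
      refine le_iSup_of_le n ?_
      rw [min_eq_left]
      rw [← ENNReal.ofReal_natCast]
      exact ENNReal.ofReal_le_ofReal hn
    · refine iSup_le fun n => ?_
      gcongr
      exact min_le_left _ _
  simp_rw [h1]
  rw [lintegral_iSup]
  · exact iSup_le fun n => H u f g τ0 x0 hc n
  · intro n; fun_prop
  · intro n n' hnn z
    simp only
    gcongr

/-- normalised smooth problem on the standard cylinder -/
structure Cls2 (d : ℕ) (δ K : ℝ) (u f g : ZZ d → ℝ) : Prop where
  hu : C2on u (cyl 0 2 0 1)
  u0 : ∀ z ∈ cyl 0 2 0 1, 0 ≤ u z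
  f0 : ∀ z ∈ cyl 0 2 0 1, 0 ≤ f z
  g0 : ∀ z ∈ cyl 0 2 0 1, 0 ≤ g z
  sup : ∀ z ∈ cyl 0 2 0 1, Super δ K u z (g z - f z)
  int : ∫⁻ z in cyl 0 2 0 1, ENNReal.ofReal (g z) ^ (d + 1) ≤ 1
  vx : u (0, 0) ≤ 1

def rad (d : ℕ) (k : ℕ) : ℝ := 1 - (Real.sqrt d + R0 d) * rk k

def EK (d : ℕ) (k : ℕ) : Set (ZZ d) := Ioo 1 2 ×ˢ Metric.ball 0 (rad d k)

lemma cube_time {d : ℕ} {k : ℕ} {z : ZZ d} (h1 : 1 ≤ z.1) (h2 : z.1 < 2) :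
    1 ≤ tbq k (dy k z) ∧ tbq k (dy k z) + rk k ^ 2 ≤ 2 := by
  have p4 : (0 : ℝ) < 4 ^ k := by positivity
  have ht : (4 : ℝ) ^ k * tbq k (dy k z) = (dy k z).1 := by rw [tbq]; field_simp
  constructor
  · refine le_of_mul_le_mul_left ?_ p4
    rw [ht]
    have : (4 : ℤ) ^ k ≤ (dy k z).1 := by
      apply Int.le_floor.2
      push_cast
      nlinarith
    have : ((4 ^ k : ℤ) : ℝ) ≤ (dy k z).1 := by exact_mod_cast this
    push_cast at this
    linarith
  · refine le_of_mul_le_mul_left ?_ p4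
    rw [mul_add, ht, rk_inv2]
    have : (dy k z).1 < (4 : ℤ) ^ k * 2 := by
      apply Int.floor_lt.2
      push_cast
      nlinarith
    have : (dy k z).1 + 1 ≤ (4 : ℤ) ^ k * 2 := by omega
    have : (((dy k z).1 + 1 : ℤ) : ℝ) ≤ ((4 ^ k * 2 : ℤ) : ℝ) := by exact_mod_cast this
    push_cast at this
    linarith

lemma cls2_inner (d : ℕ) {δ K : ℝ} (hδ : 0 < δ) (hK : 0 ≤ K) :
    ∃ (γ N : ℝ) (q : ℕ), 0 < γ ∧ γ ≤ 1 ∧ 0 < N ∧ ∀ (u f g : ZZ d → ℝ), Measurable f → Cls2 d δ K u f g → ∀ k, 1 ≤ k →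
      ∫⁻ z in EK d k, ENNReal.ofReal (f z) ^ γ ≤ ENNReal.ofReal (N * 2 ^ (k * q)) := by
  obtain ⟨m1, γ, N, hm1, hγ0, hγ1, hN, H⟩ := cls_bound d hδ hK
  obtain ⟨C, n, hC, HS⟩ := spread_bdry d hδ hK
  have hvR := vR_nonneg d 1
  refine ⟨γ, (1 + 2 * vR d 1) * (3 * C * 2 ^ d) * N, n + d + 2, hγ0, hγ1, by positivity, ?_⟩
  intro u f g hf hc k hk
  have hs := Real.sqrt_nonneg d
  have hR := R0_pos d
  set r := rk k with hr
  have hrp : 0 < r := rk_pos k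
  have hr1 : r ≤ 1 := rk_le k
  have hrh : r ≤ 1 / 2 := by
    have : rk k ≤ rk 1 := pow_le_pow_of_le_one (by norm_num) (by norm_num) (by omega)
    have h1 : rk 1 = 1 / 2 := by simp [rk]
    rw [hr]; linarith
  have hr2 : 0 < r ^ 2 := by positivity
  have hr2h : r ^ 2 ≤ 1 / 4 := by nlinarith
  set B := r⁻¹ with hB
  have hB1 : 1 ≤ B := one_le_inv_iff₀.2 ⟨hrp, hr1⟩
  have hBr : B * r = 1 := by rw [hB]; field_simp
  set A := 3 * C * 2 ^ d * B ^ (n + d + 2) with hA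
  have hp1 : 1 ≤ B ^ (n + d + 2) := one_le_pow₀ hB1
  have h2d : (1 : ℝ) ≤ 2 ^ d := one_le_pow₀ (by norm_num)
  have h3C : 1 ≤ 3 * C := by linarith
  have h3C2 : 1 ≤ 3 * C * 2 ^ d := one_le_mul_of_one_le_of_one_le h3C h2d
  have hA1 : 1 ≤ A := one_le_mul_of_one_le_of_one_le h3C2 hp1
  set IS : Set (ℤ × (Fin d → ℤ)) := dy k '' EK d k with hIS
  have hISc : IS.Countable := Set.to_countable _
  have hprop : ∀ a ∈ IS, 1 ≤ tbq k a ∧ tbq k a + r ^ 2 ≤ 2 ∧ ‖xbq k a‖ + R0 d * r ≤ 1 := by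
    rintro a ⟨z, hz, rfl⟩
    obtain ⟨h1, h2⟩ := cube_time (k := k) hz.1.1.le hz.1.2
    refine ⟨h1, h2, ?_⟩
    have h3 := cube_dist (show dy k ((tbq k (dy k z), xbq k (dy k z)) : ZZ d) = dy k z from cube_base k (dy k z))
    have h4 : ‖z.2‖ < rad d k := by simpa using hz.2
    have h5 := norm_le_norm_add_norm_sub' (xbq k (dy k z)) z.2
    have h6 := h3.2
    simp only at h6
    unfold rad at h4
    nlinarith
  have hcube : ∀ a ∈ IS, ∫⁻ z in Q0 d, ENNReal.ofReal (f (sc (tbq k a) (rk k ^ 2) (xbq k a) (rk k) z)) ^ γ ≤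
      ENNReal.ofReal (A * N) := by
    intro a ha
    obtain ⟨h1, h2, h3⟩ := hprop a ha
    have hsub1 : cyl (d := d) 0 (tbq k a - r ^ 2) 0 1 ⊆ cyl 0 2 0 1 := cyl_mono le_rfl (by linarith) (by simp)
    have hR8 : 8 ≤ R0 d := by unfold R0; linarith
    obtain ⟨x1, hx1, hx1c, hux1⟩ := HS u g (tbq k a - r ^ 2) r (xbq k a) 1 1 (fun z hz => hc.hu z (hsub1 hz))
      (by linarith) (by linarith) hrp hrh (by nlinarith)
      (fun z hz => hc.u0 z (hsub1 hz)) (fun z hz => hc.g0 z (hsub1 hz))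
      (fun z hz => (hc.sup z (hsub1 hz)).mono (by have := hc.f0 z (hsub1 hz); linarith)) zero_le_one
      ((lintegral_mono_set hsub1).trans (hc.int.trans (by simp))) hc.vx zero_le_one
    have hsub : cyl (tbq k a - r ^ 2) (tbq k a + r ^ 2) (xbq k a) (R0 d * r) ⊆ cyl 0 2 0 1 :=
      cyl_mono (by linarith) h2 (by rw [sub_zero]; exact h3)
    have hst := cls_step (δ := δ) (K := K) (R := R0 d) (m1 := m1) (X0 := X0 d) (C1 := 0) (Λ := B ^ (d + 2)) (A := A)
      (u := u) (f := f) (g := g) (l := fun _ => 0)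
      (tb := tbq k a) (t1 := tbq k a - r ^ 2) (xb := xbq k a) (x1 := x1)
      le_rfl (by positivity) (by linarith : 0 < A) ?_ hrp hr1 (by linarith) (by nlinarith)
      (by unfold X0; nlinarith) (fun z hz => hc.hu z (hsub hz)) (fun z => contDiffAt_const)
      (fun z hz => hc.u0 z (hsub hz)) (fun z hz => hc.f0 z (hsub hz)) (fun z hz => hc.g0 z (hsub hz))
      (fun z hz => hc.sup z (hsub hz)) ?_ ?_ ?_
    · have h4 := H _ _ _ _ _ ?_ hst
      · calc ∫⁻ z in Q0 d, ENNReal.ofReal (f (sc (tbq k a) (rk k ^ 2) (xbq k a) (rk k) z)) ^ γ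
            ≤ ∫⁻ z in Q0 d, ENNReal.ofReal A * ENNReal.ofReal (A⁻¹ * f (sc (tbq k a) (r ^ 2) (xbq k a) r z)) ^ γ := by
              refine lintegral_mono fun z => ?_
              have e : f (sc (tbq k a) (r ^ 2) (xbq k a) r z) = A * (A⁻¹ * f (sc (tbq k a) (r ^ 2) (xbq k a) r z)) := by
                rw [mul_inv_cancel_left₀ (by linarith)]
              rw [← hr, e, ENNReal.ofReal_mul (by linarith), ENNReal.mul_rpow_of_nonneg _ _ hγ0.le, ← e]
              gcongr
              have : (1 : ℝ≥0∞) ≤ ENNReal.ofReal A := by simpa using hA1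
              calc ENNReal.ofReal A ^ γ ≤ ENNReal.ofReal A ^ (1 : ℝ) := ENNReal.rpow_le_rpow_of_exponent_le this hγ1
                _ = _ := ENNReal.rpow_one _
          _ = ENNReal.ofReal A * ∫⁻ z in Q0 d, ENNReal.ofReal (A⁻¹ * f (sc (tbq k a) (r ^ 2) (xbq k a) r z)) ^ γ :=
              lintegral_const_mul' _ _ ENNReal.ofReal_ne_top
          _ ≤ ENNReal.ofReal A * ENNReal.ofReal N := by gcongr
          _ = ENNReal.ofReal (A * N) := (ENNReal.ofReal_mul (by linarith)).symm
      · have : Measurable (sc (tbq k a) (r ^ 2) (xbq k a) r) := by unfold sc; fun_prop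
        exact (hf.comp this).const_mul _
    · refine le_trans ?_ (le_self_pow₀ hA1 (by simp : d + 1 ≠ 0))
      rw [zero_pow (by simp), zero_mul, add_zero, hA]
      have h5 : B ^ (d + 2) ≤ B ^ (n + d + 2) := pow_le_pow_right₀ hB1 (by omega)
      have h6 : 2 ^ d ≤ 3 * C * 2 ^ d := by nlinarith
      gcongr
    · intro z hz a b c _
      have : Lop a b c (fun _ => (0 : ℝ)) z = 0 := by
        have := Lop_lin (u := fun _ => (0 : ℝ)) (v := fun _ => (0 : ℝ)) (z := z) contDiffAt_const contDiffAt_const 0 0 a b c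
        simpa using this
      rw [this]; simp
    · refine (lintegral_mono_set hsub).trans (hc.int.trans ?_)
      rw [← mul_pow, hBr, one_pow, ENNReal.ofReal_one]
    · simp only [sub_zero]
      refine hux1.trans ?_
      have e : A * r ^ 2 = 3 * C * 2 ^ d * B ^ (n + d) := by
        rw [hA, show n + d + 2 = (n + d) + 2 by ring, pow_add B (n + d) 2]
        have : B ^ 2 * r ^ 2 = 1 := by rw [← mul_pow, hBr, one_pow]
        linear_combination (3 * C * 2 ^ d * B ^ (n + d)) * this
      rw [e]
      have h5 : B ^ n ≤ B ^ (n + d) := pow_le_pow_right₀ hB1 (by omega)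
      have h6 : C * (1 + 1 + 1) ≤ 3 * C * 2 ^ d := by nlinarith
      gcongr
  have hdisj : IS.PairwiseDisjoint fun a => cube (d := d) k a := by
    intro a ha b hb hab
    rw [Function.onFun, Set.disjoint_left]
    intro z hza hzb
    exact hab ((show dy k z = a from hza).symm.trans hzb)
  have hunion : (⋃ a ∈ IS, cube k a) ⊆ cyl (d := d) 0 2 0 1 := by
    refine iUnion₂_subset fun a ha z hz => ?_
    obtain ⟨h1, h2, h3⟩ := hprop a ha
    obtain ⟨g1, g2, -⟩ := cube_pt hz
    have h4 := cube_dist (show dy k z = dy k ((tbq k a, xbq k a) : ZZ d) from (show dy k z = a from hz).trans (cube_base k a).symm)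
    refine ⟨⟨by linarith, by linarith⟩, ?_⟩
    have h5 := norm_le_norm_add_norm_sub' z.2 (xbq k a)
    have h6 := h4.2
    simp only at h6
    rw [Metric.mem_closedBall, dist_zero_right]
    have hR8 : Real.sqrt d ≤ R0 d := by unfold R0; linarith
    have : Real.sqrt d * rk k ≤ R0 d * r := by rw [hr]; gcongr
    linarith
  have h2k : B = 2 ^ k := by
    rw [hB, hr]; unfold rk; simp
  calc ∫⁻ z in EK d k, ENNReal.ofReal (f z) ^ γ
      ≤ ∫⁻ z in ⋃ a ∈ IS, cube k a, ENNReal.ofReal (f z) ^ γ := by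
        refine lintegral_mono_set fun z hz => ?_
        exact mem_biUnion (x := dy k z) ⟨z, hz, rfl⟩ (show dy k z = dy k z from rfl)
    _ = ∑' a : IS, ∫⁻ z in cube k (a : ℤ × (Fin d → ℤ)), ENNReal.ofReal (f z) ^ γ :=
        lintegral_biUnion hISc (fun a _ => cube_measurable _ _) hdisj _
    _ ≤ ∑' a : IS, volume (cube k (a : ℤ × (Fin d → ℤ))) * ENNReal.ofReal (A * N) := by
        refine ENNReal.tsum_le_tsum fun a => ?_
        rw [cube_int]
        gcongr
        exact hcube a a.2
    _ = volume (⋃ a ∈ IS, cube k a) * ENNReal.ofReal (A * N) := by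
        rw [ENNReal.tsum_mul_right, ← measure_biUnion hISc hdisj (fun a _ => cube_measurable _ _)]
    _ ≤ ENNReal.ofReal (1 + 2 * vR d 1) * ENNReal.ofReal (A * N) := by
        gcongr
        refine (measure_mono hunion).trans ?_
        rw [vol_cyl, vR_eq, ← ENNReal.ofReal_mul (by norm_num)]
        apply ENNReal.ofReal_le_ofReal
        linarith
    _ = _ := by
        rw [← ENNReal.ofReal_mul (by positivity)]
        congr 1
        rw [hA, h2k, ← pow_mul]
        ring

lemma young_rpow (x : ℝ≥0∞) {θ t : ℝ} (hθ : 0 < θ) (hθ1 : θ ≤ 1) (ht : 0 < t) :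
    x ^ θ ≤ ENNReal.ofReal (t ^ θ) + ENNReal.ofReal (t ^ θ / t) * x := by
  have htp : 0 < t ^ θ := Real.rpow_pos_of_pos ht _
  rcases le_total x (ENNReal.ofReal t) with h | h
  · refine le_trans ?_ le_self_add
    rw [← ENNReal.ofReal_rpow_of_pos ht]
    gcongr
  · refine le_trans ?_ le_add_self
    by_cases hx : x = ⊤
    · rw [hx, ENNReal.mul_top]
      · exact le_top
      · simp only [ne_eq, ENNReal.ofReal_eq_zero, not_le]; positivity
    · obtain ⟨y, hy, rfl⟩ : ∃ y : ℝ, 0 ≤ y ∧ x = ENNReal.ofReal y := ⟨x.toReal, ENNReal.toReal_nonneg, (ENNReal.ofReal_toReal hx).symm⟩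
      rw [ENNReal.ofReal_le_ofReal_iff hy] at h
      rw [ENNReal.ofReal_rpow_of_pos (by linarith), ← ENNReal.ofReal_mul (by positivity)]
      apply ENNReal.ofReal_le_ofReal
      have h1 : 1 ≤ y / t := by rwa [one_le_div ht]
      have h2 : (y / t) ^ θ ≤ (y / t) ^ (1 : ℝ) := Real.rpow_le_rpow_of_exponent_le h1 hθ1
      rw [Real.rpow_one, Real.div_rpow hy ht.le, div_le_iff₀ htp] at h2
      calc y ^ θ ≤ y / t * t ^ θ := h2
        _ = t ^ θ / t * y := by ring

lemma layer_vol (d : ℕ) {ρ : ℝ} (hρ : 0 ≤ ρ) :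
    volume ((Ioo 1 2 : Set ℝ) ×ˢ (Metric.ball (0 : EE d) 1 \ Metric.ball 0 (1 - ρ))) ≤ ENNReal.ofReal (vb d * (d + 1) * ρ) := by
  have hv := vb_pos d
  rw [Measure.volume_eq_prod, Measure.prod_prod, Real.volume_Ioo]
  norm_num
  rcases le_or_gt 1 ρ with h | h
  · refine (measure_mono sdiff_subset).trans ?_
    rw [vb_eq]
    apply ENNReal.ofReal_le_ofReal
    have : 1 ≤ (d + 1) * ρ := by nlinarith [(Nat.cast_nonneg d : (0 : ℝ) ≤ d)]
    nlinarith
  · have h1r : 0 < 1 - ρ := by linarith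
    have h2r : 0 ≤ (1 - ρ) ^ Module.finrank ℝ (EE d) := by positivity
    rw [measure_sdiff (Metric.ball_subset_ball (by linarith)) measurableSet_ball.nullMeasurableSet measure_ball_lt_top.ne,
      Measure.addHaar_ball_of_pos _ _ h1r, vb_eq, ← ENNReal.ofReal_mul h2r,
      ← ENNReal.ofReal_sub _ (mul_nonneg h2r hv.le)]
    apply ENNReal.ofReal_le_ofReal
    have h1 := one_add_mul_le_pow (show (-2 : ℝ) ≤ -ρ by linarith) d
    have e : Module.finrank ℝ (EE d) = d := by simp [EE]
    rw [e]
    have h2 : 1 + d * -ρ ≤ (1 - ρ) ^ d := by rw [sub_eq_add_neg]; exact h1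
    nlinarith [mul_le_mul_of_nonneg_left h2 hv.le, mul_nonneg hv.le hρ]

lemma cls2_bound (d : ℕ) {δ K : ℝ} (hδ : 0 < δ) (hK : 0 ≤ K) :
    ∃ (γ N : ℝ), 0 < γ ∧ γ ≤ 1 ∧ 0 < N ∧ ∀ (u f g : ZZ d → ℝ), Measurable f → Cls2 d δ K u f g →
      ∫⁻ z in Ioo 1 2 ×ˢ Metric.ball 0 1, ENNReal.ofReal (f z) ^ γ ≤ ENNReal.ofReal N := by
  obtain ⟨γ, N, q, hγ0, hγ1, hN, H⟩ := cls2_inner d hδ hK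
  have hs := Real.sqrt_nonneg d
  have hR := R0_pos d
  have hv := vb_pos d
  set θ : ℝ := 1 / (2 * (q + 1)) with hθ
  have hθ0 : 0 < θ := by positivity
  have hθ1 : θ ≤ 1 := by
    rw [hθ, div_le_one (by positivity)]
    have : (0 : ℝ) ≤ q := Nat.cast_nonneg q
    linarith
  set w : ℝ := (2 : ℝ) ^ (1 / 2 : ℝ) with hw
  have hw0 : 0 < w := by positivity
  have hw2 : w / 2 < 1 := by
    rw [div_lt_one (by norm_num)]
    calc w < (2 : ℝ) ^ (1 : ℝ) := Real.rpow_lt_rpow_of_exponent_lt (by norm_num) (by norm_num)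
      _ = 2 := Real.rpow_one 2
  set Cc := vb d * (d + 1) * (Real.sqrt d + R0 d) + N * 2 ^ q with hCc
  have hCc0 : 0 < Cc := by positivity
  refine ⟨γ * θ, Cc * (1 - w / 2)⁻¹, by positivity, by nlinarith, by
    have : 0 < 1 - w / 2 := by linarith
    positivity, ?_⟩
  intro u f g hf hc
  set S : ℕ → Set (ZZ d) := fun k => EK d (k + 1) \ EK d k with hS
  have hcov : (Ioo 1 2 ×ˢ Metric.ball 0 1 : Set (ZZ d)) ⊆ ⋃ k, S k := by
    intro z hz
    have hex : ∃ k, z ∈ EK d k := by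
      have hten : Filter.Tendsto (fun k : ℕ => rad d k) Filter.atTop (nhds 1) := by
        have := ((tendsto_pow_atTop_nhds_zero_of_lt_one (by norm_num : (0 : ℝ) ≤ 1 / 2) (by norm_num)).const_mul (Real.sqrt d + R0 d)).const_sub 1
        simpa [rk, rad] using this
      have hz2 : ‖z.2‖ < 1 := by simpa using hz.2
      obtain ⟨k, hk⟩ := (hten.eventually (lt_mem_nhds hz2)).exists
      exact ⟨k, hz.1, by simpa using hk⟩
    classical
    set k := Nat.find hex with hk
    have hks := Nat.find_spec hex
    have hk0 : k ≠ 0 := by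
      intro h0
      rw [← hk, h0] at hks
      have h1 : ‖z.2‖ < rad d 0 := by simpa using hks.2
      have h2 : rad d 0 ≤ 0 := by
        unfold rad rk R0; rw [pow_zero]; linarith
      linarith [norm_nonneg z.2]
    obtain ⟨j, hj⟩ := Nat.exists_eq_succ_of_ne_zero hk0
    refine mem_iUnion.2 ⟨j, ?_, ?_⟩
    · rw [← Nat.succ_eq_add_one, ← hj]; exact hks
    · exact Nat.find_min hex (by omega)
  have hlayer : ∀ k, ∫⁻ z in S k, ENNReal.ofReal (f z) ^ (γ * θ) ≤ ENNReal.ofReal (Cc * (w / 2) ^ k) := by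
    intro k
    set t : ℝ := 2 ^ (k * (q + 1)) with ht
    have ht0 : 0 < t := by positivity
    have htθ : t ^ θ = w ^ k := by
      rw [ht, hw, ← Real.rpow_natCast, ← Real.rpow_natCast, ← Real.rpow_mul (by norm_num), ← Real.rpow_mul (by norm_num)]
      congr 1
      rw [hθ]; push_cast; field_simp
    have hvol : volume (S k) ≤ ENNReal.ofReal (vb d * (d + 1) * ((Real.sqrt d + R0 d) * rk k)) := by
      refine (measure_mono ?_).trans (layer_vol d (by have := rk_pos k; positivity))
      rintro z ⟨h1, h2⟩
      refine ⟨h1.1, Metric.ball_subset_ball ?_ h1.2, fun h3 => h2 ⟨h1.1, h3⟩⟩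
      have := rk_pos (k + 1)
      unfold rad
      have : 0 ≤ (Real.sqrt d + R0 d) * rk (k + 1) := by positivity
      linarith
    calc ∫⁻ z in S k, ENNReal.ofReal (f z) ^ (γ * θ)
        ≤ ∫⁻ z in S k, (ENNReal.ofReal (t ^ θ) + ENNReal.ofReal (t ^ θ / t) * ENNReal.ofReal (f z) ^ γ) := by
          refine lintegral_mono fun z => ?_
          rw [ENNReal.rpow_mul]
          exact young_rpow _ hθ0 hθ1 ht0
      _ = ENNReal.ofReal (t ^ θ) * volume (S k) + ENNReal.ofReal (t ^ θ / t) * ∫⁻ z in S k, ENNReal.ofReal (f z) ^ γ := by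
          rw [lintegral_add_left measurable_const, lintegral_const_mul' _ _ ENNReal.ofReal_ne_top]; simp
      _ ≤ ENNReal.ofReal (t ^ θ) * ENNReal.ofReal (vb d * (d + 1) * ((Real.sqrt d + R0 d) * rk k)) +
          ENNReal.ofReal (t ^ θ / t) * ENNReal.ofReal (N * 2 ^ ((k + 1) * q)) := by
          gcongr
          exact (lintegral_mono_set sdiff_subset).trans (H u f g hf hc (k + 1) (by omega))
      _ = ENNReal.ofReal (Cc * (w / 2) ^ k) := by
          have hrk := rk_pos k
          rw [← ENNReal.ofReal_mul (by positivity), ← ENNReal.ofReal_mul (by positivity),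
            ← ENNReal.ofReal_add (by positivity) (by positivity)]
          congr 1
          rw [htθ, ht, hCc]
          have e1 : (w / 2) ^ k = w ^ k * rk k := by unfold rk; rw [← mul_pow]; congr 1; ring
          have e2 : (2 : ℝ) ^ ((k + 1) * q) / 2 ^ (k * (q + 1)) = 2 ^ q * rk k := by
            rw [show (k + 1) * q = k * q + q by ring, show k * (q + 1) = k * q + k by ring, pow_add, pow_add]
            unfold rk
            rw [one_div, inv_pow]
            field_simp
          rw [e1]
          calc _ = w ^ k * (vb d * (d + 1) * ((Real.sqrt d + R0 d) * rk k)) + w ^ k * N * ((2 : ℝ) ^ ((k + 1) * q) / 2 ^ (k * (q + 1))) := by ring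
            _ = _ := by rw [e2]; ring
  calc ∫⁻ z in Ioo 1 2 ×ˢ Metric.ball 0 1, ENNReal.ofReal (f z) ^ (γ * θ)
      ≤ ∫⁻ z in ⋃ k, S k, ENNReal.ofReal (f z) ^ (γ * θ) := lintegral_mono_set hcov
    _ ≤ ∑' k, ∫⁻ z in S k, ENNReal.ofReal (f z) ^ (γ * θ) := lintegral_iUnion_le _ _
    _ ≤ ∑' k, ENNReal.ofReal (Cc * (w / 2) ^ k) := ENNReal.tsum_le_tsum hlayer
    _ = ENNReal.ofReal (∑' k, Cc * (w / 2) ^ k) := by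
        rw [ENNReal.ofReal_tsum_of_nonneg (fun k => by positivity)]
        exact (summable_geometric_of_lt_one (by positivity) hw2).mul_left _
    _ = _ := by rw [tsum_mul_left, tsum_geometric_of_lt_one (by positivity) hw2]

lemma Lop_const {d : ℕ} (a : Matrix (Fin d) (Fin d) ℝ) (b : EE d) (c : ℝ) (z : ZZ d) :
    Lop a b c (fun _ => (1 : ℝ)) z = -c := by
  unfold Lop dt dx dxx
  have : fderiv ℝ (fun _ : ZZ d => (1 : ℝ)) = fun _ => 0 := by
    funext z; simp
  rw [this]
  simp

/-- estimate for smooth functions without sign assumption -/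
lemma smooth_est (d : ℕ) {δ K : ℝ} (hδ : 0 < δ) (hK : 0 ≤ K) :
    ∃ (γ N : ℝ), 0 < γ ∧ γ ≤ 1 ∧ 0 < N ∧ ∀ (u f g : ZZ d → ℝ) (M : ℝ), Measurable f →
      C2on u (cyl 0 2 0 1) → (∀ z ∈ cyl 0 2 0 1, 0 ≤ f z) → (∀ z ∈ cyl 0 2 0 1, 0 ≤ g z) →
      (∀ z ∈ cyl 0 2 0 1, Super δ K u z (g z - f z)) →
      0 < M →
      ∫⁻ z in cyl 0 2 0 1, ENNReal.ofReal (g z) ^ (d + 1) ≤ ENNReal.ofReal (M ^ (d + 1)) →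
      (∀ t ∈ Icc (0 : ℝ) 2, ∀ x, dist x 0 = 1 → -M ≤ u (t, x)) →
      (∀ x ∈ Metric.closedBall 0 1, -M ≤ u (2, x)) →
      u (0, 0) ≤ M →
      ∫⁻ z in Ioo 1 2 ×ˢ Metric.ball 0 1, ENNReal.ofReal (f z) ^ γ ≤ ENNReal.ofReal (N * M ^ γ) := by
  obtain ⟨γ, N, hγ0, hγ1, hN, H⟩ := cls2_bound d hδ hK
  obtain ⟨N0, hN0, HM⟩ := maxp (d := d) (τ := 2) hδ hK zero_lt_one zero_le_two
  refine ⟨γ, N * (N0 + 2) ^ γ, hγ0, hγ1, by positivity, ?_⟩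
  intro u f g M hf hu hf0 hg0 hsup hM hgint hlat htop hvx
  have hc1 : ∀ z : ZZ d, ContDiffAt ℝ 2 (fun _ : ZZ d => (1 : ℝ)) z := fun z => contDiffAt_const
  have hlow : ∀ z ∈ cyl (d := d) 0 2 0 1, -(M + N0 * M) ≤ u z := by
    rintro ⟨t0, x0⟩ hz
    have ht0 : t0 ∈ Icc (0 : ℝ) 2 := hz.1
    have hsub : cyl (d := d) t0 2 0 1 ⊆ cyl 0 2 0 1 := prod_mono (Icc_subset_Icc_left ht0.1) subset_rfl
    have := HM (fun z => (-1) * u z + (-M) * 1) g t0 2 0 x0 M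
      (fun z hz => C2_lin (hu z (hsub hz)) (hc1 z) _ _) ht0.2 (by linarith [ht0.1]) hz.2
      (fun t ht x hx => by
        have := hlat t ⟨ht0.1.trans ht.1, ht.2⟩ x hx
        linarith)
      (fun x hx => by
        have := htop x hx
        linarith)
      (fun z hz => hg0 z (hsub hz))
      (fun z hz _ => by
        obtain ⟨a, b, c, hA, hL⟩ := hsup z (hsub hz)
        refine ⟨a, b, c, hA, ?_⟩
        rw [Lop_lin (hu z (hsub hz)) (hc1 z), Lop_const]
        have := hf0 z (hsub hz)
        have := mul_nonneg hM.le hA.c0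
        linarith)
      hM.le ((lintegral_mono_set hsub).trans hgint)

    linarith
  set P := (N0 + 2) * M with hP
  have hP0 : 0 < P := by positivity
  have key := H (fun z => P⁻¹ * u z + (P⁻¹ * (M + N0 * M)) * 1) (fun z => P⁻¹ * f z) (fun z => P⁻¹ * g z)
    (hf.const_mul _) ?_
  · have e : ∀ z, ENNReal.ofReal (f z) ^ γ = ENNReal.ofReal (P ^ γ) * ENNReal.ofReal (P⁻¹ * f z) ^ γ := by
      intro z
      rw [← ENNReal.ofReal_rpow_of_pos hP0, ← ENNReal.mul_rpow_of_nonneg _ _ hγ0.le, ← ENNReal.ofReal_mul hP0.le,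
        mul_inv_cancel_left₀ hP0.ne']
    simp_rw [e]
    rw [lintegral_const_mul' _ _ ENNReal.ofReal_ne_top]
    refine (mul_le_mul_right key _).trans ?_
    rw [← ENNReal.ofReal_mul (by positivity), hP, Real.mul_rpow (by positivity) hM.le]
    apply le_of_eq
    congr 1; ring
  · have hPi : 0 < P⁻¹ := inv_pos.2 hP0
    refine ⟨fun z hz => C2_lin (hu z hz) (hc1 z) _ _, ?_, ?_, ?_, ?_, ?_, ?_⟩
    · intro z hz
      have := mul_le_mul_of_nonneg_left (hlow z hz) hPi.le
      linarith
    · intro z hz; exact mul_nonneg hPi.le (hf0 z hz)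
    · intro z hz; exact mul_nonneg hPi.le (hg0 z hz)
    · intro z hz
      obtain ⟨a, b, c, hA, hL⟩ := hsup z hz
      refine ⟨a, b, c, hA, ?_⟩
      rw [Lop_lin (hu z hz) (hc1 z), Lop_const]
      have h1 := mul_le_mul_of_nonneg_left hL hPi.le
      have h2 : 0 ≤ P⁻¹ * (M + N0 * M) * c := by have := hA.c0; positivity
      linarith
    · simp_rw [ENNReal.ofReal_mul hPi.le, mul_pow]
      rw [lintegral_const_mul' _ _ (by finiteness)]
      refine (mul_le_mul_right hgint _).trans ?_
      rw [← ENNReal.ofReal_pow hPi.le, ← ENNReal.ofReal_mul (by positivity), ← mul_pow]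
      apply ENNReal.ofReal_le_one.2
      apply pow_le_one₀ (by positivity)
      rw [inv_mul_le_iff₀ hP0, hP]
      nlinarith
    · have : P⁻¹ * u (0, 0) + P⁻¹ * (M + N0 * M) * 1 = P⁻¹ * (u (0, 0) + M + N0 * M) := by ring
      rw [this, inv_mul_le_iff₀ hP0, hP]
      linarith

/-- mollification -/
def moll {d : ℕ} (φ : ContDiffBump (0 : ZZ d)) (h : ZZ d → ℝ) : ZZ d → ℝ :=
  convolution (φ.normed volume) h (ContinuousLinearMap.lsmul ℝ ℝ) volume

lemma moll_apply {d : ℕ} (φ : ContDiffBump (0 : ZZ d)) (h : ZZ d → ℝ) (z : ZZ d) :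
    moll φ h z = ∫ t, φ.normed volume t * h (z - t) := rfl

lemma moll_smooth {d : ℕ} (φ : ContDiffBump (0 : ZZ d)) {h : ZZ d → ℝ} (hh : LocallyIntegrable h) :
    ContDiff ℝ 2 (moll φ h) := by
  have := HasCompactSupport.contDiff_convolution_left (n := 2) (ContinuousLinearMap.lsmul ℝ ℝ)
    φ.hasCompactSupport_normed (φ.contDiff_normed (μ := volume)) hh
  exact this

lemma moll_fderiv {d : ℕ} (φ : ContDiffBump (0 : ZZ d)) {h : ZZ d → ℝ} (hh : LocallyIntegrable h) (z v : ZZ d) :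
    fderiv ℝ (moll φ h) z v = ∫ t, fderiv ℝ (φ.normed volume) t v * h (z - t) := by
  have hs : ContDiff ℝ 1 (φ.normed (volume : Measure (ZZ d))) := φ.contDiff_normed (n := 1)
  have := HasCompactSupport.hasFDerivAt_convolution_left (ContinuousLinearMap.lsmul ℝ ℝ)
    φ.hasCompactSupport_normed hs hh z
  unfold moll
  rw [this.fderiv]
  unfold convolution
  have hi : Integrable (fun t => ((ContinuousLinearMap.lsmul ℝ ℝ).precompL (ZZ d) : (ZZ d →L[ℝ] ℝ) →L[ℝ] ℝ →L[ℝ] _)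
      (fderiv ℝ (φ.normed volume) t) (h (z - t))) volume :=
    HasCompactSupport.convolutionExists_left _ (φ.hasCompactSupport_normed.fderiv (𝕜 := ℝ))
      (hs.continuous_fderiv (by norm_num)) hh z
  rw [ContinuousLinearMap.integral_apply hi]
  rfl

lemma moll_ibp {d : ℕ} (φ : ContDiffBump (0 : ZZ d)) {h h' : ZZ d → ℝ} (hh : LocallyIntegrable h)
    (hh' : LocallyIntegrable h') {z v : ZZ d}
    (hd : ∀ y ∈ Metric.closedBall z φ.rOut, HasLineDerivAt ℝ h (h' y) y v) :
    fderiv ℝ (moll φ h) z v = moll φ h' z := by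
  have hs : ContDiff ℝ 1 (φ.normed (volume : Measure (ZZ d))) := φ.contDiff_normed (n := 1)
  rw [moll_fderiv φ hh, moll_apply]
  have hsup : HasCompactSupport (φ.normed (volume : Measure (ZZ d))) := φ.hasCompactSupport_normed
  have i1 : Integrable (fun t => φ.normed volume t * h' (z - t)) volume :=
    hsup.convolutionExists_left (ContinuousLinearMap.lsmul ℝ ℝ) hs.continuous hh' z
  have i2 : Integrable (fun t => φ.normed volume t * h (z - t)) volume :=
    hsup.convolutionExists_left (ContinuousLinearMap.lsmul ℝ ℝ) hs.continuous hh z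
  have hs' : HasCompactSupport (fun t => fderiv ℝ (φ.normed (volume : Measure (ZZ d))) t v) :=
    hsup.fderiv_apply (𝕜 := ℝ) v
  have i3 : Integrable (fun t => fderiv ℝ (φ.normed volume) t v * h (z - t)) volume :=
    hs'.convolutionExists_left (ContinuousLinearMap.lsmul ℝ ℝ)
      ((hs.continuous_fderiv (by norm_num)).clm_apply continuous_const) hh z
  have := integral_bilinear_hasLineDerivAt_right_eq_neg_left_of_integrable (μ := (volume : Measure (ZZ d)))
    (f := φ.normed volume) (f' := fun t => fderiv ℝ (φ.normed volume) t v)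
    (g := fun t => h (z - t)) (g' := fun t => - h' (z - t)) (v := v) (B := ContinuousLinearMap.mul ℝ ℝ)
    (by simpa using i3) (by simpa using i1.neg) (by simpa using i2)
    (fun x _ => ((hs.differentiable (by norm_num)) x).hasFDerivAt.hasLineDerivAt v)
    (fun x hx => by
      rw [φ.tsupport_normed_eq] at hx
      have h1 : z - x ∈ Metric.closedBall z φ.rOut := by
        simpa [dist_eq_norm] using hx
      have h2 := hd _ h1
      unfold HasLineDerivAt at h2 ⊢
      have h3 : HasDerivAt (fun s : ℝ => -s) (-1) 0 := hasDerivAt_neg 0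
      have h4 := HasDerivAt.scomp (0 : ℝ) (by simpa using h2) h3
      simp only [smul_eq_mul, neg_one_mul] at h4
      refine h4.congr_of_eventuallyEq (Filter.Eventually.of_forall fun s => ?_)
      simp only [Function.comp]
      congr 1
      rw [neg_smul]; abel)
  simp only [ContinuousLinearMap.mul_apply', mul_neg, integral_neg, neg_inj] at this
  exact this.symm

lemma jensen_pow {α : Type*} [MeasurableSpace α] (μ : Measure α) [IsProbabilityMeasure μ] {F : α → ℝ}
    (hF : AEStronglyMeasurable F μ) (n : ℕ) : (∫⁻ x, ‖F x‖ₑ ∂μ) ^ (n + 1) ≤ ∫⁻ x, ‖F x‖ₑ ^ (n + 1) ∂μ := by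
  have h := eLpNorm'_le_eLpNorm'_of_exponent_le (p := 1) (q := ((n + 1 : ℕ) : ℝ)) one_pos
    (by push_cast; linarith [(Nat.cast_nonneg n : (0 : ℝ) ≤ n)]) μ hF
  rw [eLpNorm'_eq_lintegral_enorm, eLpNorm'_eq_lintegral_enorm] at h
  simp only [ENNReal.rpow_natCast, ENNReal.rpow_one, div_one] at h
  have h2 := pow_le_pow_left' h (n + 1)
  refine h2.trans (le_of_eq ?_)
  rw [one_div, ← ENNReal.rpow_natCast, ← ENNReal.rpow_mul, inv_mul_cancel₀ (by positivity), ENNReal.rpow_one]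

lemma eLp_pow {d : ℕ} {α : Type*} [MeasurableSpace α] (μ : Measure α) (h : α → ℝ) :
    eLpNorm h ((d + 1 : ℕ) : ℝ≥0∞) μ ^ (d + 1) = ∫⁻ z, ‖h z‖ₑ ^ (d + 1) ∂μ := by
  rw [eLpNorm_eq_lintegral_rpow_enorm_toReal (by simp) (ENNReal.natCast_ne_top _), ENNReal.toReal_natCast]
  simp only [ENNReal.rpow_natCast]
  rw [one_div, ← ENNReal.rpow_natCast, ← ENNReal.rpow_mul, inv_mul_cancel₀ (by positivity), ENNReal.rpow_one]

lemma translate_lp {d : ℕ} {h : ZZ d → ℝ} (hh : MemLp h ((d + 1 : ℕ) : ℝ≥0∞) volume) {η : ℝ} (hη : 0 < η) :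
    ∃ ε > 0, ∀ y : ZZ d, ‖y‖ < ε → ∫⁻ z, ‖h (z - y) - h z‖ₑ ^ (d + 1) ≤ ENNReal.ofReal (η ^ (d + 1)) := by
  have f1 : Fact ((1 : ℝ≥0∞) ≤ ((d + 1 : ℕ) : ℝ≥0∞)) := ⟨by exact_mod_cast Nat.le_add_left 1 d⟩
  set G : C(ZZ d, C(ZZ d, ZZ d)) :=
    (ContinuousMap.mk (fun a : ZZ d × ZZ d => a.2 - a.1) (continuous_snd.sub continuous_fst)).curry with hG
  have hmp : ∀ y : ZZ d, MeasurePreserving (G y) volume volume := fun y => measurePreserving_sub_right volume y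
  have hc := Continuous.compMeasurePreservingLp (f := fun _ : ZZ d => hh.toLp h) continuous_const G.continuous hmp
    (ENNReal.natCast_ne_top _)
  obtain ⟨ε, hε, H⟩ := Metric.continuous_iff.1 hc 0 η hη
  refine ⟨ε, hε, fun y hy => ?_⟩
  have h1 := H y (by simpa using hy)
  rw [Lp.toLp_compMeasurePreserving, Lp.toLp_compMeasurePreserving, dist_eq_norm, ← MemLp.toLp_sub, Lp.norm_toLp] at h1
  have hm := (hh.comp_measurePreserving (hmp y)).sub (hh.comp_measurePreserving (hmp 0))
  have h2 := (ENNReal.lt_ofReal_iff_toReal_lt hm.2.ne).2 h1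
  rw [ENNReal.ofReal_pow hη.le]
  refine le_trans (le_of_eq ?_) (pow_le_pow_left' h2.le (d + 1))
  rw [eLp_pow]
  simp [hG]

lemma moll_lp {d : ℕ} {h : ZZ d → ℝ} (hm : Measurable h) (hh : MemLp h ((d + 1 : ℕ) : ℝ≥0∞) volume) {η : ℝ} (hη : 0 < η) :
    ∃ ε > 0, ∀ φ : ContDiffBump (0 : ZZ d), φ.rOut < ε →
      eLpNorm (fun z => moll φ h z - h z) ((d + 1 : ℕ) : ℝ≥0∞) volume ≤ ENNReal.ofReal η := by
  obtain ⟨ε, hε, H⟩ := translate_lp hh hη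
  refine ⟨ε, hε, fun φ hφ => ?_⟩
  have hloc : LocallyIntegrable h volume := hh.locallyIntegrable (by exact_mod_cast Nat.le_add_left 1 d)
  have hs : ContDiff ℝ 1 (φ.normed (volume : Measure (ZZ d))) := φ.contDiff_normed (n := 1)
  have hsup : HasCompactSupport (φ.normed (volume : Measure (ZZ d))) := φ.hasCompactSupport_normed
  set ρ := φ.normed (volume : Measure (ZZ d)) with hρ
  have hρi : Integrable ρ volume := hs.continuous.integrable_of_hasCompactSupport hsup
  set μ := volume.withDensity (fun t => ‖ρ t‖ₑ) with hμ
  have hρm : Measurable fun t => ‖ρ t‖ₑ := hs.continuous.measurable.enorm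
  have hpr : IsProbabilityMeasure μ := by
    refine ⟨?_⟩
    rw [hμ, withDensity_apply _ MeasurableSet.univ, setLIntegral_univ]
    have : ∀ t, ‖ρ t‖ₑ = ENNReal.ofReal (ρ t) := fun t => Real.enorm_of_nonneg (φ.nonneg_normed t)
    simp_rw [this]
    rw [← ofReal_integral_eq_lintegral_ofReal hρi (Filter.Eventually.of_forall fun t => φ.nonneg_normed t),
      hρ, φ.integral_normed, ENNReal.ofReal_one]
  have hpt : ∀ z, ‖moll φ h z - h z‖ₑ ^ (d + 1) ≤ ∫⁻ t, ‖h (z - t) - h z‖ₑ ^ (d + 1) ∂μ := by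
    intro z
    have i2 : Integrable (fun t => ρ t * h (z - t)) volume :=
      hsup.convolutionExists_left (ContinuousLinearMap.lsmul ℝ ℝ) hs.continuous hloc z
    have e : moll φ h z - h z = ∫ t, ρ t * (h (z - t) - h z) := by
      simp_rw [mul_sub]
      rw [integral_sub i2 (hρi.mul_const _), integral_mul_const, hρ, φ.integral_normed, one_mul]
      rfl
    have mm : Measurable fun t => h (z - t) - h z := (hm.comp (measurable_const.sub measurable_id)).sub_const _
    refine le_trans (pow_le_pow_left' ?_ _) (jensen_pow μ mm.aestronglyMeasurable d)
    rw [e, hμ, lintegral_withDensity_eq_lintegral_mul _ hρm mm.enorm]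
    refine (enorm_integral_le_lintegral_enorm _).trans (le_of_eq ?_)
    refine lintegral_congr fun t => ?_
    simp [enorm_mul]
  have hae : ∀ᵐ t ∂μ, ‖t‖ < ε := by
    rw [hμ, ae_withDensity_iff hρm]
    refine Filter.Eventually.of_forall fun t ht => ?_
    have : t ∈ Function.support ρ := by
      rw [Function.mem_support]; simpa using ht
    rw [hρ, φ.support_normed_eq] at this
    have h2 : ‖t‖ < φ.rOut := by simpa using this
    linarith
  refine (ENNReal.pow_le_pow_left_iff (n := d + 1) (by omega)).1 ?_
  rw [eLp_pow, ← ENNReal.ofReal_pow hη.le]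
  calc ∫⁻ z, ‖moll φ h z - h z‖ₑ ^ (d + 1) ≤ ∫⁻ z, ∫⁻ t, ‖h (z - t) - h z‖ₑ ^ (d + 1) ∂μ := lintegral_mono hpt
    _ = ∫⁻ t, (∫⁻ z, ‖h (z - t) - h z‖ₑ ^ (d + 1)) ∂μ := by
        refine lintegral_lintegral_swap ?_
        refine Measurable.aemeasurable ?_
        exact ((hm.comp (measurable_fst.sub measurable_snd)).sub (hm.comp measurable_fst)).enorm.pow_const _
    _ ≤ ∫⁻ t, ENNReal.ofReal (η ^ (d + 1)) ∂μ := by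
        refine lintegral_mono_ae ?_
        filter_upwards [hae] with t ht using H t ht
    _ = ENNReal.ofReal (η ^ (d + 1)) := by simp

lemma a_bound {d : ℕ} {δ K : ℝ} {a : Matrix (Fin d) (Fin d) ℝ} {b : EE d} {c : ℝ}
    (h : Adm δ K a b c) (hδ : 0 < δ) (hs : a.IsSymm) (i j : Fin d) : |a i j| ≤ δ⁻¹ := by
  have hdi : 0 < δ⁻¹ := inv_pos.2 hδ
  have q : ∀ ξ : EE d, 0 ≤ ∑ i, ∑ j, a i j * ξ i * ξ j := fun ξ => le_trans (by positivity) (h.lo ξ)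
  have hii : ∀ k, 0 ≤ a k k ∧ a k k ≤ δ⁻¹ := by
    intro k
    have h1 := h.up (eb k)
    have h0 := q (eb k)
    have h2 : ‖(eb k : EE d)‖ = 1 := by simp [eb]
    rw [h2] at h1
    exact ⟨by simpa [eb, Pi.single_apply] using h0, by simpa [eb, Pi.single_apply] using h1⟩
  have ex : ∀ s : ℝ, ∑ k, ∑ l, a k l * (eb i + s • eb j : EE d) k * (eb i + s • eb j : EE d) l =
      a i i + s * (2 * a i j) + s ^ 2 * a j j := by
    intro s
    have hij : a j i = a i j := hs.apply i j
    simp only [eb, PiLp.add_apply, PiLp.smul_apply, PiLp.single_apply, smul_eq_mul, mul_add, add_mul,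
      Finset.sum_add_distrib, mul_ite, ite_mul, mul_one, mul_zero, zero_mul, Finset.sum_ite_eq', Finset.mem_univ, if_true]
    rw [hij]; ring
  have p1 := q (eb i + (1 : ℝ) • eb j)
  have p2 := q (eb i + (-1 : ℝ) • eb j)
  rw [ex] at p1 p2
  have := hii i
  have := hii j
  rw [abs_le]
  constructor <;> linarith

lemma memLp_ind {d : ℕ} {G : Set (ZZ d)} (hG : IsCompact G) {h F : ZZ d → ℝ} (hm : Measurable h)
    (hF : IntegrableOn F G volume) (hle : ∀ z, |h z| ^ ((d : ℝ) + 1) ≤ F z) :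
    MemLp (G.indicator h) ((d + 1 : ℕ) : ℝ≥0∞) volume := by
  rw [memLp_indicator_iff_restrict hG.measurableSet]
  refine (integrable_norm_rpow_iff hm.aestronglyMeasurable (by simp) (ENNReal.natCast_ne_top _)).1 ?_
  refine Integrable.mono' hF (hm.norm.pow_const _).aestronglyMeasurable (Filter.Eventually.of_forall fun z => ?_)
  rw [Real.norm_of_nonneg (by positivity), ENNReal.toReal_natCast]
  push_cast
  exact hle z

lemma moll_ind {d : ℕ} (φ : ContDiffBump (0 : ZZ d)) {G : Set (ZZ d)} {h h' : ZZ d → ℝ}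
    (hh : LocallyIntegrable (G.indicator h)) (hh' : LocallyIntegrable (G.indicator h')) {z v : ZZ d} {ε : ℝ}
    (hε : φ.rOut < ε) (hG : Metric.ball z ε ⊆ G)
    (hd : ∀ y ∈ G, HasLineDerivAt ℝ h (h' y) y v) :
    fderiv ℝ (moll φ (G.indicator h)) z v = moll φ (G.indicator h') z := by
  refine moll_ibp φ hh hh' fun y hy => ?_
  have hy1 : y ∈ Metric.ball z ε := lt_of_le_of_lt hy hε
  rw [indicator_of_mem (hG hy1)]
  refine (hd y (hG hy1)).congr_of_eventuallyEq ?_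
  filter_upwards [Metric.isOpen_ball.mem_nhds hy1] with x hx
  rw [indicator_of_mem (hG hx)]

lemma moll_lp_fin {d : ℕ} {ι : Type*} [Fintype ι] (h : ι → ZZ d → ℝ) (hm : ∀ k, Measurable (h k))
    (hh : ∀ k, MemLp (h k) ((d + 1 : ℕ) : ℝ≥0∞) volume) {η : ℝ} (hη : 0 < η) :
    ∃ ε > 0, ∀ φ : ContDiffBump (0 : ZZ d), φ.rOut < ε →
      eLpNorm (fun z => ∑ k, |moll φ (h k) z - h k z|) ((d + 1 : ℕ) : ℝ≥0∞) volume ≤ ENNReal.ofReal η := by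
  set η' := η / (Fintype.card ι + 1) with hη'
  have hη'0 : 0 < η' := by positivity
  have hp1 : (1 : ℝ≥0∞) ≤ ((d + 1 : ℕ) : ℝ≥0∞) := by exact_mod_cast Nat.le_add_left 1 d
  have H : ∀ᶠ r in nhdsWithin (0 : ℝ) (Ioi 0), ∀ k, ∀ φ : ContDiffBump (0 : ZZ d), φ.rOut < r →
      eLpNorm (fun z => moll φ (h k) z - h k z) ((d + 1 : ℕ) : ℝ≥0∞) volume ≤ ENNReal.ofReal η' := by
    rw [Filter.eventually_all]
    intro k
    obtain ⟨ε, hε, HH⟩ := moll_lp (hm k) (hh k) hη'0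
    filter_upwards [Ioo_mem_nhdsGT hε] with r hr φ hφ using HH φ (hφ.trans hr.2)
  obtain ⟨ε, H1, H2⟩ := (H.and self_mem_nhdsWithin).exists
  refine ⟨ε, H2, fun φ hφ => ?_⟩
  have e1 : (fun z => ∑ k, |moll φ (h k) z - h k z|) = ∑ k, fun z => |moll φ (h k) z - h k z| := by
    funext z; simp
  rw [e1]
  refine (eLpNorm_sum_le (fun k _ => ?_) hp1).trans ?_
  · have := (moll_smooth φ ((hh k).locallyIntegrable hp1)).continuous.measurable
    exact ((this.sub (hm k)).abs).aestronglyMeasurable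
  calc ∑ k, eLpNorm (fun z => |moll φ (h k) z - h k z|) ((d + 1 : ℕ) : ℝ≥0∞) volume
      ≤ ∑ k : ι, ENNReal.ofReal η' := by
        refine Finset.sum_le_sum fun k _ => ?_
        refine le_trans (le_of_eq ?_) (H1 k φ hφ)
        exact eLpNorm_norm (fun z => moll φ (h k) z - h k z)
    _ = ENNReal.ofReal (Fintype.card ι * η') := by
        rw [Finset.sum_const, Finset.card_univ, nsmul_eq_mul, ENNReal.ofReal_mul (by positivity), ENNReal.ofReal_natCast]
    _ ≤ ENNReal.ofReal η := by
        apply ENNReal.ofReal_le_ofReal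
        rw [hη', mul_div_assoc', div_le_iff₀ (by positivity)]
        nlinarith

/-- smooth approximation on compact subsets -/
lemma approx {d : ℕ} {δ K : ℝ} (hδ : 0 < δ) (hK : 0 ≤ K) {Om : Set (ZZ d)} (hOm : IsOpen Om)
    {u ut : ZZ d → ℝ} {du : ZZ d → EE d} {d2u : ZZ d → Matrix (Fin d) (Fin d) ℝ}
    (mu : Measurable u) (mutt : Measurable ut) (mdu : ∀ i, Measurable fun z => du z i)
    (md2 : ∀ i j, Measurable fun z => d2u z i j) (hc : ContinuousOn u Om)
    (h1 : ∀ z ∈ Om, HasDerivAt (fun s => u (s, z.2)) (ut z) z.1)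
    (h2 : ∀ z ∈ Om, ∀ i, HasDerivAt (fun s : ℝ => u (z.1, z.2 + s • EuclideanSpace.single i (1 : ℝ))) (du z i) 0)
    (h3 : ∀ z ∈ Om, ∀ i j, HasDerivAt (fun s : ℝ => du (z.1, z.2 + s • EuclideanSpace.single j (1 : ℝ)) i)
            (d2u z i j) 0)
    (hI : ∀ G : Set (ZZ d), IsCompact G → G ⊆ Om →
          IntegrableOn (fun z => |ut z| ^ ((d : ℝ) + 1) + ‖du z‖ ^ ((d : ℝ) + 1) +
            frobNorm (d2u z) ^ ((d : ℝ) + 1)) G volume)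
    {G : Set (ZZ d)} (hG : IsCompact G) (hGO : G ⊆ Om) {η : ℝ} (hη : 0 < η) :
    ∃ v e : ZZ d → ℝ, (∀ z, ContDiffAt ℝ 2 v z) ∧ Measurable e ∧ (∀ z, 0 ≤ e z) ∧
      (∀ z ∈ G, |v z - u z| ≤ η) ∧ eLpNorm e ((d + 1 : ℕ) : ℝ≥0∞) volume ≤ ENNReal.ofReal η ∧
      ∀ z ∈ G, ∀ a b c, Adm δ K a b c → a.IsSymm →
        Lop a b c v z ≤ ut z + (∑ i, ∑ j, a i j * d2u z i j) + (∑ i, b i * du z i) - c * u z + e z := by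
  obtain ⟨ε1, hε1, hsub⟩ := hG.exists_cthickening_subset_open hOm hGO
  set G' := Metric.cthickening ε1 G with hG'
  have hGc : IsCompact G' := hG.cthickening
  have hGG : G ⊆ G' := Metric.self_subset_cthickening G
  have hp1 : (1 : ℝ≥0∞) ≤ ((d + 1 : ℕ) : ℝ≥0∞) := by exact_mod_cast Nat.le_add_left 1 d
  have hd1 : 0 ≤ (d : ℝ) + 1 := by positivity
  have hI' := hI G' hGc hsub
  have ms := hGc.measurableSet
  have hball : ∀ z ∈ G, Metric.ball z ε1 ⊆ G' := by
    intro z hz y hy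
    exact Metric.mem_cthickening_of_dist_le y z ε1 G hz hy.le
  have hfrob0 : ∀ m : Matrix (Fin d) (Fin d) ℝ, 0 ≤ frobNorm m := fun m => Real.sqrt_nonneg _
  -- integrability of the pieces
  have Lt : MemLp (G'.indicator ut) ((d + 1 : ℕ) : ℝ≥0∞) volume := by
    refine memLp_ind hGc mutt hI' fun z => ?_
    have := Real.rpow_nonneg (norm_nonneg (du z)) ((d : ℝ) + 1)
    have := Real.rpow_nonneg (hfrob0 (d2u z)) ((d : ℝ) + 1)
    linarith
  have L1 : ∀ i, MemLp (G'.indicator fun z => du z i) ((d + 1 : ℕ) : ℝ≥0∞) volume := by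
    intro i
    refine memLp_ind hGc (mdu i) hI' fun z => ?_
    have h1 : |du z i| ^ ((d : ℝ) + 1) ≤ ‖du z‖ ^ ((d : ℝ) + 1) :=
      Real.rpow_le_rpow (abs_nonneg _) (PiLp.norm_apply_le (du z) i) hd1
    have := Real.rpow_nonneg (abs_nonneg (ut z)) ((d : ℝ) + 1)
    have := Real.rpow_nonneg (hfrob0 (d2u z)) ((d : ℝ) + 1)
    linarith
  have L2 : ∀ i j, MemLp (G'.indicator fun z => d2u z i j) ((d + 1 : ℕ) : ℝ≥0∞) volume := by
    intro i j
    refine memLp_ind hGc (md2 i j) hI' fun z => ?_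
    have h0 : |d2u z i j| ≤ frobNorm (d2u z) := by
      apply Real.abs_le_sqrt
      refine le_trans ?_ (Finset.single_le_sum (f := fun i => ∑ j, d2u z i j ^ 2) (fun k _ => Finset.sum_nonneg fun l _ => sq_nonneg _)
        (Finset.mem_univ i))
      exact Finset.single_le_sum (f := fun j => d2u z i j ^ 2) (fun l _ => sq_nonneg _) (Finset.mem_univ j)
    have h1 : |d2u z i j| ^ ((d : ℝ) + 1) ≤ frobNorm (d2u z) ^ ((d : ℝ) + 1) :=
      Real.rpow_le_rpow (abs_nonneg _) h0 hd1
    have := Real.rpow_nonneg (abs_nonneg (ut z)) ((d : ℝ) + 1)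
    have := Real.rpow_nonneg (norm_nonneg (du z)) ((d : ℝ) + 1)
    linarith
  have L0 : MemLp (G'.indicator u) ((d + 1 : ℕ) : ℝ≥0∞) volume := by
    rw [memLp_indicator_iff_restrict ms]
    obtain ⟨C, hC⟩ := hGc.exists_bound_of_continuousOn (hc.mono hsub)
    have : IsFiniteMeasure (volume.restrict G') := ⟨by simpa using hGc.measure_lt_top⟩
    exact MemLp.of_bound mu.aestronglyMeasurable C ((ae_restrict_iff' ms).2 (Filter.Eventually.of_forall hC))
  have l0 := L0.locallyIntegrable hp1
  have lt := Lt.locallyIntegrable hp1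
  have l1 := fun i => (L1 i).locallyIntegrable hp1
  have l2 := fun i j => (L2 i j).locallyIntegrable hp1
  set C := 1 + δ⁻¹ + K with hC
  have hdi : 0 < δ⁻¹ := inv_pos.2 hδ
  have hC0 : 0 < C := by positivity
  -- the family
  set F : (Fin d × Fin d) ⊕ Fin d ⊕ Bool → ZZ d → ℝ :=
    Sum.elim (fun p => G'.indicator fun z => d2u z p.1 p.2)
      (Sum.elim (fun i => G'.indicator fun z => du z i) (fun b => cond b (G'.indicator ut) (G'.indicator u))) with hF
  obtain ⟨ε2, hε2, HLp⟩ := moll_lp_fin F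
    (by
      rintro (⟨i, j⟩ | i | b)
      · exact (md2 i j).indicator ms
      · exact (mdu i).indicator ms
      · cases b
        · exact mu.indicator ms
        · exact mutt.indicator ms)
    (by
      rintro (⟨i, j⟩ | i | b)
      · exact L2 i j
      · exact L1 i
      · cases b
        · exact L0
        · exact Lt) (div_pos hη hC0)
  obtain ⟨ε3, hε3, Huc⟩ := Metric.uniformContinuousOn_iff.1 (hGc.uniformContinuousOn_of_continuous (hc.mono hsub)) η hη
  set r := min (ε1 / 2) (min ε2 ε3) / 2 with hr
  have hr0 : 0 < r := by positivity
  have hmin0 : 0 < min (ε1 / 2) (min ε2 ε3) := by positivity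
  have hra : r < ε1 / 2 := by have := min_le_left (ε1 / 2) (min ε2 ε3); linarith
  have hrb : r < ε2 := by
    have := (min_le_right (ε1 / 2) (min ε2 ε3)).trans (min_le_left ε2 ε3); linarith
  have hrc : r < ε3 := by
    have := (min_le_right (ε1 / 2) (min ε2 ε3)).trans (min_le_right ε2 ε3); linarith
  set φ : ContDiffBump (0 : ZZ d) := ⟨r / 2, r, by positivity, by linarith⟩ with hφ
  have hφr : φ.rOut = r := rfl
  have hLp := HLp φ hrb
  set v := moll φ (G'.indicator u) with hv
  have vs : ContDiff ℝ 2 v := moll_smooth φ l0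
  -- line derivatives
  have d1 : ∀ y ∈ G', HasLineDerivAt ℝ u (ut y) y (1, 0) := by
    intro y hy
    have := h1 y (hsub hy)
    unfold HasLineDerivAt
    have h := HasDerivAt.scomp (0 : ℝ) (g₁ := fun s => u (s, y.2)) (h := fun s : ℝ => y.1 + s) (by simpa using this)
      ((hasDerivAt_id (0 : ℝ)).const_add y.1)
    simp only [one_smul] at h
    refine h.congr_of_eventuallyEq (Filter.Eventually.of_forall fun s => ?_)
    simp only [Function.comp]
    congr 1
    exact Prod.ext (by simp) (by simp)
  have d2 : ∀ i, ∀ y ∈ G', HasLineDerivAt ℝ u (du y i) y (0, eb i) := by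
    intro i y hy
    unfold HasLineDerivAt
    refine (h2 y (hsub hy) i).congr_of_eventuallyEq (Filter.Eventually.of_forall fun s => ?_)
    have e : y + s • ((0 : ℝ), (eb i : EE d)) = (y.1, y.2 + s • EuclideanSpace.single i (1 : ℝ)) :=
      Prod.ext (by simp) (by simp [eb])
    show u _ = u _
    rw [e]
  have d3 : ∀ i j, ∀ y ∈ G', HasLineDerivAt ℝ (fun z => du z i) (d2u y i j) y (0, eb j) := by
    intro i j y hy
    unfold HasLineDerivAt
    refine (h3 y (hsub hy) i j).congr_of_eventuallyEq (Filter.Eventually.of_forall fun s => ?_)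
    have e : y + s • ((0 : ℝ), (eb j : EE d)) = (y.1, y.2 + s • EuclideanSpace.single j (1 : ℝ)) :=
      Prod.ext (by simp) (by simp [eb])
    show du _ i = du _ i
    rw [e]
  have D1 : ∀ z ∈ G, dt v z = moll φ (G'.indicator ut) z := fun z hz =>
    moll_ind φ l0 lt (ε := ε1) (by rw [hφr]; linarith) (hball z hz) d1
  have D2 : ∀ z ∈ G, ∀ z' ∈ Metric.ball z (ε1 / 2), ∀ i, fderiv ℝ v z' (0, eb i) = moll φ (G'.indicator fun z => du z i) z' := by
    intro z hz z' hz' i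
    refine moll_ind φ l0 (l1 i) (ε := ε1 / 2) (by rw [hφr]; linarith) ?_ (d2 i)
    refine (Metric.ball_subset_ball' ?_).trans (hball z hz)
    have : dist z' z < ε1 / 2 := hz'
    linarith
  have D3 : ∀ z ∈ G, ∀ i j, dxx v z (eb i) (eb j) = moll φ (G'.indicator fun z => d2u z j i) z := by
    intro z hz i j
    rw [← moll_ind φ (l1 j) (l2 j i) (ε := ε1) (by rw [hφr]; linarith) (hball z hz) (d3 j i)]
    have hev : (fun z' => fderiv ℝ v z' (0, eb j)) =ᶠ[nhds z] moll φ (G'.indicator fun z => du z j) := by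
      filter_upwards [Metric.ball_mem_nhds z (half_pos hε1)] with z' hz' using D2 z hz z' hz' j
    rw [← hev.fderiv_eq]
    unfold dxx
    have hdiff : DifferentiableAt ℝ (fderiv ℝ v) z :=
      (vs.fderiv_right (m := 1) (by norm_num)).differentiable (by norm_num) z
    have := (hdiff.hasFDerivAt.clm_apply (hasFDerivAt_const ((0 : ℝ), (eb j : EE d)) z)).fderiv
    rw [this]
    simp
  refine ⟨v, fun z => C * ∑ k, |moll φ (F k) z - F k z|, fun z => vs.contDiffAt, ?_, fun z => ?_, fun z hz => ?_, ?_, ?_⟩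
  · refine Measurable.const_mul (Finset.measurable_sum _ fun k _ => ?_) _
    have key : ∀ h : ZZ d → ℝ, Measurable h → LocallyIntegrable h volume → Measurable fun z => |moll φ h z - h z| :=
      fun h m l => ((moll_smooth φ l).continuous.measurable.sub m).abs
    rcases k with (⟨i, j⟩ | i | b)
    · exact key _ ((md2 i j).indicator ms) (l2 i j)
    · exact key _ ((mdu i).indicator ms) (l1 i)
    · cases b
      · exact key _ (mu.indicator ms) l0
      · exact key _ (mutt.indicator ms) lt
  · positivity
  · have := ContDiffBump.dist_normed_convolution_le (φ := φ) (x₀ := z) (ε := η) (mu.indicator ms).aestronglyMeasurable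
      (μ := volume) (g := G'.indicator u) (fun x hx => by
        have hx1 : dist x z < r := hx
        have hx' : x ∈ G' := hball z hz (show dist x z < ε1 by linarith)
        rw [indicator_of_mem hx', indicator_of_mem (hGG hz)]
        exact (Huc x hx' z (hGG hz) (hx1.trans hrc)).le)
    rw [indicator_of_mem (hGG hz), Real.dist_eq] at this
    exact this
  · have := eLpNorm_const_smul (μ := volume) (p := ((d + 1 : ℕ) : ℝ≥0∞)) C (fun z => ∑ k, |moll φ (F k) z - F k z|)
    simp only [Pi.smul_def, smul_eq_mul] at this
    rw [this, Real.enorm_of_nonneg hC0.le]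
    refine (mul_le_mul_right hLp _).trans (le_of_eq ?_)
    rw [← ENNReal.ofReal_mul hC0.le, mul_div_cancel₀ _ hC0.ne']
  · intro z hz a b c hA hs
    have hz' := hGG hz
    simp only [hF, Fintype.sum_sum_type, Sum.elim_inl, Sum.elim_inr, Fintype.sum_prod_type, Fintype.sum_bool, cond_true, cond_false,
      indicator_of_mem hz']
    rw [← hv]
    unfold Lop
    rw [D1 z hz, dx_sum]
    simp only [D3 z hz]
    have D2' : ∀ i, dx v z (eb i) = moll φ (G'.indicator fun z => du z i) z :=
      fun i => D2 z hz z (Metric.mem_ball_self (half_pos hε1)) i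
    simp only [D2']
    set T := moll φ (G'.indicator ut) z
    set W : Fin d → ℝ := fun i => moll φ (G'.indicator fun z => du z i) z with hW
    set Q : Fin d → Fin d → ℝ := fun i j => moll φ (G'.indicator fun z => d2u z i j) z with hQ
    have E2 : ∑ i, ∑ j, a i j * Q j i - ∑ i, ∑ j, a i j * d2u z i j ≤ δ⁻¹ * ∑ i, ∑ j, |Q i j - d2u z i j| := by
      have : ∑ i, ∑ j, a i j * Q j i = ∑ i, ∑ j, a i j * Q i j := by
        rw [Finset.sum_comm]
        refine Finset.sum_congr rfl fun i _ => Finset.sum_congr rfl fun j _ => ?_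
        rw [hs.apply]
      rw [this, ← Finset.sum_sub_distrib, Finset.mul_sum]
      refine Finset.sum_le_sum fun i _ => ?_
      rw [← Finset.sum_sub_distrib, Finset.mul_sum]
      refine Finset.sum_le_sum fun j _ => ?_
      rw [← mul_sub]
      refine (le_abs_self _).trans ?_
      rw [abs_mul]
      exact mul_le_mul_of_nonneg_right (a_bound hA hδ hs i j) (abs_nonneg _)
    have hbK : ‖b‖ ≤ K := by linarith [hA.bc, hA.c0]
    have hcK : c ≤ K := by linarith [hA.bc, norm_nonneg b]
    have E1 : ∑ i, b i * W i - ∑ i, b i * du z i ≤ K * ∑ i, |W i - du z i| := by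
      rw [← Finset.sum_sub_distrib, Finset.mul_sum]
      refine Finset.sum_le_sum fun i _ => ?_
      rw [← mul_sub]
      refine (le_abs_self _).trans ?_
      rw [abs_mul]
      exact mul_le_mul_of_nonneg_right ((PiLp.norm_apply_le b i).trans hbK) (abs_nonneg _)
    have E0 : c * u z - c * v z ≤ K * |v z - u z| := by
      have : c * u z - c * v z = c * (-(v z - u z)) := by ring
      rw [this]
      calc c * (-(v z - u z)) ≤ c * |v z - u z| := mul_le_mul_of_nonneg_left (neg_le_abs _) hA.c0
        _ ≤ _ := mul_le_mul_of_nonneg_right hcK (abs_nonneg _)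
    have Et : T - ut z ≤ |T - ut z| := le_abs_self _
    have n2 : 0 ≤ ∑ i, ∑ j, |Q i j - d2u z i j| := Finset.sum_nonneg fun i _ => Finset.sum_nonneg fun j _ => abs_nonneg _
    have n1 : 0 ≤ ∑ i, |W i - du z i| := Finset.sum_nonneg fun i _ => abs_nonneg _
    have n0 := abs_nonneg (v z - u z)
    have nt := abs_nonneg (T - ut z)
    have p1 : δ⁻¹ * ∑ i, ∑ j, |Q i j - d2u z i j| ≤ C * ∑ i, ∑ j, |Q i j - d2u z i j| :=
      mul_le_mul_of_nonneg_right (by linarith) n2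
    have p2 : K * ∑ i, |W i - du z i| ≤ C * ∑ i, |W i - du z i| := mul_le_mul_of_nonneg_right (by linarith) n1
    have p3 : K * |v z - u z| ≤ C * |v z - u z| := mul_le_mul_of_nonneg_right (by linarith) n0
    have p4 : 1 * |T - ut z| ≤ C * |T - ut z| := mul_le_mul_of_nonneg_right (by linarith) nt
    rw [mul_add, mul_add, mul_add]
    linarith

lemma core {d : ℕ} {δ K γ N : ℝ} (hδ : 0 < δ) (hK : 0 ≤ K) (hγ0 : 0 < γ) (hγ1 : γ ≤ 1)
    (HS : ∀ (u f g : ZZ d → ℝ) (M : ℝ), Measurable f →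
      C2on u (cyl 0 2 0 1) → (∀ z ∈ cyl 0 2 0 1, 0 ≤ f z) → (∀ z ∈ cyl 0 2 0 1, 0 ≤ g z) →
      (∀ z ∈ cyl 0 2 0 1, Super (δ / 2) K u z (g z - f z)) →
      0 < M →
      ∫⁻ z in cyl 0 2 0 1, ENNReal.ofReal (g z) ^ (d + 1) ≤ ENNReal.ofReal (M ^ (d + 1)) →
      (∀ t ∈ Icc (0 : ℝ) 2, ∀ x, dist x 0 = 1 → -M ≤ u (t, x)) →
      (∀ x ∈ Metric.closedBall 0 1, -M ≤ u (2, x)) →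
      u (0, 0) ≤ M →
      ∫⁻ z in Ioo 1 2 ×ˢ Metric.ball 0 1, ENNReal.ofReal (f z) ^ γ ≤ ENNReal.ofReal (N * M ^ γ))
    {a : ZZ d → Matrix (Fin d) (Fin d) ℝ} {b : ZZ d → EE d} {c : ZZ d → ℝ} {u f g : ZZ d → ℝ} {L : ZZ d → ℝ}
    {G : Set (ZZ d)} {η M r : ℝ} (hη : 0 < η) (hM : η ≤ M) (hr : 1 / 2 ≤ r) (hr1 : r < 1)
    (hA : ∀ z, Adm δ K (a z) (b z) (c z))
    (mf : Measurable f) (mg : Measurable g)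
    (hG : IsCompact G) (hcG : ∀ z ∈ cyl 0 2 0 1, sc (1 - r) r 0 r z ∈ G)
    (hL : ∀ z ∈ G, L z = g z - f z) (hf0 : ∀ z ∈ G, 0 ≤ f z)
    {v e : ZZ d → ℝ} (vs : ∀ z, ContDiffAt ℝ 2 v z) (me : Measurable e) (he0 : ∀ z, 0 ≤ e z)
    (hvu : ∀ z ∈ G, |v z - u z| ≤ η) (heL : eLpNorm e ((d + 1 : ℕ) : ℝ≥0∞) volume ≤ ENNReal.ofReal η)
    (hLop : ∀ z ∈ G, Lop (a z) (b z) (c z) v z ≤ L z + e z)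
    (hI : eLpNorm (fun z => max (g z) 0) ((d + 1 : ℕ) : ℝ≥0∞) (volume.restrict G) ≤ ENNReal.ofReal (M - η))
    (hlat : ∀ t ∈ Icc (0 : ℝ) 2, ∀ x, dist x 0 = 1 → -(M - η) ≤ u (sc (1 - r) r 0 r (t, x)))
    (htop : ∀ x ∈ Metric.closedBall 0 1, -(M - η) ≤ u (sc (1 - r) r 0 r (2, x)))
    (hvx : u (sc (1 - r) r 0 r (0, 0)) ≤ M - η) :
    ∫⁻ z in Ioo 1 (1 + r) ×ˢ Metric.ball 0 r, ENNReal.ofReal (f z) ^ γ ≤ ENNReal.ofReal (N * M ^ γ) := by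
  set A := sc (d := d) (1 - r) r 0 r with hAd
  have hr0 : 0 < r := by linarith
  have hM0 : 0 < M := by linarith
  have mA : Measurable A := by
    have : Continuous A := (sc_contDiff (1 - r) r (0 : EE d) r).continuous
    exact this.measurable
  have hp1 : (1 : ℝ≥0∞) ≤ ((d + 1 : ℕ) : ℝ≥0∞) := by exact_mod_cast Nat.le_add_left 1 d
  have hkey := HS (fun z => v (A z)) (fun z => r * f (A z)) (fun z => r * (max (g (A z)) 0 + e (A z))) M
    ((mf.comp mA).const_mul _) (fun z hz => C2_sc (vs _)) (fun z hz => mul_nonneg hr0.le (hf0 _ (hcG z hz)))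
    (fun z hz => mul_nonneg hr0.le (add_nonneg (le_max_right _ _) (he0 _)))
    ?_ hM0 ?_ ?_ ?_ ?_
  · -- transform back
    have hpre : A ⁻¹' (Ioo 1 (1 + r) ×ˢ Metric.ball 0 r) = Ioo 1 2 ×ˢ Metric.ball 0 1 := by
      ext ⟨t, x⟩
      simp only [hAd, sc, mem_preimage, mem_prod, mem_Ioo, Metric.mem_ball, dist_zero_right, zero_add, norm_smul,
        Real.norm_of_nonneg hr0.le]
      constructor
      · rintro ⟨⟨h1, h2⟩, h3⟩
        refine ⟨⟨?_, ?_⟩, ?_⟩ <;> nlinarith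
      · rintro ⟨⟨h1, h2⟩, h3⟩
        refine ⟨⟨?_, ?_⟩, ?_⟩ <;> nlinarith
    rw [← hpre] at hkey
    have hm := sc_vol_map (1 - r) (0 : EE d) hr0 hr0 (fun z => ENNReal.ofReal (r * f z) ^ γ) (Ioo 1 (1 + r) ×ˢ Metric.ball 0 r)
    rw [← hAd] at hm
    refine le_trans ?_ (hm ▸ hkey)
    rw [← lintegral_const_mul' _ _ ENNReal.ofReal_ne_top]
    refine lintegral_mono fun z => ?_
    rw [ENNReal.ofReal_mul hr0.le, ENNReal.mul_rpow_of_nonneg _ _ hγ0.le, ← mul_assoc]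
    refine le_mul_of_one_le_left zero_le ?_
    rw [ENNReal.ofReal_rpow_of_pos hr0, ← ENNReal.ofReal_mul (by positivity)]
    apply ENNReal.one_le_ofReal.2
    rw [inv_mul_eq_div, one_le_div (by positivity)]
    calc r * r ^ d ≤ r * 1 := mul_le_mul_of_nonneg_left (pow_le_one₀ hr0.le hr1.le) hr0.le
      _ = r ^ (1 : ℝ) := by simp
      _ ≤ r ^ γ := Real.rpow_le_rpow_of_exponent_ge hr0 hr1.le hγ1
  · intro z hz
    have hz' := hcG z hz
    have hAz := hA (A z)
    refine ⟨(r / r ^ 2) • a (A z), (r / r) • b (A z), r * c (A z), ⟨?_, ?_, ?_, mul_nonneg hr0.le hAz.c0⟩, ?_⟩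
    · intro ξ
      have e1 : ∑ i, ∑ j, ((r / r ^ 2) • a (A z)) i j * ξ i * ξ j = (r / r ^ 2) * ∑ i, ∑ j, a (A z) i j * ξ i * ξ j := by
        simp only [Finset.mul_sum, Matrix.smul_apply, smul_eq_mul, mul_assoc]
      rw [e1]
      have h1 := hAz.lo ξ
      have h2 : 1 ≤ r / r ^ 2 := by rw [one_le_div (by positivity)]; nlinarith
      have h3 : 0 ≤ δ * ‖ξ‖ ^ 2 := by positivity
      nlinarith
    · intro ξ
      have e1 : ∑ i, ∑ j, ((r / r ^ 2) • a (A z)) i j * ξ i * ξ j = (r / r ^ 2) * ∑ i, ∑ j, a (A z) i j * ξ i * ξ j := by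
        simp only [Finset.mul_sum, Matrix.smul_apply, smul_eq_mul, mul_assoc]
      rw [e1]
      have h1 := hAz.up ξ
      have h2 : r / r ^ 2 ≤ 2 := by rw [div_le_iff₀ (by positivity)]; nlinarith
      have h3 : 0 ≤ δ⁻¹ * ‖ξ‖ ^ 2 := by positivity
      have h4 : (δ / 2)⁻¹ = 2 * δ⁻¹ := by field_simp
      rw [h4, mul_assoc]
      exact mul_le_mul h2 h1 (le_trans (by positivity) (hAz.lo ξ)) (by norm_num)
    · rw [div_self hr0.ne', one_smul]
      have := hAz.bc
      have := mul_le_of_le_one_left hAz.c0 hr1.le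
      linarith
    · rw [Lop_sc hr0.ne' (vs _)]
      have h1 := hLop (A z) hz'
      have h2 := le_max_left (g (A z)) 0
      rw [hL _ hz'] at h1
      rw [← mul_sub]
      apply mul_le_mul_of_nonneg_left _ hr0.le
      linarith
  · have hsub : cyl (d := d) 0 2 0 1 ⊆ A ⁻¹' G := hcG
    refine (lintegral_mono_set hsub).trans ?_
    have hm := sc_vol_map (1 - r) (0 : EE d) hr0 hr0 (fun z => ENNReal.ofReal (r * (max (g z) 0 + e z)) ^ (d + 1)) G
    rw [← hAd] at hm
    rw [hm]
    simp_rw [ENNReal.ofReal_mul hr0.le, mul_pow]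
    rw [lintegral_const_mul' _ _ (by finiteness), ← mul_assoc, ← ENNReal.ofReal_pow hr0.le, ← ENNReal.ofReal_mul (by positivity)]
    have e1 : (r * r ^ d)⁻¹ * r ^ (d + 1) = 1 := by rw [pow_succ', inv_mul_cancel₀ (by positivity)]
    rw [e1, ENNReal.ofReal_one, one_mul]
    have e2 : ∀ z, ENNReal.ofReal (max (g z) 0 + e z) = ‖max (g z) 0 + e z‖ₑ := fun z =>
      (Real.enorm_of_nonneg (add_nonneg (le_max_right _ _) (he0 z))).symm
    simp_rw [e2]
    rw [← eLp_pow (d := d) (volume.restrict G) (fun z => max (g z) 0 + e z), ENNReal.ofReal_pow hM0.le]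
    refine pow_le_pow_left' ?_ _
    have := eLpNorm_add_le (μ := volume.restrict G) (mg.max measurable_const).aestronglyMeasurable me.aestronglyMeasurable hp1
      (f := fun z => max (g z) 0) (g := e)
    refine this.trans ?_
    refine (add_le_add hI ((eLpNorm_mono_measure _ Measure.restrict_le_self).trans heL)).trans ?_
    rw [← ENNReal.ofReal_add (by linarith) hη.le, sub_add_cancel]
  · intro t ht x hx
    have h1 := hlat t ht x hx
    have h2 := abs_le.1 (hvu (A (t, x)) (hcG _ ⟨ht, by simpa using hx.le⟩))
    linarith [h2.1]
  · intro x hx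
    have h1 := htop x hx
    have h2 := abs_le.1 (hvu (A (2, x)) (hcG _ ⟨by simp, hx⟩))
    linarith [h2.1]
  · have h2 := abs_le.1 (hvu (A (0, 0)) (hcG _ ⟨by simp, by simp⟩))
    have h1 := hvx
    show v (A (0, 0)) ≤ M
    linarith [h2.2]

lemma exhaust {d : ℕ} {F : ZZ d → ℝ≥0∞} {C : ℝ≥0∞} {r0 : ℝ} (h0 : r0 < 1)
    (H : ∀ r, r0 ≤ r → r < 1 → ∫⁻ z in Ioo 1 (1 + r) ×ˢ Metric.ball 0 r, F z ≤ C) :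
    ∫⁻ z in Ioo 1 2 ×ˢ Metric.ball 0 1, F z ≤ C := by
  set s : ℕ → ℝ := fun n => 1 - (1 - r0) * (1 / ((n : ℝ) + 1)) with hs
  have hp : ∀ n : ℕ, 0 < 1 / ((n : ℝ) + 1) := fun n => Nat.one_div_pos_of_nat
  have hle : ∀ n : ℕ, 1 / ((n : ℝ) + 1) ≤ 1 := by
    intro n
    rw [div_le_one (by positivity)]
    linarith [Nat.cast_nonneg (α := ℝ) n]
  have hmono : Monotone s := by
    intro n m hnm
    have := Nat.one_div_le_one_div (α := ℝ) hnm
    simp only [hs]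
    nlinarith
  have hs1 : ∀ n, s n < 1 := by
    intro n
    have := mul_pos (sub_pos.2 h0) (hp n)
    simp only [hs]
    linarith
  have hs0 : ∀ n, r0 ≤ s n := by
    intro n
    have := hle n
    simp only [hs]
    nlinarith
  have hlim : ∀ y < 1, ∃ n, y < s n := by
    intro y hy
    obtain ⟨n, hn⟩ := exists_nat_one_div_lt (div_pos (sub_pos.2 hy) (sub_pos.2 h0))
    refine ⟨n, ?_⟩
    rw [lt_div_iff₀ (sub_pos.2 h0)] at hn
    simp only [hs]
    linarith
  have hU : (Ioo 1 2 ×ˢ Metric.ball 0 1 : Set (ZZ d)) = ⋃ n, Ioo 1 (1 + s n) ×ˢ Metric.ball 0 (s n) := by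
    ext ⟨t, x⟩
    simp only [mem_prod, mem_Ioo, Metric.mem_ball, mem_iUnion]
    constructor
    · rintro ⟨⟨h1, h2⟩, h3⟩
      obtain ⟨n, hn⟩ := hlim (max (t - 1) (dist x 0)) (max_lt (by linarith) h3)
      exact ⟨n, ⟨h1, by linarith [le_max_left (t - 1) (dist x 0)]⟩, lt_of_le_of_lt (le_max_right _ _) hn⟩
    · rintro ⟨n, ⟨h1, h2⟩, h3⟩
      have := hs1 n
      exact ⟨⟨h1, by linarith⟩, by linarith⟩
  rw [hU, setLIntegral_iUnion_of_directed]
  · exact iSup_le fun n => H _ (hs0 n) (hs1 n)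
  · refine Monotone.directed_le fun n m hnm => ?_
    have := hmono hnm
    exact prod_mono (Ioo_subset_Ioo_right (by linarith)) (Metric.ball_subset_ball this)

lemma shrink {d : ℕ} {u : ZZ d → ℝ} (hc : ContinuousOn u (cyl 0 2 0 1)) {η : ℝ} (hη : 0 < η) :
    ∃ r0 : ℝ, 1 / 2 ≤ r0 ∧ r0 < 1 ∧ ∀ r, r0 ≤ r → r < 1 → ∀ z ∈ cyl 0 2 0 1,
      |u (sc (1 - r) r 0 r z) - u z| ≤ η := by
  have huc := (isCompact_cyl (d := d) 0 2 0 1).uniformContinuousOn_of_continuous hc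
  obtain ⟨ε, hε, H⟩ := Metric.uniformContinuousOn_iff.1 huc η hη
  refine ⟨max (1 / 2) (1 - ε / 2), le_max_left _ _, max_lt (by norm_num) (by linarith), ?_⟩
  rintro r hr hr1 ⟨t, x⟩ hz
  have hra := (le_max_left _ _).trans hr
  have hrb := (le_max_right _ _).trans hr
  obtain ⟨⟨ht0, ht2⟩, hx⟩ := hz
  simp only [Metric.mem_closedBall, dist_zero_right] at ht0 ht2 hx
  have hmem : sc (1 - r) r 0 r (t, x) ∈ cyl (d := d) 0 2 0 1 := by
    refine ⟨⟨?_, ?_⟩, ?_⟩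
    · simp only [sc]; nlinarith
    · simp only [sc]; nlinarith
    · simp only [sc, zero_add, Metric.mem_closedBall, dist_zero_right, norm_smul, Real.norm_of_nonneg (by linarith : 0 ≤ r)]
      nlinarith [norm_nonneg x]
  have hd : dist (sc (1 - r) r 0 r (t, x)) (t, x) < ε := by
    simp only [sc, Prod.dist_eq]
    refine max_lt ?_ ?_
    · rw [Real.dist_eq]
      have : 1 - r + r * t - t = (1 - r) * (1 - t) := by ring
      rw [this, abs_lt]
      constructor <;> nlinarith
    · rw [dist_eq_norm]
      have : (0 : EE d) + r • x - x = (r - 1) • x := by module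
      rw [this, norm_smul, Real.norm_eq_abs, abs_of_neg (by linarith)]
      nlinarith [norm_nonneg x]
  have := H _ hmem (t, x) ⟨⟨ht0, ht2⟩, by simpa using hx⟩ hd
  rw [Real.dist_eq] at this
  exact this.le

lemma rpow_limit {X : ℝ≥0∞} {N M0 γ : ℝ} (hγ : 0 < γ)
    (H : ∀ η : ℝ, 0 < η → X ≤ ENNReal.ofReal (N * (M0 + 2 * η) ^ γ)) : X ≤ ENNReal.ofReal (N * M0 ^ γ) := by
  have hcont : Continuous fun η : ℝ => ENNReal.ofReal (N * (M0 + 2 * η) ^ γ) := by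
    refine ENNReal.continuous_ofReal.comp (continuous_const.mul ?_)
    exact (continuous_const.add (continuous_const.mul continuous_id)).rpow_const fun x => Or.inr hγ.le
  have ht : Filter.Tendsto (fun η : ℝ => ENNReal.ofReal (N * (M0 + 2 * η) ^ γ)) (nhdsWithin 0 (Ioi 0))
      (nhds (ENNReal.ofReal (N * M0 ^ γ))) := by
    have := (hcont.tendsto 0).mono_left (nhdsWithin_le_nhds (s := Ioi 0))
    simpa using this
  refine ge_of_tendsto ht ?_
  filter_upwards [self_mem_nhdsWithin] with η hη using H η hη

lemma split3 {N B S V γ : ℝ} (hN : 0 < N) (hB : 0 ≤ B) (hS : 0 ≤ S) (hV : 0 ≤ V) (hγ0 : 0 < γ) (hγ1 : γ ≤ 1) :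
    ENNReal.ofReal (N * (B + S + V) ^ γ) ≤ ENNReal.ofReal N * ENNReal.ofReal (B ^ γ)
      + ENNReal.ofReal N * ENNReal.ofReal (V ^ γ) + ENNReal.ofReal N * ENNReal.ofReal (S ^ γ) := by
  rw [← ENNReal.ofReal_mul hN.le, ← ENNReal.ofReal_mul hN.le, ← ENNReal.ofReal_mul hN.le,
    ← ENNReal.ofReal_add (by positivity) (by positivity), ← ENNReal.ofReal_add (by positivity) (by positivity)]
  refine ENNReal.ofReal_le_ofReal ?_
  have h1 := Real.rpow_add_le_add_rpow (add_nonneg hB hS) hV hγ0.le hγ1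
  have h2 := Real.rpow_add_le_add_rpow hB hS hγ0.le hγ1
  nlinarith

lemma sup_bound {d : ℕ} {u : ZZ d → ℝ} (hc : ContinuousOn u (cyl 0 2 0 1)) {s : Set (ZZ d)} (hs : s ⊆ cyl 0 2 0 1) :
    0 ≤ (⨆ z ∈ s, max (-u z) 0) ∧ ∀ z ∈ s, -(⨆ z ∈ s, max (-u z) 0) ≤ u z := by
  refine ⟨Real.iSup_nonneg fun z => Real.iSup_nonneg fun _ => le_max_right _ _, ?_⟩
  intro z hz
  obtain ⟨C, hC⟩ := (isCompact_cyl (d := d) 0 2 0 1).exists_bound_of_continuousOn hc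
  have hb : BddAbove (range fun z => ⨆ (_ : z ∈ s), max (-u z) 0) := by
    refine ⟨max C 0, ?_⟩
    rintro _ ⟨y, rfl⟩
    refine Real.iSup_le (fun hy => ?_) (le_max_right _ _)
    refine max_le_max ?_ le_rfl
    have := hC y (hs hy)
    rw [Real.norm_eq_abs] at this
    linarith [neg_abs_le (u y)]
  have h1 := le_ciSup hb z
  have h2 : (⨆ (_ : z ∈ s), max (-u z) 0) = max (-u z) 0 := ciSup_pos hz
  rw [h2] at h1
  linarith [le_max_left (-u z) 0]

/-- **Lemma 1.6.** There are constants `γ ∈ (0,1]` and `N` depending only on `δ`, `K`, `d`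
such that, if `L ∈ 𝔏_{δ,K}`, `u ∈ W^{1,2}_{d+1,loc}(C_{2,1}) ∩ C(C̄_{2,1})`, and
`Lu = g - f` in `C_{2,1}` with `f ≥ 0`, then
`∫_{C_{1,1}(1,0)} |f|^γ ≤ N (∫_{C_{2,1}} |g₊|^{d+1})^{γ/(d+1)} + N |u₊(0,0)|^γ
  + N sup_{∂'C_{2,1}} |u₋|^γ`. -/
theorem parabolic_estimate_of_decomposition
    (d : ℕ) (hd : 1 ≤ d) (δ K : ℝ) (hδ0 : 0 < δ) (hδ1 : δ < 1) (hK : 0 ≤ K) :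
    ∃ γ N : ℝ, γ ∈ Set.Ioc (0 : ℝ) 1 ∧ 0 < N ∧
      ∀ (a : ℝ × EuclideanSpace ℝ (Fin d) → Matrix (Fin d) (Fin d) ℝ)
        (b : ℝ × EuclideanSpace ℝ (Fin d) → EuclideanSpace ℝ (Fin d))
        (c : ℝ × EuclideanSpace ℝ (Fin d) → ℝ)
        (u ut : ℝ × EuclideanSpace ℝ (Fin d) → ℝ)
        (du : ℝ × EuclideanSpace ℝ (Fin d) → EuclideanSpace ℝ (Fin d))
        (d2u : ℝ × EuclideanSpace ℝ (Fin d) → Matrix (Fin d) (Fin d) ℝ)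
        (f g : ℝ × EuclideanSpace ℝ (Fin d) → ℝ),
        -- measurability of the coefficients of `L ∈ 𝔏_{δ,K}`
        (∀ i j, Measurable fun z => a z i j) →
        (∀ i, Measurable fun z => b z i) →
        Measurable c →
        -- `a` is `S_δ`-valued
        (∀ z, (a z).IsSymm) →
        (∀ z (ξ : EuclideanSpace ℝ (Fin d)),
          δ * ‖ξ‖ ^ 2 ≤ ∑ i, ∑ j, a z i j * ξ i * ξ j ∧
          ∑ i, ∑ j, a z i j * ξ i * ξ j ≤ δ⁻¹ * ‖ξ‖ ^ 2) →
        -- `|b| + c ≤ K`, `c ≥ 0`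
        (∀ z, ‖b z‖ + c z ≤ K) →
        (∀ z, 0 ≤ c z) →
        -- measurability
        Measurable u → Measurable ut →
        (∀ i, Measurable fun z => du z i) →
        (∀ i j, Measurable fun z => d2u z i j) →
        Measurable f → Measurable g →
        -- `u ∈ C(C̄_{2,1})`
        ContinuousOn u (closure (Set.Ioo (0 : ℝ) 2 ×ˢ Metric.ball (0 : EuclideanSpace ℝ (Fin d)) 1)) →
        -- `ut = ∂ₜu`, `du = Du`, `d2u = D²u` pointwise in `C_{2,1}`
        (∀ z ∈ Set.Ioo (0 : ℝ) 2 ×ˢ Metric.ball (0 : EuclideanSpace ℝ (Fin d)) 1,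
          HasDerivAt (fun s => u (s, z.2)) (ut z) z.1) →
        (∀ z ∈ Set.Ioo (0 : ℝ) 2 ×ˢ Metric.ball (0 : EuclideanSpace ℝ (Fin d)) 1, ∀ i,
          HasDerivAt (fun s : ℝ => u (z.1, z.2 + s • EuclideanSpace.single i (1 : ℝ))) (du z i) 0) →
        (∀ z ∈ Set.Ioo (0 : ℝ) 2 ×ˢ Metric.ball (0 : EuclideanSpace ℝ (Fin d)) 1, ∀ i j,
          HasDerivAt (fun s : ℝ => du (z.1, z.2 + s • EuclideanSpace.single j (1 : ℝ)) i)
            (d2u z i j) 0) →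
        -- `u ∈ W^{1,2}_{d+1,loc}(C_{2,1})`
        (∀ G : Set (ℝ × EuclideanSpace ℝ (Fin d)), IsCompact G →
          G ⊆ Set.Ioo (0 : ℝ) 2 ×ˢ Metric.ball (0 : EuclideanSpace ℝ (Fin d)) 1 →
          IntegrableOn (fun z => |ut z| ^ ((d : ℝ) + 1) + ‖du z‖ ^ ((d : ℝ) + 1) +
            frobNorm (d2u z) ^ ((d : ℝ) + 1)) G volume) →
        -- `f ≥ 0` and `Lu = g - f` in `C_{2,1}`
        (∀ z ∈ Set.Ioo (0 : ℝ) 2 ×ˢ Metric.ball (0 : EuclideanSpace ℝ (Fin d)) 1, 0 ≤ f z) →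
        (∀ z ∈ Set.Ioo (0 : ℝ) 2 ×ˢ Metric.ball (0 : EuclideanSpace ℝ (Fin d)) 1,
          ut z + (∑ i, ∑ j, a z i j * d2u z i j) + (∑ i, b z i * du z i) - c z * u z
            = g z - f z) →
        (∫⁻ z in Set.Ioo (1 : ℝ) 2 ×ˢ Metric.ball (0 : EuclideanSpace ℝ (Fin d)) 1,
            ENNReal.ofReal |f z| ^ γ ∂volume)
          ≤ ENNReal.ofReal N *
              (∫⁻ z in Set.Ioo (0 : ℝ) 2 ×ˢ Metric.ball (0 : EuclideanSpace ℝ (Fin d)) 1,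
                ENNReal.ofReal (max (g z) 0) ^ ((d : ℝ) + 1) ∂volume) ^ (γ / ((d : ℝ) + 1))
            + ENNReal.ofReal N *
              ENNReal.ofReal (|max (u ((0 : ℝ), (0 : EuclideanSpace ℝ (Fin d)))) 0| ^ γ)
            + ENNReal.ofReal N *
              ENNReal.ofReal
                ((⨆ z ∈ (Set.Icc (0 : ℝ) 2 ×ˢ Metric.sphere (0 : EuclideanSpace ℝ (Fin d)) 1 ∪
                    {(2 : ℝ)} ×ˢ Metric.ball (0 : EuclideanSpace ℝ (Fin d)) 1),
                  max (-u z) 0) ^ γ) := by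
  obtain ⟨γ, N, hγ0, hγ1, hN, HS⟩ := smooth_est d (half_pos hδ0) hK
  refine ⟨γ, N, ⟨hγ0, hγ1⟩, hN, ?_⟩
  intro a b c u ut du d2u f g _ _ _ hsym hell hbc hc0 mu mutt mdu md2 mf mg hcont h1 h2 h3 hI hf0 hL
  set Om : Set (ZZ d) := Set.Ioo (0 : ℝ) 2 ×ˢ Metric.ball (0 : EuclideanSpace ℝ (Fin d)) 1 with hOmd
  have hOm : IsOpen Om := isOpen_Ioo.prod Metric.isOpen_ball
  have hclos : closure Om = cyl 0 2 0 1 := by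
    rw [hOmd, closure_prod_eq, closure_Ioo (by norm_num), closure_ball _ one_ne_zero]
    rfl
  rw [hclos] at hcont
  have hOc : Om ⊆ cyl 0 2 0 1 := hclos ▸ subset_closure
  have hA : ∀ z, Adm δ K (a z) (b z) (c z) := fun z =>
    ⟨fun ξ => (hell z ξ).1, fun ξ => (hell z ξ).2, hbc z, hc0 z⟩
  set P : Set (ZZ d) := Set.Icc (0 : ℝ) 2 ×ˢ Metric.sphere (0 : EuclideanSpace ℝ (Fin d)) 1 ∪
                    {(2 : ℝ)} ×ˢ Metric.ball (0 : EuclideanSpace ℝ (Fin d)) 1 with hP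
  have hPc : P ⊆ cyl 0 2 0 1 := by
    refine union_subset (prod_mono subset_rfl Metric.sphere_subset_closedBall)
      (prod_mono ?_ Metric.ball_subset_closedBall)
    rintro _ rfl
    exact ⟨zero_le_two, le_rfl⟩
  obtain ⟨hS0, hSu⟩ := sup_bound hcont hPc
  set S : ℝ := ⨆ z ∈ P, max (-u z) 0 with hSd
  set I : ℝ≥0∞ := ∫⁻ z in Om, ENNReal.ofReal (max (g z) 0) ^ ((d : ℝ) + 1) ∂volume with hId
  have hd1 : 0 < (d : ℝ) + 1 := by positivity
  by_cases hItop : I = ⊤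
  · rw [hItop, ENNReal.top_rpow_of_pos (div_pos hγ0 hd1), ENNReal.mul_top (by simpa using hN)]
    simp
  set B : ℝ := I.toReal ^ (1 / ((d : ℝ) + 1)) with hBd
  have hB0 : 0 ≤ B := by positivity
  set V : ℝ := max (u ((0 : ℝ), (0 : EuclideanSpace ℝ (Fin d)))) 0 with hVd
  have hV0 : 0 ≤ V := le_max_right _ _
  have hBp : B ^ (d + 1) = I.toReal := by
    rw [hBd, ← Real.rpow_natCast, ← Real.rpow_mul ENNReal.toReal_nonneg]
    push_cast
    rw [one_div, inv_mul_cancel₀ hd1.ne', Real.rpow_one]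
  have hBγ : ENNReal.ofReal (B ^ γ) = I ^ (γ / ((d : ℝ) + 1)) := by
    rw [hBd, ← Real.rpow_mul ENNReal.toReal_nonneg, ← ENNReal.ofReal_rpow_of_nonneg ENNReal.toReal_nonneg (by positivity),
      ENNReal.ofReal_toReal hItop]
    congr 1
    ring
  have hgO : eLpNorm (fun z => max (g z) 0) ((d + 1 : ℕ) : ℝ≥0∞) (volume.restrict Om) ≤ ENNReal.ofReal B := by
    refine (ENNReal.pow_le_pow_left_iff (Nat.succ_ne_zero d)).1 ?_
    rw [Nat.succ_eq_add_one, eLp_pow, ← ENNReal.ofReal_pow hB0, hBp, ENNReal.ofReal_toReal hItop, hId]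
    refine lintegral_mono fun z => le_of_eq ?_
    rw [Real.enorm_of_nonneg (le_max_right _ _), ← ENNReal.rpow_natCast]
    push_cast
    rfl
  have hfabs : ∫⁻ z in Set.Ioo (1 : ℝ) 2 ×ˢ Metric.ball (0 : EuclideanSpace ℝ (Fin d)) 1,
      ENNReal.ofReal |f z| ^ γ ∂volume = ∫⁻ z in Ioo 1 2 ×ˢ Metric.ball 0 1, ENNReal.ofReal (f z) ^ γ := by
    refine setLIntegral_congr_fun (measurableSet_Ioo.prod Metric.isOpen_ball.measurableSet) fun z hz => ?_
    have hz0 : z ∈ Om := ⟨⟨by linarith [hz.1.1], hz.1.2⟩, hz.2⟩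
    simp only [abs_of_nonneg (hf0 z hz0)]
  rw [hfabs, ← hBγ, abs_of_nonneg hV0]
  refine le_trans ?_ (split3 hN hB0 hS0 hV0 hγ0 hγ1)
  refine rpow_limit hγ0 fun η hη => ?_
  obtain ⟨r0, hr0, hr01, Hr⟩ := shrink hcont hη
  refine exhaust hr01 fun r hr hr1 => ?_
  have hrp : 0 < r := by linarith
  have Hr' := Hr r hr hr1
  set G : Set (ZZ d) := sc (1 - r) r 0 r '' cyl 0 2 0 1 with hGd
  have hG : IsCompact G := (isCompact_cyl 0 2 0 1).image (sc_contDiff (1 - r) r (0 : EE d) r).continuous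
  have hGO : G ⊆ Om := by
    rintro _ ⟨⟨t, x⟩, ⟨⟨ht0, ht2⟩, hx⟩, rfl⟩
    simp only [Metric.mem_closedBall, dist_zero_right] at ht0 ht2 hx
    refine ⟨⟨?_, ?_⟩, ?_⟩
    · simp only [sc]; nlinarith
    · simp only [sc]; nlinarith
    · simp only [sc, zero_add, Metric.mem_ball, dist_zero_right, norm_smul, Real.norm_of_nonneg hrp.le]
      nlinarith [norm_nonneg x]
  obtain ⟨v, e, vs, me, he0, hvu, heL, hLop⟩ := approx hδ0 hK hOm mu mutt mdu md2 (hcont.mono hOc) h1 h2 h3 hI hG hGO hη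
  have hbot : ∀ z ∈ P, -(B + S + V + 2 * η - η) ≤ u (sc (1 - r) r 0 r z) := by
    intro z hz
    have e1 := hSu z hz
    have e2 := abs_le.1 (Hr' z (hPc hz))
    linarith [e2.1]
  refine core (L := fun z => ut z + (∑ i, ∑ j, a z i j * d2u z i j) + (∑ i, b z i * du z i) - c z * u z)
    hδ0 hK hγ0 hγ1 HS hη (by linarith) (hr0.trans hr) hr1 hA mf mg hG
    (fun z hz => ⟨z, hz, rfl⟩) (fun z hz => hL z (hGO hz)) (fun z hz => hf0 z (hGO hz)) vs me he0 hvu heL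
    (fun z hz => hLop z hz _ _ _ (hA z) (hsym z)) ?_ ?_ ?_ ?_
  · refine (eLpNorm_mono_measure _ (Measure.restrict_mono hGO le_rfl)).trans (hgO.trans ?_)
    exact ENNReal.ofReal_le_ofReal (by linarith)
  · intro t ht x hx
    exact hbot (t, x) (Or.inl ⟨ht, hx⟩)
  · intro x hx
    rcases eq_or_lt_of_le (Metric.mem_closedBall.1 hx) with h | h
    · exact hbot (2, x) (Or.inl ⟨⟨zero_le_two, le_rfl⟩, h⟩)
    · exact hbot (2, x) (Or.inr ⟨rfl, h⟩)
  · have e2 := abs_le.1 (Hr' (0, 0) ⟨⟨le_rfl, zero_le_two⟩, by simp⟩)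
    have e3 : u (0, 0) ≤ V := le_max_left _ _
    linarith [e2.2]
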